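/- Let $k$ and $\ell$ be multiplicatively independent integers, each at least $2$, let $m$ and $n$ be positive integers, and let $a_1, \ldots, a_n, b_1, \ldots, b_m$ be nonzero rational numbers. Then there are at most $(8(n+m-1))^{10(n+m)^5 - 4(n+m-1)^4}$ tuples $(X_1, \ldots, X_n, Y_1, \ldots, Y_m)$ of rational numbers satisfying $a_1 X_1 + \cdots + a_n X_n + b_1 Y_1 + \cdots + b_m Y_m = 0$, in which each $X_i$ is an integer power of $k$, each $Y_j$ is an integer power of $\ell$, and no proper nonempty subsum of the left-hand side vanishes (i.e., for every nonempty proper subset of the $n+m$ terms $a_i X_i, b_j Y_j$, the sum of that subset of terms is nonzero). -/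

import Mathlib

/-- Two natural numbers `k, ℓ ≥ 2` are multiplicatively independent if
`k^a = ℓ^b` with integers `a, b` implies `a = b = 0`. -/
def MultIndep (k l : ℕ) : Prop :=
  ∀ a b : ℤ, (k : ℚ) ^ a = (l : ℚ) ^ b → a = 0 ∧ b = 0

namespace SUnit

/-- The multiplicative height of a rational number. -/
def mulHeight (q : ℚ) : ℕ := max q.num.natAbs q.den

/-- The logarithmic height of a rational number. -/
noncomputable def ht (q : ℚ) : ℝ := Real.log (mulHeight q)

theorem one_le_mulHeight (q : ℚ) : 1 ≤ mulHeight q :=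
  le_max_of_le_right q.pos

theorem ht_nonneg (q : ℚ) : 0 ≤ ht q :=
  Real.log_nonneg (by exact_mod_cast one_le_mulHeight q)

theorem exp_ht (q : ℚ) : Real.exp (ht q) = mulHeight q :=
  Real.exp_log (by exact_mod_cast one_le_mulHeight q)

theorem den_le_exp_ht (q : ℚ) : (q.den : ℝ) ≤ Real.exp (ht q) := by
  rw [exp_ht]; exact_mod_cast le_max_right _ _

theorem abs_num_le_exp_ht (q : ℚ) : |(q.num : ℝ)| ≤ Real.exp (ht q) := by
  rw [exp_ht, ← Int.cast_abs, Int.abs_eq_natAbs]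
  exact_mod_cast le_max_left _ _

theorem abs_eq_num_div_den (q : ℚ) : |(q : ℝ)| = |(q.num : ℝ)| / q.den := by
  conv_lhs => rw [← Rat.num_div_den q]
  push_cast
  rw [abs_div, Nat.abs_cast]

theorem abs_le_exp_ht (q : ℚ) : |(q : ℝ)| ≤ Real.exp (ht q) := by
  rw [abs_eq_num_div_den]
  have h1 : (1 : ℝ) ≤ q.den := by exact_mod_cast q.pos
  exact (div_le_self (abs_nonneg _) h1).trans (abs_num_le_exp_ht q)

theorem inv_den_le_abs {q : ℚ} (hq : q ≠ 0) : (1 : ℝ) / q.den ≤ |(q : ℝ)| := by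
  rw [abs_eq_num_div_den]
  have h1 : (1 : ℝ) ≤ |(q.num : ℝ)| := by
    rw [← Int.cast_abs]; exact_mod_cast Int.one_le_abs (Rat.num_ne_zero.mpr hq)
  gcongr

theorem exp_neg_ht_le_abs {q : ℚ} (hq : q ≠ 0) : Real.exp (-ht q) ≤ |(q : ℝ)| := by
  refine le_trans ?_ (inv_den_le_abs hq)
  rw [Real.exp_neg, ← one_div]
  exact one_div_le_one_div_of_le (by exact_mod_cast q.pos) (den_le_exp_ht q)

theorem inv_den_le_abs_one_sub {q : ℚ} (hq : q ≠ 1) : (1 : ℝ) / q.den ≤ |1 - (q : ℝ)| := by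
  have h0 : (1 : ℚ) - q ≠ 0 := sub_ne_zero.mpr (Ne.symm hq)
  have hd : (q.den : ℚ) ≠ 0 := by exact_mod_cast q.pos.ne'
  have h : (1 - (q : ℝ)) = ((q.den - q.num : ℤ) : ℝ) / q.den := by
    have : (1 - q : ℚ) = ((q.den - q.num : ℤ) : ℚ) / q.den := by
      rw [eq_div_iff hd]; push_cast; rw [sub_mul, one_mul, Rat.mul_den_eq_num]
    exact_mod_cast congrArg (fun x : ℚ => (x : ℝ)) this
  have hne : ((q.den : ℤ) - q.num) ≠ 0 := by
    intro h'
    rw [h', Int.cast_zero, zero_div] at h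
    exact h0 (by exact_mod_cast h)
  rw [h, abs_div, Nat.abs_cast, ← Int.cast_abs]
  have : (1 : ℝ) ≤ (|(q.den : ℤ) - q.num| : ℤ) := by exact_mod_cast Int.one_le_abs hne
  gcongr

theorem ht_div_le {p d : ℤ} (hd : d ≠ 0) {B : ℝ} (hp : |(p : ℝ)| ≤ B) (hdB : |(d : ℝ)| ≤ B) :
    ht ((p : ℚ) / d) ≤ Real.log B := by
  have h1 : ((p : ℚ) / d) = Rat.divInt p d := (Rat.divInt_eq_div p d).symm
  refine Real.log_le_log (by exact_mod_cast one_le_mulHeight _) ?_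
  have hd1 : (1 : ℝ) ≤ |(d : ℝ)| := by
    rw [← Int.cast_abs]; exact_mod_cast Int.one_le_abs hd
  rw [h1, mulHeight, Nat.cast_max]
  refine max_le ?_ ?_
  · by_cases hp0 : p = 0
    · subst hp0; simp; linarith [abs_nonneg (d : ℝ)]
    · have h := Int.le_of_dvd (abs_pos.mpr hp0) ((abs_dvd_abs _ _).mpr (Rat.num_dvd p hd))
      refine le_trans ?_ hp
      rw [Nat.cast_natAbs, ← Int.cast_abs]
      exact Int.cast_le.mpr h
  · have h := Int.le_of_dvd (abs_pos.mpr hd)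
      ((dvd_abs _ _).mpr (Rat.den_dvd p d))
    refine le_trans ?_ hdB
    rw [← Int.cast_abs]; exact_mod_cast h

theorem ht_zero : ht 0 = 0 := by simp [ht, mulHeight]

theorem ht_inv (q : ℚ) : ht q⁻¹ = ht q := by
  rcases eq_or_ne q 0 with rfl | hq
  · simp
  · simp only [ht, mulHeight, Rat.num_inv, Rat.den_inv]
    have : (q.num.sign * (q.den : ℤ)).natAbs = q.den := by
      rw [Int.natAbs_mul, Int.natAbs_sign_of_ne_zero (Rat.num_ne_zero.mpr hq)]; simp
    simp [this, hq, max_comm]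

theorem ht_neg (q : ℚ) : ht (-q) = ht q := by
  simp [ht, mulHeight]

theorem ht_mul_le (q r : ℚ) : ht (q * r) ≤ ht q + ht r := by
  have h : q * r = ((q.num * r.num : ℤ) : ℚ) / ((q.den * r.den : ℤ) : ℚ) := by
    push_cast
    rw [mul_div_mul_comm, Rat.num_div_den, Rat.num_div_den]
  rw [h, ← Real.log_exp (ht q + ht r), Real.exp_add]
  have hd : ((q.den : ℤ) * r.den) ≠ 0 := by
    exact_mod_cast (Nat.mul_pos q.pos r.pos).ne'
  refine ht_div_le hd ?_ ?_
  · push_cast; rw [abs_mul]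
    exact mul_le_mul (abs_num_le_exp_ht q) (abs_num_le_exp_ht r) (abs_nonneg _)
      (Real.exp_pos _).le
  · push_cast; rw [abs_mul, Nat.abs_cast, Nat.abs_cast]
    exact mul_le_mul (den_le_exp_ht q) (den_le_exp_ht r) (Nat.cast_nonneg _)
      (Real.exp_pos _).le

theorem ht_div_le_add (q r : ℚ) : ht (q / r) ≤ ht q + ht r := by
  rw [div_eq_mul_inv, ← ht_inv r]; exact ht_mul_le _ _

theorem ht_sum_le {ι : Type*} (s : Finset ι) (hs : s.Nonempty) (f : ι → ℚ) :
    ht (∑ i ∈ s, f i) ≤ ∑ i ∈ s, ht (f i) + Real.log s.card := by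
  classical
  have key : ∑ i ∈ s, f i =
      ((∑ i ∈ s, (f i).num * ∏ j ∈ s.erase i, ((f j).den : ℤ) : ℤ) : ℚ) /
        ((∏ j ∈ s, ((f j).den : ℤ) : ℤ) : ℚ) := by
    have hd : ((∏ j ∈ s, ((f j).den : ℤ) : ℤ) : ℚ) ≠ 0 := by
      push_cast; exact Finset.prod_ne_zero_iff.mpr fun i _ => by exact_mod_cast (f i).pos.ne'
    rw [eq_div_iff hd, Finset.sum_mul]
    push_cast
    refine Finset.sum_congr rfl fun i hi => ?_
    rw [← Finset.mul_prod_erase s _ hi, ← mul_assoc, Rat.mul_den_eq_num]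
  have hc : (1 : ℝ) ≤ s.card := by exact_mod_cast hs.card_pos
  have hlog : ∑ i ∈ s, ht (f i) + Real.log s.card
      = Real.log ((∏ i ∈ s, Real.exp (ht (f i))) * s.card) := by
    rw [Real.log_mul (by positivity) (by positivity), ← Real.exp_sum, Real.log_exp]
  have h1 : ∀ i, (1 : ℝ) ≤ Real.exp (ht (f i)) := fun i => Real.one_le_exp (ht_nonneg _)
  rw [key, hlog]
  refine ht_div_le ?_ ?_ ?_
  · exact Finset.prod_ne_zero_iff.mpr fun i _ => by exact_mod_cast (f i).pos.ne'
  · push_cast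
    refine (Finset.abs_sum_le_sum_abs _ _).trans ?_
    rw [mul_comm, ← nsmul_eq_mul]
    refine Finset.sum_le_card_nsmul _ _ _ fun i hi => ?_
    rw [← Finset.mul_prod_erase s _ hi, abs_mul, Finset.abs_prod]
    refine mul_le_mul (abs_num_le_exp_ht _) ?_ (by positivity) (by positivity)
    exact Finset.prod_le_prod (fun _ _ => abs_nonneg _) fun j _ => by
      rw [Nat.abs_cast]; exact den_le_exp_ht _
  · push_cast
    rw [Finset.abs_prod]
    have : ∏ i ∈ s, |((f i).den : ℝ)| ≤ ∏ i ∈ s, Real.exp (ht (f i)) :=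
      Finset.prod_le_prod (fun _ _ => abs_nonneg _) fun j _ => by
        rw [Nat.abs_cast]; exact den_le_exp_ht _
    refine this.trans (le_mul_of_one_le_right (by positivity) hc)

end SUnit

namespace SUnit

theorem cast_eq_prod_pow {k : ℕ} (hk : k ≠ 0) {S : Finset ℕ} (hS : k.primeFactors ⊆ S) :
    k = ∏ p ∈ S, p ^ k.factorization p := by
  conv_lhs => rw [← Nat.prod_factorization_pow_eq_self hk]
  exact Finsupp.prod_of_support_subset _ (by simpa using hS) _ (by simp)

theorem log_eq_sum_factorization {k : ℕ} (hk : k ≠ 0) {S : Finset ℕ} (hS : k.primeFactors ⊆ S)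
    (hp : ∀ p ∈ S, p.Prime) : Real.log k = ∑ p ∈ S, k.factorization p * Real.log p := by
  conv_lhs => rw [cast_eq_prod_pow hk hS]
  push_cast
  rw [Real.log_prod fun p h => pow_ne_zero _ (by exact_mod_cast (hp p h).ne_zero)]
  exact Finset.sum_congr rfl fun p _ => Real.log_pow _ _

theorem log_max {a b : ℝ} (ha : 0 < a) (hb : 0 < b) :
    2 * Real.log (max a b) = |Real.log a - Real.log b| + (Real.log a + Real.log b) := by
  rcases le_total a b with h | h
  · rw [max_eq_right h, abs_of_nonpos (by linarith [Real.log_le_log ha h])]; ring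
  · rw [max_eq_left h, abs_of_nonneg (by linarith [Real.log_le_log hb h])]; ring

theorem two_mul_ht_prod_zpow (S : Finset ℕ) (hp : ∀ p ∈ S, p.Prime) (z : ℕ → ℤ) :
    2 * ht (∏ p ∈ S, (p : ℚ) ^ z p) =
      |∑ p ∈ S, z p * Real.log p| + ∑ p ∈ S, |(z p : ℝ)| * Real.log p := by
  set A : ℕ := ∏ p ∈ S, p ^ (z p).toNat
  set B : ℕ := ∏ p ∈ S, p ^ (-z p).toNat
  have hA : A ≠ 0 := Finset.prod_ne_zero_iff.mpr fun p h => pow_ne_zero _ (hp p h).ne_zero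
  have hB : B ≠ 0 := Finset.prod_ne_zero_iff.mpr fun p h => pow_ne_zero _ (hp p h).ne_zero
  have hcop : A.Coprime B := by
    refine Nat.Coprime.prod_left fun p h => Nat.Coprime.prod_right fun q h' => ?_
    rcases eq_or_ne p q with rfl | hpq
    · rcases le_total 0 (z p) with h0 | h0
      · have : (-z p).toNat = 0 := by omega
        simp [this]
      · have : (z p).toNat = 0 := by omega
        simp [this]
    · exact Nat.Coprime.pow _ _ ((Nat.coprime_primes (hp p h) (hp q h')).mpr hpq)
  have hr : (∏ p ∈ S, (p : ℚ) ^ z p) = ((A : ℤ) : ℚ) / ((B : ℤ) : ℚ) := by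
    simp only [A, B]
    push_cast
    rw [← Finset.prod_div_distrib]
    refine Finset.prod_congr rfl fun p h => ?_
    have h0 : (p : ℚ) ≠ 0 := by exact_mod_cast (hp p h).ne_zero
    rw [← zpow_natCast, ← zpow_natCast, ← zpow_sub₀ h0]
    congr 1; omega
  have hBpos : (0 : ℤ) < B := by exact_mod_cast Nat.pos_of_ne_zero hB
  have hnum := Rat.num_div_eq_of_coprime (a := (A : ℤ)) hBpos (by simpa using hcop)
  have hden := Rat.den_div_eq_of_coprime (a := (A : ℤ)) hBpos (by simpa using hcop)
  rw [hr, ht, mulHeight, hnum]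
  have hden' : ((A : ℤ) / (B : ℤ) : ℚ).den = B := by exact_mod_cast hden
  rw [hden', Int.natAbs_natCast, Nat.cast_max, log_max (by positivity) (by positivity)]
  have hlA : Real.log A = ∑ p ∈ S, (z p).toNat * Real.log p := by
    simp only [A]; push_cast
    rw [Real.log_prod fun p h => pow_ne_zero _ (by exact_mod_cast (hp p h).ne_zero)]
    exact Finset.sum_congr rfl fun p _ => Real.log_pow _ _
  have hlB : Real.log B = ∑ p ∈ S, (-z p).toNat * Real.log p := by
    simp only [B]; push_cast
    rw [Real.log_prod fun p h => pow_ne_zero _ (by exact_mod_cast (hp p h).ne_zero)]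
    exact Finset.sum_congr rfl fun p _ => Real.log_pow _ _
  have e1 : ∀ w : ℤ, ((w.toNat : ℝ) - ((-w).toNat : ℝ)) = w := fun w => by
    have : ((w.toNat : ℤ) - ((-w).toNat : ℤ)) = w := by omega
    exact_mod_cast this
  have e2 : ∀ w : ℤ, ((w.toNat : ℝ) + ((-w).toNat : ℝ)) = |(w : ℝ)| := fun w => by
    have : ((w.toNat : ℤ) + ((-w).toNat : ℤ)) = |w| := by
      rcases abs_cases w with h | h <;> omega
    exact_mod_cast this
  rw [hlA, hlB, ← Finset.sum_sub_distrib, ← Finset.sum_add_distrib]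
  simp only [← sub_mul, ← add_mul, e1, e2]

/-- Heights of quotients `k ^ x / l ^ y` are controlled, up to constants, by the
archimedean distance of the logarithms and a single parameter `τ` depending on `k` and `l`. -/
theorem exists_height_param (k l : ℕ) (hk : 2 ≤ k) (hl : 2 ≤ l) :
    ∃ τ : ℝ, 0 ≤ τ ∧ τ ≤ 1 ∧ ∀ x y : ℤ,
      ht ((k : ℚ) ^ x / (l : ℚ) ^ y) ≤
        |x * Real.log k - y * Real.log l| + τ * |x * Real.log k| ∧
      ht ((k : ℚ) ^ x / (l : ℚ) ^ y) ≤
        |x * Real.log k - y * Real.log l| + τ * |y * Real.log l| ∧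
      τ * |x * Real.log k| ≤ ht ((k : ℚ) ^ x / (l : ℚ) ^ y) ∧
      τ * |y * Real.log l| ≤ ht ((k : ℚ) ^ x / (l : ℚ) ^ y) ∧
      |x * Real.log k - y * Real.log l| ≤ ht ((k : ℚ) ^ x / (l : ℚ) ^ y) := by
  have hk0 : k ≠ 0 := by omega
  have hl0 : l ≠ 0 := by omega
  set S := k.primeFactors ∪ l.primeFactors
  have hp : ∀ p ∈ S, p.Prime := by
    intro p h
    rcases Finset.mem_union.mp h with h | h <;> exact Nat.prime_of_mem_primeFactors h
  have hkS : k.primeFactors ⊆ S := Finset.subset_union_left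
  have hlS : l.primeFactors ⊆ S := Finset.subset_union_right
  have hlk : 0 < Real.log k := Real.log_pos (by exact_mod_cast hk)
  have hll : 0 < Real.log l := Real.log_pos (by exact_mod_cast hl)
  set κ : ℕ → ℝ := fun p => k.factorization p * Real.log p / Real.log k
  set μ : ℕ → ℝ := fun p => l.factorization p * Real.log p / Real.log l
  have hκ0 : ∀ p, 0 ≤ κ p := fun p => by
    have := Real.log_natCast_nonneg p; simp only [κ]; positivity
  have hμ0 : ∀ p, 0 ≤ μ p := fun p => by
    have := Real.log_natCast_nonneg p; simp only [μ]; positivity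
  have hκ : ∑ p ∈ S, κ p = 1 := by
    simp only [κ]
    rw [← Finset.sum_div, ← log_eq_sum_factorization hk0 hkS hp, div_self hlk.ne']
  have hμ : ∑ p ∈ S, μ p = 1 := by
    simp only [μ]
    rw [← Finset.sum_div, ← log_eq_sum_factorization hl0 hlS hp, div_self hll.ne']
  refine ⟨(∑ p ∈ S, |κ p - μ p|) / 2, by positivity, ?_, fun x y => ?_⟩
  · have : ∑ p ∈ S, |κ p - μ p| ≤ ∑ p ∈ S, (κ p + μ p) :=
      Finset.sum_le_sum fun p _ => by
        rw [abs_le]; constructor <;> linarith [hκ0 p, hμ0 p]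
    rw [Finset.sum_add_distrib, hκ, hμ] at this
    linarith
  set X := x * Real.log k
  set Y := y * Real.log l
  have hr : (k : ℚ) ^ x / (l : ℚ) ^ y =
      ∏ p ∈ S, (p : ℚ) ^ (x * k.factorization p - y * l.factorization p) := by
    have h1 : (k : ℚ) = ∏ p ∈ S, (p : ℚ) ^ k.factorization p := by
      exact_mod_cast cast_eq_prod_pow hk0 hkS
    have h2 : (l : ℚ) = ∏ p ∈ S, (p : ℚ) ^ l.factorization p := by
      exact_mod_cast cast_eq_prod_pow hl0 hlS
    rw [h1, h2, ← Finset.prod_zpow, ← Finset.prod_zpow, ← Finset.prod_div_distrib]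
    refine Finset.prod_congr rfl fun p h => ?_
    have h0 : (p : ℚ) ≠ 0 := by exact_mod_cast (hp p h).ne_zero
    rw [← zpow_natCast, ← zpow_natCast, ← zpow_mul, ← zpow_mul, ← zpow_sub₀ h0]
    congr 1; ring
  have e : ∀ p, ((x * k.factorization p - y * l.factorization p : ℤ) : ℝ) * Real.log p
      = κ p * X - μ p * Y := fun p => by
    simp only [κ, μ, X, Y]; push_cast; field_simp
  have e' : ∀ p, |((x * k.factorization p - y * l.factorization p : ℤ) : ℝ)| * Real.log p
      = |κ p * X - μ p * Y| := fun p => by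
    rw [← e, abs_mul, abs_of_nonneg (Real.log_natCast_nonneg p)]
  have key := two_mul_ht_prod_zpow S hp fun p => x * k.factorization p - y * l.factorization p
  rw [← hr] at key
  simp only [e, e'] at key
  have hXY : ∑ p ∈ S, (κ p * X - μ p * Y) = X - Y := by
    rw [Finset.sum_sub_distrib, ← Finset.sum_mul, ← Finset.sum_mul, hκ, hμ]; ring
  rw [hXY] at key
  have b1 : ∑ p ∈ S, |κ p * X - μ p * Y| ≤ (∑ p ∈ S, |κ p - μ p|) * |X| + |X - Y| := by
    calc _ ≤ ∑ p ∈ S, (|κ p - μ p| * |X| + μ p * |X - Y|) := by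
          refine Finset.sum_le_sum fun p _ => ?_
          rw [← abs_mul, ← abs_of_nonneg (hμ0 p), ← abs_mul, abs_of_nonneg (hμ0 p)]
          refine le_trans (le_of_eq ?_) (abs_add_le _ _)
          congr 1; ring
      _ = _ := by rw [Finset.sum_add_distrib, ← Finset.sum_mul, ← Finset.sum_mul, hμ, one_mul]
  have b2 : ∑ p ∈ S, |κ p * X - μ p * Y| ≤ (∑ p ∈ S, |κ p - μ p|) * |Y| + |X - Y| := by
    calc _ ≤ ∑ p ∈ S, (|κ p - μ p| * |Y| + κ p * |X - Y|) := by
          refine Finset.sum_le_sum fun p _ => ?_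
          rw [← abs_mul, ← abs_of_nonneg (hκ0 p), ← abs_mul, abs_of_nonneg (hκ0 p)]
          refine le_trans (le_of_eq ?_) (abs_add_le _ _)
          congr 1; ring
      _ = _ := by rw [Finset.sum_add_distrib, ← Finset.sum_mul, ← Finset.sum_mul, hκ, one_mul]
  have b3 : (∑ p ∈ S, |κ p - μ p|) * |X| ≤ ∑ p ∈ S, |κ p * X - μ p * Y| + |X - Y| := by
    calc _ ≤ ∑ p ∈ S, (|κ p * X - μ p * Y| + μ p * |X - Y|) := by
          rw [Finset.sum_mul]
          refine Finset.sum_le_sum fun p _ => ?_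
          rw [← abs_mul, ← abs_of_nonneg (hμ0 p), ← abs_mul, abs_of_nonneg (hμ0 p)]
          refine le_trans (le_of_eq ?_) (abs_sub _ _)
          congr 1; ring
      _ = _ := by rw [Finset.sum_add_distrib, ← Finset.sum_mul, hμ, one_mul]
  have b4 : (∑ p ∈ S, |κ p - μ p|) * |Y| ≤ ∑ p ∈ S, |κ p * X - μ p * Y| + |X - Y| := by
    calc _ ≤ ∑ p ∈ S, (|κ p * X - μ p * Y| + κ p * |X - Y|) := by
          rw [Finset.sum_mul]
          refine Finset.sum_le_sum fun p _ => ?_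
          rw [← abs_mul, ← abs_of_nonneg (hκ0 p), ← abs_mul, abs_of_nonneg (hκ0 p)]
          refine le_trans (le_of_eq ?_) (abs_sub _ _)
          congr 1; ring
      _ = _ := by rw [Finset.sum_add_distrib, ← Finset.sum_mul, hκ, one_mul]
  have b5 : |X - Y| ≤ ∑ p ∈ S, |κ p * X - μ p * Y| := by
    rw [← hXY]; exact Finset.abs_sum_le_sum_abs _ _
  refine ⟨?_, ?_, ?_, ?_, ?_⟩ <;> linarith

theorem ht_zpow_div (k : ℕ) (hk : 1 ≤ k) (x y : ℤ) :
    ht ((k : ℚ) ^ x / (k : ℚ) ^ y) = |x * Real.log k - y * Real.log k| := by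
  have hk0 : (k : ℚ) ≠ 0 := by exact_mod_cast (by omega : k ≠ 0)
  have h1 : ∀ n : ℕ, ht ((k : ℚ) ^ n) = n * Real.log k := fun n => by
    have : ((k : ℚ) ^ n) = ((k ^ n : ℕ) : ℚ) := by push_cast; rfl
    rw [this, ht, mulHeight, Rat.num_natCast, Rat.den_natCast, Int.natAbs_natCast,
      max_eq_left (Nat.one_le_pow _ _ hk)]
    push_cast; rw [Real.log_pow]
  have h2 : ∀ z : ℤ, ht ((k : ℚ) ^ z) = |(z : ℝ)| * Real.log k := fun z => by
    rcases Int.eq_nat_or_neg z with ⟨n, rfl | rfl⟩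
    · simp [h1]
    · rw [zpow_neg, ht_inv, zpow_natCast, h1]; simp
  rw [← zpow_sub₀ hk0, h2, ← sub_mul, abs_mul, abs_of_nonneg (Real.log_natCast_nonneg k)]
  push_cast; rfl

end SUnit

namespace SUnit

open Polynomial

/-- The Euler operator `X * d/dX`. -/
noncomputable def eulerOp {R : Type*} [CommRing R] (f : R[X]) : R[X] := X * derivative f

theorem coeff_eulerOp {R : Type*} [CommRing R] (f : R[X]) (n : ℕ) :
    (eulerOp f).coeff n = n * f.coeff n := by
  cases n with
  | zero => simp [eulerOp]
  | succ n => rw [eulerOp, coeff_X_mul, coeff_derivative, mul_comm]; push_cast; rfl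

theorem coeff_iterate_eulerOp {R : Type*} [CommRing R] (f : R[X]) (s n : ℕ) :
    (eulerOp^[s] f).coeff n = n ^ s * f.coeff n := by
  induction s with
  | zero => simp
  | succ s ih => rw [Function.iterate_succ_apply', coeff_eulerOp, ih, pow_succ']; ring

theorem iterate_eulerOp_sum_C_mul {R ι : Type*} [CommRing R] [Fintype ι] (c : ι → R)
    (f : ι → R[X]) (s : ℕ) :
    eulerOp^[s] (∑ i, C (c i) * f i) = ∑ i, C (c i) * eulerOp^[s] (f i) := by
  ext n
  simp only [coeff_iterate_eulerOp, finsetSum_coeff, coeff_C_mul, Finset.mul_sum]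
  exact Finset.sum_congr rfl fun i _ => by ring

theorem map_iterate_eulerOp {R S : Type*} [CommRing R] [CommRing S] (φ : R →+* S) (f : R[X])
    (s : ℕ) : (eulerOp^[s] f).map φ = eulerOp^[s] (f.map φ) := by
  ext n
  simp [coeff_iterate_eulerOp]

theorem pow_dvd_iterate_eulerOp {R : Type*} [CommRing R] {p f : R[X]} {n : ℕ} (h : p ^ n ∣ f)
    (s : ℕ) : p ^ (n - s) ∣ eulerOp^[s] f := by
  induction s with
  | zero => simpa using h
  | succ s ih =>
    rw [Function.iterate_succ_apply', ← Nat.sub_sub]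
    exact Dvd.dvd.mul_left (pow_sub_one_dvd_derivative_of_pow_dvd ih) _

theorem natDegree_iterate_eulerOp_le {R : Type*} [CommRing R] (f : R[X]) (s : ℕ) :
    (eulerOp^[s] f).natDegree ≤ f.natDegree := by
  refine natDegree_le_iff_coeff_eq_zero.mpr fun n hn => ?_
  rw [coeff_iterate_eulerOp, coeff_eq_zero_of_natDegree_lt hn, mul_zero]

theorem isPrimitive_pow {p : ℤ[X]} (h : p.IsPrimitive) (n : ℕ) : (p ^ n).IsPrimitive := by
  induction n with
  | zero => simp
  | succ n ih => rw [pow_succ]; exact ih.mul h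

theorem isPrimitive_den_mul_X_sub_num (ζ : ℚ) :
    (C (ζ.den : ℤ) * X - C ζ.num : ℤ[X]).IsPrimitive := by
  intro r hr
  rw [C_dvd_iff_dvd_coeff] at hr
  have h1 : r ∣ (ζ.den : ℤ) := by
    have := hr 1
    rwa [coeff_sub, coeff_C_mul, coeff_X_one, coeff_C_of_ne_zero one_ne_zero, sub_zero,
      mul_one] at this
  have h0 : r ∣ ζ.num := by simpa [coeff_X] using hr 0
  have : IsCoprime ζ.num (ζ.den : ℤ) := Int.isCoprime_iff_gcd_eq_one.mpr ζ.reduced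
  exact this.isUnit_of_dvd' h0 h1

/-- A nonzero integer polynomial divisible by a high power of `X - ζ` over `ℚ` has leading
coefficient divisible by the same power of the denominator of `ζ`. -/
theorem den_pow_dvd_leadingCoeff {D : ℤ[X]} {ζ : ℚ} {n : ℕ}
    (h : (X - C ζ) ^ n ∣ D.map (Int.castRingHom ℚ)) : (ζ.den : ℤ) ^ n ∣ D.leadingCoeff := by
  have hd : (ζ.den : ℚ) ≠ 0 := by exact_mod_cast ζ.pos.ne'
  have hdvd : (C (ζ.den : ℤ) * X - C ζ.num : ℤ[X]) ^ n ∣ D := by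
    rw [IsPrimitive.Int.dvd_iff_map_cast_dvd_map_cast _ _
      (isPrimitive_pow (isPrimitive_den_mul_X_sub_num ζ) n)]
    have e : ((C (ζ.den : ℤ) * X - C ζ.num : ℤ[X]) ^ n).map (Int.castRingHom ℚ) =
        C ((ζ.den : ℚ) ^ n) * (X - C ζ) ^ n := by
      simp only [Polynomial.map_pow, Polynomial.map_sub, Polynomial.map_mul, map_C, map_X]
      rw [C_pow, ← mul_pow, mul_sub, ← C_mul]
      congr 4
      rw [Rat.den_mul_eq_num]; simp
    rw [e]
    have hu : IsUnit (C ((ζ.den : ℚ) ^ n)) := isUnit_C.mpr (pow_ne_zero _ hd).isUnit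
    exact (hu.mul_left_dvd).mpr h
  obtain ⟨H, rfl⟩ := hdvd
  rw [leadingCoeff_mul, leadingCoeff_pow]
  have : (C (ζ.den : ℤ) * X - C ζ.num : ℤ[X]).leadingCoeff = ζ.den := by
    have hz : (ζ.den : ℤ) ≠ 0 := by exact_mod_cast ζ.pos.ne'
    rw [sub_eq_add_neg, ← C_neg, leadingCoeff_linear hz]
  rw [this]
  exact dvd_mul_right _ _

theorem natDegree_det_le {n : ℕ} {R : Type*} [CommRing R] (M : Matrix (Fin n) (Fin n) R[X])
    (E : ℕ) (h : ∀ i j, (M i j).natDegree ≤ E) : M.det.natDegree ≤ n * E := by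
  rw [Matrix.det_apply]
  refine natDegree_sum_le_of_forall_le _ _ fun σ _ => ?_
  refine (natDegree_smul_le _ _).trans ((natDegree_prod_le _ _).trans ?_)
  refine (Finset.sum_le_card_nsmul _ _ E fun i _ => h _ _).trans ?_
  simp

theorem coeff_det {n : ℕ} {R : Type*} [CommRing R] (M : Matrix (Fin n) (Fin n) R[X])
    (E : ℕ) (h : ∀ i j, (M i j).natDegree ≤ E) :
    M.det.coeff (n * E) = (Matrix.of fun i j => (M i j).coeff E).det := by
  rw [Matrix.det_apply, Matrix.det_apply, finsetSum_coeff]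
  refine Finset.sum_congr rfl fun σ _ => ?_
  rw [coeff_smul]
  congr 1
  have := coeff_prod_of_natDegree_le Finset.univ (fun i => M (σ i) i) E fun i _ => h _ _
  simpa using this

/-- If a linear combination with nonzero rational coefficients of integer polynomials of distinct
degrees is divisible by a high power of `X - ζ`, then the denominator of `ζ` is bounded. -/
theorem den_pow_le {r E T : ℕ} (f : Fin r → ℤ[X]) (hr : 0 < r)
    (hdeg : ∀ i, (f i).natDegree ≤ E) (hinj : Function.Injective fun i => (f i).natDegree)
    (hf : ∀ i, f i ≠ 0) (B : ℕ) (hB : ∀ i, |(f i).leadingCoeff| ≤ B) (c : Fin r → ℚ)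
    (hc : ∀ i, c i ≠ 0) {ζ : ℚ} (hζ : ζ ≠ 0)
    (hdvd : (X - C ζ) ^ (T + r) ∣ ∑ i, C (c i) * (f i).map (Int.castRingHom ℚ)) :
    ζ.den ^ T ≤ B ^ r * (E + 1) ^ (r * r) := by
  set M : Matrix (Fin r) (Fin r) ℤ[X] :=
    Matrix.of fun i s => X ^ (E - (f i).natDegree) * eulerOp^[(s : ℕ)] (f i) with hM
  have hMdeg : ∀ i j, (M i j).natDegree ≤ E := fun i j => by
    rw [hM, Matrix.of_apply]
    refine natDegree_mul_le.trans ?_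
    rw [natDegree_X_pow]
    have := natDegree_iterate_eulerOp_le (f i) j
    have := hdeg i
    omega
  have hcoeff : M.det.coeff (r * E) = (∏ i, (f i).leadingCoeff) *
      ∏ i : Fin r, ∏ j ∈ Finset.Ioi i, (((f j).natDegree : ℤ) - ((f i).natDegree : ℤ)) := by
    rw [coeff_det M E hMdeg]
    have hmat : (Matrix.of fun i j => (M i j).coeff E) = Matrix.of fun i j =>
        (f i).leadingCoeff * Matrix.vandermonde (fun i => ((f i).natDegree : ℤ)) i j := by
      ext i j
      simp only [Matrix.of_apply, hM, Matrix.vandermonde_apply]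
      have : E = (f i).natDegree + (E - (f i).natDegree) := by have := hdeg i; omega
      conv_lhs => rw [this]
      rw [add_tsub_cancel_left, coeff_X_pow_mul, coeff_iterate_eulerOp, mul_comm]; rfl
    rw [hmat, Matrix.det_mul_column, Matrix.det_vandermonde]
  have hne : M.det.coeff (r * E) ≠ 0 := by
    rw [hcoeff]
    refine mul_ne_zero (Finset.prod_ne_zero_iff.mpr fun i _ => leadingCoeff_ne_zero.mpr (hf i)) ?_
    refine Finset.prod_ne_zero_iff.mpr fun i _ => Finset.prod_ne_zero_iff.mpr fun j hj => ?_
    rw [sub_ne_zero]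
    intro h
    exact (Finset.mem_Ioi.mp hj).ne' (hinj (by exact_mod_cast h))
  have hlead : M.det.leadingCoeff = M.det.coeff (r * E) := by
    rw [leadingCoeff, le_antisymm (natDegree_det_le M E hMdeg) (le_natDegree_of_ne_zero hne)]
  set φ := Int.castRingHom ℚ
  set v : Fin r → ℚ[X] := fun i => C (c i) * X ^ (f i).natDegree with hv
  have hvM : ∀ s, (X - C ζ) ^ T ∣ Matrix.vecMul v ((mapRingHom φ).mapMatrix M) s := fun s => by
    have : Matrix.vecMul v ((mapRingHom φ).mapMatrix M) s =
        X ^ E * eulerOp^[(s : ℕ)] (∑ i, C (c i) * (f i).map φ) := by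
      rw [iterate_eulerOp_sum_C_mul, Finset.mul_sum, Matrix.vecMul, dotProduct]
      refine Finset.sum_congr rfl fun i _ => ?_
      simp only [hv, hM, RingHom.mapMatrix_apply, Matrix.map_apply, Matrix.of_apply,
        coe_mapRingHom, Polynomial.map_mul, Polynomial.map_pow, Polynomial.map_X,
        map_iterate_eulerOp]
      have : E = (f i).natDegree + (E - (f i).natDegree) := by have := hdeg i; omega
      conv_rhs => rw [this, pow_add]
      ring
    rw [this]
    refine Dvd.dvd.mul_left ((pow_dvd_pow _ ?_).trans (pow_dvd_iterate_eulerOp hdvd s)) _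
    have := s.2
    omega
  have hdet : (X - C ζ) ^ T ∣ M.det.map φ := by
    have h1 : ∀ i, (X - C ζ) ^ T ∣ ((mapRingHom φ).mapMatrix M).det * v i := fun i => by
      have e : Matrix.vecMul (Matrix.vecMul v ((mapRingHom φ).mapMatrix M))
          ((mapRingHom φ).mapMatrix M).adjugate i = ((mapRingHom φ).mapMatrix M).det * v i := by
        rw [Matrix.vecMul_vecMul, Matrix.mul_adjugate, Matrix.vecMul_smul, Matrix.vecMul_one]
        rfl
      rw [← e, Matrix.vecMul, dotProduct]
      exact Finset.dvd_sum fun s _ => Dvd.dvd.mul_right (hvM s) _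
    have h2 := h1 ⟨0, hr⟩
    rw [← RingHom.map_det, hv] at h2
    have hcop : IsCoprime ((X - C ζ) ^ T) (C (c ⟨0, hr⟩) * X ^ (f ⟨0, hr⟩).natDegree) := by
      refine IsCoprime.pow_left ?_
      refine IsCoprime.mul_right ?_ (IsCoprime.pow_right ?_)
      · exact ⟨0, C (c ⟨0, hr⟩)⁻¹, by rw [← C_mul, inv_mul_cancel₀ (hc _)]; simp⟩
      · have := isCoprime_X_sub_C_of_isUnit_sub (a := ζ) (b := 0) (by simpa using hζ)
        simpa using this
    exact hcop.dvd_of_dvd_mul_right h2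
  have hd := den_pow_dvd_leadingCoeff hdet
  rw [hlead] at hd
  have hle := Int.le_of_dvd (abs_pos.mpr hne) ((dvd_abs _ _).mpr hd)
  have hbd : |M.det.coeff (r * E)| ≤ (B : ℤ) ^ r * ((E : ℤ) + 1) ^ (r * r) := by
    rw [hcoeff, abs_mul, Finset.abs_prod, Finset.abs_prod]
    refine mul_le_mul ?_ ?_ (by positivity) (by positivity)
    · refine (Finset.prod_le_prod (fun _ _ => abs_nonneg _) fun i _ => hB i).trans ?_
      simp
    · rw [pow_mul]
      refine (Finset.prod_le_prod (fun _ _ => abs_nonneg _)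
        (g := fun _ => ((E : ℤ) + 1) ^ r) fun i _ => ?_).trans ?_
      · rw [Finset.abs_prod]
        refine (Finset.prod_le_prod (fun _ _ => abs_nonneg _)
          (g := fun _ => ((E : ℤ) + 1)) fun j _ => ?_).trans ?_
        · have h1 := hdeg i
          have h2 := hdeg j
          rw [abs_le]; constructor <;> omega
        · rw [Finset.prod_const]
          refine pow_le_pow_right₀ (by omega) ?_
          exact (Finset.card_le_univ _).trans (by simp)
      · simp
  exact_mod_cast hle.trans hbd

end SUnit

namespace SUnit

open Polynomial

attribute [local instance] Matrix.seminormedAddCommGroup in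

/-- An auxiliary integer vector with small entries annihilated by binomial functionals. -/
theorem exists_small_vector {m J w : ℕ} (hm : 0 < m) (hw : w < m)
    (hcard : 2 * m ≤ (J + 1) * (w + 1)) :
    ∃ c : Fin (J + 1) × Fin (w + 1) → ℤ, c ≠ 0 ∧
      (∀ s < m, ∑ p, c p * ((m * (p.1 : ℕ) + p.2).choose s : ℤ) = 0) ∧
      ∀ p, |c p| ≤ 4 ^ (m * (J + 1)) := by
  set E := m * (J + 1)
  set A : Matrix (Fin m) (Fin (J + 1) × Fin (w + 1)) ℤ :=
    Matrix.of fun s p => ((m * (p.1 : ℕ) + p.2).choose s : ℤ) with hA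
  have hβ : Fintype.card (Fin (J + 1) × Fin (w + 1)) = (J + 1) * (w + 1) := by simp
  have hexp : ∀ p : Fin (J + 1) × Fin (w + 1), m * (p.1 : ℕ) + p.2 ≤ E := fun p => by
    have h1 := p.1.2
    have h2 := p.2.2
    have h3 : m * (p.1 : ℕ) ≤ m * J := Nat.mul_le_mul_left _ (by omega)
    simp only [E]; rw [mul_add]; omega
  obtain ⟨c, hc0, hc1, hc2⟩ := Int.Matrix.exists_ne_zero_int_vec_norm_le A
    (by rw [hβ, Fintype.card_fin]; omega) (by simpa using hm)
  refine ⟨c, hc0, fun s hs => ?_, fun p => ?_⟩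
  · have := congrFun hc1 ⟨s, hs⟩
    rw [Matrix.mulVec, dotProduct] at this
    simp only [hA, Matrix.of_apply] at this
    refine Eq.trans ?_ this
    exact Finset.sum_congr rfl fun p _ => mul_comm _ _
  · have hnA : ‖A‖ ≤ 2 ^ E := by
      rw [Matrix.norm_le_iff (by positivity)]
      intro s p
      simp only [hA, Matrix.of_apply, Int.norm_natCast]
      have : (m * (p.1 : ℕ) + p.2).choose s ≤ 2 ^ E :=
        (Nat.choose_le_two_pow _ _).trans (Nat.pow_le_pow_right (by norm_num) (hexp p))
      exact_mod_cast this
    have hcardle : (J + 1) * (w + 1) ≤ 2 ^ E := by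
      refine le_trans ?_ (Nat.lt_two_pow_self (n := E)).le
      simp only [E]; rw [mul_comm m]
      exact Nat.mul_le_mul_left _ (by omega)
    have hbase : (1 : ℝ) ≤ (J + 1) * (w + 1) * max 1 ‖A‖ := by
      have h1 : (1 : ℝ) ≤ (J + 1) * (w + 1) := by
        exact_mod_cast (Nat.mul_pos (Nat.succ_pos J) (Nat.succ_pos w))
      exact one_le_mul_of_one_le_of_one_le h1 (le_max_left _ _)
    have hle : ‖c‖ ≤ (J + 1) * (w + 1) * max 1 ‖A‖ := by
      refine hc2.trans ?_
      rw [hβ, Fintype.card_fin]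
      push_cast
      refine Real.rpow_le_self_of_one_le hbase ?_
      have h2 : (2 * m : ℝ) ≤ (J + 1) * (w + 1) := by exact_mod_cast hcard
      have h3 : (0 : ℝ) < m := by exact_mod_cast hm
      rw [div_le_one (by linarith)]; linarith
    have h4 : ‖c p‖ ≤ (4 : ℝ) ^ E := by
      refine (norm_le_pi_norm c p).trans (hle.trans ?_)
      have e1 : ((J + 1) * (w + 1) : ℝ) ≤ 2 ^ E := by exact_mod_cast hcardle
      have e2 : max 1 ‖A‖ ≤ 2 ^ E := max_le (one_le_pow₀ (by norm_num)) hnA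
      calc _ ≤ (2 : ℝ) ^ E * 2 ^ E := by gcongr
        _ = _ := by rw [← mul_pow]; norm_num
    rw [Int.norm_eq_abs] at h4
    exact_mod_cast h4

theorem sum_choose_mul_pow {β : Type*} [Fintype β] (E : ℕ) (e : β → ℕ) (he : ∀ p, e p ≤ E)
    (c : β → ℤ) (x : ℝ) (s : ℕ) :
    ∑ p, (c p : ℝ) * (e p).choose s * x ^ (e p - s) =
      ∑ i ∈ Finset.range (E + 1), (x - 1) ^ i * ((s + i).choose s : ℝ) *
        ((∑ p, c p * ((e p).choose (s + i) : ℤ) : ℤ) : ℝ) := by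
  have h1 : ∀ p, x ^ (e p - s) =
      ∑ i ∈ Finset.range (E + 1), (x - 1) ^ i * ((e p - s).choose i : ℝ) := fun p => by
    conv_lhs => rw [← sub_add_cancel x 1, add_pow]
    simp only [one_pow, mul_one]
    refine Finset.sum_subset ?_ fun i _ hi => ?_
    · intro i hi
      have := he p
      simp only [Finset.mem_range] at hi ⊢; omega
    · rw [Nat.choose_eq_zero_of_lt (by simp only [Finset.mem_range] at hi; omega)]; simp
  simp only [h1, Finset.mul_sum, Int.cast_sum]
  rw [Finset.sum_comm]
  refine Finset.sum_congr rfl fun i _ => Finset.sum_congr rfl fun p _ => ?_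
  have h2 : ((e p).choose (s + i) * (s + i).choose s : ℝ) =
      (e p).choose s * (e p - s).choose i := by
    have := Nat.choose_mul (n := e p) (k := s + i) (s := s) (by omega)
    rw [add_tsub_cancel_left] at this
    exact_mod_cast this
  push_cast
  linear_combination (-(c p : ℝ) * (x - 1) ^ i) * h2

/-- Upper bound for the auxiliary form near `1`. -/
theorem abs_sum_le {β : Type*} [Fintype β] (E m : ℕ) (e : β → ℕ) (he : ∀ p, e p ≤ E)
    (hβ : Fintype.card β ≤ 2 ^ E) (c : β → ℤ) (hc : ∀ p, |c p| ≤ 4 ^ E)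
    (hvan : ∀ s < m, ∑ p, c p * ((e p).choose s : ℤ) = 0) {x η : ℝ} (hη : 0 ≤ η) (hx : |x - 1| ≤ 1)
    (d : β → ℝ) (hd : ∀ p, |d p - 1| ≤ 2 ^ E * η) (s : ℕ) :
    |∑ p, (c p : ℝ) * (e p).choose s * x ^ (e p - s) * d p| ≤
      64 ^ E * (|x - 1| ^ (m - s) + η) := by
  have hβ' : (Fintype.card β : ℝ) ≤ 2 ^ E := by exact_mod_cast hβ
  have hc' : ∀ p, |(c p : ℝ)| ≤ 4 ^ E := fun p => by exact_mod_cast hc p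
  have hch : ∀ p s, ((e p).choose s : ℝ) ≤ 2 ^ E := fun p s => by
    exact_mod_cast (Nat.choose_le_two_pow _ _).trans (Nat.pow_le_pow_right (by norm_num) (he p))
  have hx2 : |x| ≤ 2 := by
    have := abs_add_le (x - 1) 1
    rw [sub_add_cancel, abs_one] at this; linarith
  have split : ∑ p, (c p : ℝ) * (e p).choose s * x ^ (e p - s) * d p =
      ∑ p, (c p : ℝ) * (e p).choose s * x ^ (e p - s) +
      ∑ p, (c p : ℝ) * (e p).choose s * x ^ (e p - s) * (d p - 1) := by
    rw [← Finset.sum_add_distrib]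
    exact Finset.sum_congr rfl fun p _ => by ring
  have b1 : |∑ p, (c p : ℝ) * (e p).choose s * x ^ (e p - s)| ≤ 64 ^ E * |x - 1| ^ (m - s) := by
    rw [sum_choose_mul_pow E e he]
    refine (Finset.abs_sum_le_sum_abs _ _).trans ?_
    have : ∀ i ∈ Finset.range (E + 1), |(x - 1) ^ i * ((s + i).choose s : ℝ) *
        ((∑ p, c p * ((e p).choose (s + i) : ℤ) : ℤ) : ℝ)| ≤ 32 ^ E * |x - 1| ^ (m - s) := by
      intro i _
      rcases lt_or_ge (s + i) m with h | h
      · rw [hvan _ h]; simp only [Int.cast_zero, mul_zero, abs_zero]; positivity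
      rcases lt_or_ge E (s + i) with h' | h'
      · have : ∑ p, c p * ((e p).choose (s + i) : ℤ) = 0 := Finset.sum_eq_zero fun p _ => by
          rw [Nat.choose_eq_zero_of_lt (lt_of_le_of_lt (he p) h')]; simp
        rw [this]; simp only [Int.cast_zero, mul_zero, abs_zero]; positivity
      · have e1 : |x - 1| ^ i ≤ |x - 1| ^ (m - s) :=
          pow_le_pow_of_le_one (abs_nonneg _) hx (by omega)
        have e2 : ((s + i).choose s : ℝ) ≤ 2 ^ E := by
          exact_mod_cast (Nat.choose_le_two_pow _ _).trans
            (Nat.pow_le_pow_right (by norm_num) h')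
        have e3 : |((∑ p, c p * ((e p).choose (s + i) : ℤ) : ℤ) : ℝ)| ≤
            2 ^ E * (4 ^ E * 2 ^ E) := by
          push_cast
          refine (Finset.abs_sum_le_sum_abs _ _).trans ?_
          refine (Finset.sum_le_card_nsmul _ _ ((4 : ℝ) ^ E * 2 ^ E) fun p _ => ?_).trans ?_
          · rw [abs_mul, Nat.abs_cast]
            exact mul_le_mul (hc' p) (hch p _) (by positivity) (by positivity)
          · rw [nsmul_eq_mul, Finset.card_univ]
            gcongr
        rw [abs_mul, abs_mul, abs_pow, Nat.abs_cast]
        calc _ ≤ |x - 1| ^ (m - s) * 2 ^ E * (2 ^ E * (4 ^ E * 2 ^ E)) := by gcongr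
          _ = (2 * 2 * 4 * 2) ^ E * |x - 1| ^ (m - s) := by simp only [mul_pow]; ring
          _ = _ := by norm_num
    refine (Finset.sum_le_card_nsmul _ _ _ this).trans ?_
    rw [nsmul_eq_mul, Finset.card_range, ← mul_assoc]
    gcongr
    have : ((E + 1 : ℕ) : ℝ) ≤ 2 ^ E := by exact_mod_cast Nat.lt_two_pow_self (n := E)
    calc _ ≤ (2 : ℝ) ^ E * 32 ^ E := by gcongr
      _ = _ := by rw [← mul_pow]; norm_num
  have b2 : |∑ p, (c p : ℝ) * (e p).choose s * x ^ (e p - s) * (d p - 1)| ≤ 64 ^ E * η := by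
    refine (Finset.abs_sum_le_sum_abs _ _).trans ?_
    have : ∀ p ∈ Finset.univ, |(c p : ℝ) * (e p).choose s * x ^ (e p - s) * (d p - 1)| ≤
        4 ^ E * 2 ^ E * 2 ^ E * (2 ^ E * η) := by
      intro p _
      have hxp : |x| ^ (e p - s) ≤ 2 ^ E :=
        (pow_le_pow_left₀ (abs_nonneg _) hx2 _).trans
          (pow_le_pow_right₀ (by norm_num) (by have := he p; omega))
      rw [abs_mul, abs_mul, abs_mul, abs_pow, Nat.abs_cast]
      have := hc' p
      have := hch p s
      have := hd p
      gcongr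
    refine (Finset.sum_le_card_nsmul _ _ _ this).trans ?_
    rw [nsmul_eq_mul, Finset.card_univ]
    calc _ ≤ (2 : ℝ) ^ E * (4 ^ E * 2 ^ E * 2 ^ E * (2 ^ E * η)) := by gcongr
      _ = (2 * 4 * 2 * 2 * 2) ^ E * η := by simp only [mul_pow]; ring
      _ = _ := by norm_num
  rw [split, mul_add]
  exact (abs_add_le _ _).trans (add_le_add b1 b2)

/-- Liouville bound for nonzero integral polynomial values at rational points. -/
theorem one_le_abs_mul_den {β : Type*} [Fintype β] (n : β → ℤ) (x y z : ℚ) (f g h : β → ℕ)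
    {F G H : ℕ} (hf : ∀ p, f p ≤ F) (hg : ∀ p, g p ≤ G) (hh : ∀ p, h p ≤ H)
    (hne : ∑ p, (n p : ℚ) * x ^ f p * y ^ g p * z ^ h p ≠ 0) :
    1 ≤ |((∑ p, (n p : ℚ) * x ^ f p * y ^ g p * z ^ h p : ℚ) : ℝ)| *
      ((x.den : ℝ) ^ F * (y.den : ℝ) ^ G * (z.den : ℝ) ^ H) := by
  set N := ∑ p, (n p : ℚ) * x ^ f p * y ^ g p * z ^ h p
  have key : ∀ (q : ℚ) (a A : ℕ), a ≤ A →
      q ^ a * (q.den : ℚ) ^ A = ((q.num ^ a * (q.den : ℤ) ^ (A - a) : ℤ) : ℚ) := fun q a A ha => by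
    obtain ⟨b, rfl⟩ := Nat.exists_eq_add_of_le ha
    rw [add_tsub_cancel_left, pow_add, ← mul_assoc, ← mul_pow, Rat.mul_den_eq_num]
    push_cast; rfl
  have hint : ∃ t : ℤ, N * ((x.den : ℚ) ^ F * (y.den : ℚ) ^ G * (z.den : ℚ) ^ H) = t := by
    refine ⟨∑ p, n p * (x.num ^ f p * (x.den : ℤ) ^ (F - f p)) *
      (y.num ^ g p * (y.den : ℤ) ^ (G - g p)) * (z.num ^ h p * (z.den : ℤ) ^ (H - h p)), ?_⟩
    rw [Finset.sum_mul, Int.cast_sum]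
    refine Finset.sum_congr rfl fun p _ => ?_
    rw [Int.cast_mul, Int.cast_mul, Int.cast_mul, ← key x _ _ (hf p), ← key y _ _ (hg p),
      ← key z _ _ (hh p)]
    ring
  obtain ⟨t, ht⟩ := hint
  have hd : ((x.den : ℚ) ^ F * (y.den : ℚ) ^ G * (z.den : ℚ) ^ H) ≠ 0 := by
    have := x.pos; have := y.pos; have := z.pos
    positivity
  have ht0 : t ≠ 0 := by
    rintro rfl
    exact mul_ne_zero hne hd (by simpa using ht)
  have h1 : (1 : ℝ) ≤ |(t : ℝ)| := by exact_mod_cast Int.one_le_abs ht0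
  have h2 : (t : ℝ) = (N : ℝ) * ((x.den : ℝ) ^ F * (y.den : ℝ) ^ G * (z.den : ℝ) ^ H) := by
    exact_mod_cast (congrArg (fun q : ℚ => (q : ℝ)) ht).symm
  rw [h2, abs_mul, abs_of_nonneg (a := (x.den : ℝ) ^ F * _ * _) (by positivity)] at h1
  exact h1

end SUnit

namespace SUnit

open Polynomial

theorem den_pow_le_of_vanish {m J w T : ℕ} (hw : w < m) (c : Fin (J + 1) × Fin (w + 1) → ℤ)
    (hc0 : c ≠ 0) (B : ℕ) (hc : ∀ p, |c p| ≤ B) {ζ ζ' : ℚ} (hζ : ζ ≠ 0) (hζ' : ζ' ≠ 0)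
    (hvan : ∀ s < T + (J + 1), ∑ p, (c p : ℚ) * (m * (p.1 : ℕ) + p.2).choose s *
      ζ ^ (m * (p.1 : ℕ) + p.2 - s) * ζ' ^ (J - (p.1 : ℕ)) = 0) :
    ∃ r ≤ J + 1, ζ.den ^ T ≤ B ^ r * (m * (J + 1) + 1) ^ (r * r) := by
  classical
  set f : Fin (J + 1) → ℤ[X] := fun j =>
    ∑ r : Fin (w + 1), monomial (m * (j : ℕ) + r) (c (j, r)) with hf
  have hcoeff : ∀ j n, (f j).coeff n =
      ∑ r : Fin (w + 1), if m * (j : ℕ) + r = n then c (j, r) else 0 :=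
    fun j n => by simp only [hf, finsetSum_coeff, coeff_monomial]
  have hcoeff' : ∀ j (r : Fin (w + 1)), (f j).coeff (m * (j : ℕ) + r) = c (j, r) := fun j r => by
    rw [hcoeff, Finset.sum_eq_single r]
    · simp
    · intro r' _ h
      rw [if_neg]; intro h'; exact h (Fin.ext (by omega))
    · simp
  have hex : ∀ j n, (f j).coeff n ≠ 0 → ∃ r : Fin (w + 1), n = m * (j : ℕ) + r := fun j n h => by
    rw [hcoeff] at h
    obtain ⟨r, _, hr⟩ := Finset.exists_ne_zero_of_sum_ne_zero h
    exact ⟨r, by by_contra h'; exact hr (if_neg (Ne.symm h'))⟩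
  set s0 : Finset (Fin (J + 1)) := Finset.univ.filter fun j => f j ≠ 0 with hs0
  have hs0card : s0.card ≤ J + 1 := (Finset.card_le_univ _).trans (by simp)
  have hs0pos : 0 < s0.card := by
    obtain ⟨⟨j, r⟩, hjr⟩ := Function.ne_iff.mp hc0
    refine Finset.card_pos.mpr ⟨j, Finset.mem_filter.mpr ⟨Finset.mem_univ _, fun h => hjr ?_⟩⟩
    rw [← hcoeff', h]; simp
  refine ⟨s0.card, hs0card, ?_⟩
  set φ := s0.equivFin.symm
  have hne : ∀ i, f (φ i) ≠ 0 := fun i => (Finset.mem_filter.mp (φ i).2).2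
  have hlead : ∀ i, ∃ r : Fin (w + 1), (f (φ i)).natDegree = m * ((φ i : Fin (J + 1)) : ℕ) + r :=
    fun i => hex _ _ (leadingCoeff_ne_zero.mpr (hne i))
  refine den_pow_le (fun i => f (φ i)) hs0pos ?_ ?_ hne B ?_
    (fun i => ζ' ^ (J - ((φ i : Fin (J + 1)) : ℕ))) (fun i => pow_ne_zero _ hζ') hζ ?_
  · intro i
    obtain ⟨r, hr⟩ := hlead i
    rw [hr]
    have h1 := (φ i : Fin (J + 1)).2
    have h2 := r.2
    have h3 : m * ((φ i : Fin (J + 1)) : ℕ) ≤ m * J := Nat.mul_le_mul_left _ (by omega)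
    rw [mul_add]; omega
  · intro i i' h
    obtain ⟨r, hr⟩ := hlead i
    obtain ⟨r', hr'⟩ := hlead i'
    simp only [hr, hr'] at h
    have h1 : (((φ i : Fin (J + 1)) : ℕ)) = (φ i' : Fin (J + 1)) := by
      have e1 : (m * ((φ i : Fin (J + 1)) : ℕ) + r) / m = (φ i : Fin (J + 1)) := by
        rw [Nat.mul_add_div (by omega), Nat.div_eq_of_lt (by omega), add_zero]
      have e2 : (m * ((φ i' : Fin (J + 1)) : ℕ) + r') / m = (φ i' : Fin (J + 1)) := by
        rw [Nat.mul_add_div (by omega), Nat.div_eq_of_lt (by omega), add_zero]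
      rw [← e1, ← e2, h]
    exact φ.injective (Subtype.ext (Fin.ext h1))
  · intro i
    obtain ⟨r, hr⟩ := hlead i
    rw [leadingCoeff, hr, hcoeff']; exact hc _
  · have hG : ∑ i, C (ζ' ^ (J - ((φ i : Fin (J + 1)) : ℕ))) * (f (φ i)).map (Int.castRingHom ℚ) =
        ∑ p : Fin (J + 1) × Fin (w + 1),
          monomial (m * (p.1 : ℕ) + p.2) ((c p : ℚ) * ζ' ^ (J - (p.1 : ℕ))) := by
      rw [φ.sum_comp (fun j : s0 => C (ζ' ^ (J - ((j : Fin (J + 1)) : ℕ))) *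
        (f j).map (Int.castRingHom ℚ)), Finset.sum_coe_sort s0
        (fun j => C (ζ' ^ (J - (j : ℕ))) * (f j).map (Int.castRingHom ℚ)), hs0,
        Finset.sum_filter_of_ne, Fintype.sum_prod_type]
      · refine Finset.sum_congr rfl fun j _ => ?_
        simp only [hf, Polynomial.map_sum, map_monomial, Finset.mul_sum, C_mul_monomial]
        exact Finset.sum_congr rfl fun r _ => by rw [mul_comm (ζ' ^ _)]; rfl
      · intro j _ h h'
        exact h (by rw [h']; simp)
    rw [hG, X_sub_C_pow_dvd_iff, ← taylor_apply, X_pow_dvd_iff]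
    intro d hd
    rw [taylor_coeff, map_sum, eval_finsetSum]
    simp only [hasseDeriv_monomial, eval_monomial]
    rw [← hvan d (by omega)]
    exact Finset.sum_congr rfl fun p _ => by ring

theorem abs_pow_sub_one_le {y : ℝ} (hy : |y| ≤ 2) (n : ℕ) :
    |y ^ n - 1| ≤ (2 ^ n - 1) * |y - 1| := by
  induction n with
  | zero => simp
  | succ n ih =>
    have : y ^ (n + 1) - 1 = y * (y ^ n - 1) + (y - 1) := by ring
    rw [this]
    refine (abs_add_le _ _).trans ?_
    rw [abs_mul]
    have : |y| * |y ^ n - 1| ≤ 2 * ((2 ^ n - 1) * |y - 1|) := by gcongr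
    rw [pow_succ]; linarith

/-- Both bounds for a single nonvanishing value of the auxiliary form. -/
theorem gap_bound_of_ne_zero {m J w s : ℕ} (hJ : 1 ≤ J) (hw : w < m) (hsm : s ≤ m)
    (c : Fin (J + 1) × Fin (w + 1) → ℤ) (hc : ∀ p, |c p| ≤ 4 ^ (m * (J + 1)))
    (hcard : (J + 1) * (w + 1) ≤ 2 ^ (m * (J + 1)))
    (hvan : ∀ s < m, ∑ p, c p * ((m * (p.1 : ℕ) + p.2).choose s : ℤ) = 0)
    {u α z : ℚ} {h ε κ L : ℝ} (hu0 : u ≠ 0) (hε : 0 ≤ ε)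
    (hL : 1 ≤ L) (hu : ht u ≤ h) (hα : ht α ≤ ε) (hz : ht z ≤ κ)
    (h1 : |1 - ((u * α : ℚ) : ℝ)| ≤ Real.exp (-L))
    (h2 : |1 - ((u ^ m * z : ℚ) : ℝ)| ≤ Real.exp (-(m * L)))
    (hne : ∑ p, (c p : ℚ) * (m * (p.1 : ℕ) + p.2).choose s *
      (u * α) ^ (m * (p.1 : ℕ) + p.2 - s) * (u ^ m * z) ^ (J - (p.1 : ℕ)) ≠ 0) :
    L * (m - s) ≤ w * h + 2 * ε * (m * (J + 1)) + κ * J + 7 * (m * (J + 1)) := by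
  set E := m * (J + 1) with hE
  have hm : 0 < m := by omega
  have hexp : ∀ p : Fin (J + 1) × Fin (w + 1), m * (p.1 : ℕ) + p.2 ≤ E := fun p => by
    have h1 := p.1.2
    have h2 := p.2.2
    have h3 : m * (p.1 : ℕ) ≤ m * J := Nat.mul_le_mul_left _ (by omega)
    simp only [E]; rw [mul_add]; omega
  have hmJ : m ≤ m * J := Nat.le_mul_of_pos_right _ hJ
  have hE1 : 1 ≤ E := Nat.mul_pos hm (Nat.succ_pos J)
  set N : ℚ := ∑ p : Fin (J + 1) × Fin (w + 1),
    ((c p * ((m * (p.1 : ℕ) + p.2).choose s : ℤ) : ℤ) : ℚ)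
    * u ^ (p.2 : ℕ) * α ^ (m * (p.1 : ℕ) + p.2 - s) * z ^ (J - (p.1 : ℕ)) with hN
  set F : ℚ := ∑ p : Fin (J + 1) × Fin (w + 1), (c p : ℚ) * (m * (p.1 : ℕ) + p.2).choose s *
      (u * α) ^ (m * (p.1 : ℕ) + p.2 - s) * (u ^ m * z) ^ (J - (p.1 : ℕ)) with hF
  have hFN : F = u ^ (m * J - s) * N := by
    rw [hF, hN, Finset.mul_sum]
    refine Finset.sum_congr rfl fun p _ => ?_
    rcases lt_or_ge (m * (p.1 : ℕ) + p.2) s with hlt | hge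
    · rw [Nat.choose_eq_zero_of_lt hlt]; simp
    · have hp : m * J = m * (p.1 : ℕ) + m * (J - (p.1 : ℕ)) := by
        rw [← mul_add]; congr 1; have := p.1.2; omega
      have : u ^ (m * J - s) * u ^ (p.2 : ℕ) =
          u ^ (m * (p.1 : ℕ) + p.2 - s) * (u ^ m) ^ (J - (p.1 : ℕ)) := by
        rw [← pow_mul, ← pow_add, ← pow_add]; congr 1
        have := hsm.trans hmJ; omega
      rw [mul_pow, mul_pow]; push_cast
      linear_combination (-(c p : ℚ) * ((m * (p.1 : ℕ) + p.2).choose s) *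
        α ^ (m * (p.1 : ℕ) + p.2 - s) * z ^ (J - (p.1 : ℕ))) * this
  have hN0 : N ≠ 0 := fun h0 => hne (by rw [hFN, h0, mul_zero])
  have hliou := one_le_abs_mul_den _ u α z (fun p : Fin (J + 1) × Fin (w + 1) => (p.2 : ℕ))
    (fun p => m * (p.1 : ℕ) + p.2 - s) (fun p => J - (p.1 : ℕ)) (F := w) (G := E) (H := J)
    (fun p => by have := p.2.2; omega) (fun p => by have := hexp p; omega)
    (fun p => by omega) hN0
  have hN1 : Real.exp (-(w * h + E * ε + J * κ)) ≤ |(N : ℝ)| := by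
    have hD : (u.den : ℝ) ^ w * (α.den : ℝ) ^ E * (z.den : ℝ) ^ J ≤
        Real.exp (w * h + E * ε + J * κ) := by
      rw [Real.exp_add, Real.exp_add, Real.exp_nat_mul, Real.exp_nat_mul, Real.exp_nat_mul]
      have e1 := (den_le_exp_ht u).trans (Real.exp_le_exp.mpr hu)
      have e2 := (den_le_exp_ht α).trans (Real.exp_le_exp.mpr hα)
      have e3 := (den_le_exp_ht z).trans (Real.exp_le_exp.mpr hz)
      gcongr
    rw [Real.exp_neg, inv_le_iff_one_le_mul₀ (Real.exp_pos _)]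
    exact hliou.trans (by gcongr)
  have hexpL : Real.exp (-L) ≤ 1 / 2 := by
    have h3 : Real.exp (-L) ≤ Real.exp (-1) := Real.exp_le_exp.mpr (by linarith)
    have := Real.exp_neg_one_lt_half
    linarith
  have hL' : Real.exp (-(m * L)) ≤ Real.exp (-L) := Real.exp_le_exp.mpr (by
    have : (1 : ℝ) ≤ m := by exact_mod_cast hm
    nlinarith)
  have hulow : Real.exp (-(ε + 1)) ≤ |(u : ℝ)| := by
    have e1 : 1 / 2 ≤ |((u * α : ℚ) : ℝ)| := by
      have := abs_sub_abs_le_abs_sub (1 : ℝ) ((u * α : ℚ) : ℝ)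
      rw [abs_one] at this; linarith
    push_cast at e1
    rw [abs_mul] at e1
    have e2 := (abs_le_exp_ht α).trans (Real.exp_le_exp.mpr hα)
    have e3 : 1 / 2 ≤ |(u : ℝ)| * Real.exp ε := e1.trans (by gcongr)
    rw [neg_add, Real.exp_add, Real.exp_neg]
    have := Real.exp_neg_one_lt_half
    rw [mul_comm, ← div_eq_mul_inv, div_le_iff₀ (Real.exp_pos _)]
    linarith
  have hlow : Real.exp (-((ε + 1) * E) - (w * h + E * ε + J * κ)) ≤ |(F : ℝ)| := by
    rw [hFN]; push_cast
    rw [abs_mul, abs_pow, sub_eq_add_neg, Real.exp_add]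
    refine mul_le_mul ?_ hN1 (Real.exp_pos _).le (by positivity)
    refine le_trans ?_ (pow_le_pow_left₀ (Real.exp_pos _).le hulow _)
    rw [← Real.exp_nat_mul]
    refine Real.exp_le_exp.mpr ?_
    have : ((m * J - s : ℕ) : ℝ) ≤ E := by
      have : m * J - s ≤ E := by rw [hE, mul_add]; omega
      exact_mod_cast this
    nlinarith
  set η := |((u ^ m * z : ℚ) : ℝ) - 1| with hη
  rw [abs_sub_comm] at h1 h2
  have hup := abs_sum_le E m (fun p : Fin (J + 1) × Fin (w + 1) => m * (p.1 : ℕ) + p.2) hexp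
    (by simpa using hcard) c hc hvan (x := ((u * α : ℚ) : ℝ)) (η := η) (abs_nonneg _)
    (by linarith) (fun p => ((u ^ m * z : ℚ) : ℝ) ^ (J - (p.1 : ℕ))) (fun p => by
      have hy : |((u ^ m * z : ℚ) : ℝ)| ≤ 2 := by
        have := abs_add_le (((u ^ m * z : ℚ) : ℝ) - 1) 1
        rw [sub_add_cancel, abs_one] at this; linarith
      refine (abs_pow_sub_one_le hy _).trans ?_
      refine mul_le_mul_of_nonneg_right ?_ (abs_nonneg _)
      have : (2 : ℝ) ^ (J - (p.1 : ℕ)) ≤ 2 ^ E := pow_le_pow_right₀ (by norm_num) (by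
        have := Nat.le_mul_of_pos_left J hm
        rw [hE, mul_add]; omega)
      linarith) s
  have hFr : (F : ℝ) = ∑ p : Fin (J + 1) × Fin (w + 1), (c p : ℝ) *
      (m * (p.1 : ℕ) + p.2).choose s * ((u * α : ℚ) : ℝ) ^ (m * (p.1 : ℕ) + p.2 - s) *
      ((u ^ m * z : ℚ) : ℝ) ^ (J - (p.1 : ℕ)) := by
    rw [hF]; push_cast; rfl
  rw [← hFr] at hup
  have hsm' : (((m - s : ℕ) : ℝ)) = m - s := by rw [Nat.cast_sub hsm]
  have b1 : |((u * α : ℚ) : ℝ) - 1| ^ (m - s) ≤ Real.exp (-(L * (m - s))) := by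
    refine (pow_le_pow_left₀ (abs_nonneg _) h1 _).trans ?_
    rw [← Real.exp_nat_mul, hsm']
    exact Real.exp_le_exp.mpr (by linarith)
  have b2 : η ≤ Real.exp (-(L * (m - s))) := by
    refine h2.trans (Real.exp_le_exp.mpr ?_)
    have : (0 : ℝ) ≤ s := Nat.cast_nonneg s
    nlinarith
  have b3 : (64 : ℝ) ^ E * 2 ≤ Real.exp (5 * E + E) := by
    have h64 : (64 : ℝ) ≤ Real.exp 5 := by
      have : Real.exp 5 = Real.exp 1 ^ 5 := by rw [← Real.exp_nat_mul]; norm_num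
      rw [this]
      have := Real.exp_one_gt_d9
      calc (64 : ℝ) ≤ 2.7 ^ 5 := by norm_num
        _ ≤ _ := pow_le_pow_left₀ (by norm_num) (by linarith) _
    rw [Real.exp_add, mul_comm (5 : ℝ), Real.exp_nat_mul]
    refine mul_le_mul (pow_le_pow_left₀ (by norm_num) h64 _) ?_ (by norm_num) (by positivity)
    have := Real.add_one_le_exp (E : ℝ)
    have : (1 : ℝ) ≤ E := by exact_mod_cast hE1
    linarith
  have hfin : Real.exp (-((ε + 1) * E) - (w * h + E * ε + J * κ)) ≤
      Real.exp (5 * E + E + -(L * (m - s))) := by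
    refine hlow.trans (hup.trans ?_)
    rw [Real.exp_add _ (-(L * (m - s)))]
    calc (64 : ℝ) ^ E * (|((u * α : ℚ) : ℝ) - 1| ^ (m - s) + η)
        ≤ 64 ^ E * (Real.exp (-(L * (m - s))) + Real.exp (-(L * (m - s)))) := by gcongr
      _ = 64 ^ E * 2 * Real.exp (-(L * (m - s))) := by ring
      _ ≤ _ := by gcongr
  have := Real.exp_le_exp.mp hfin
  have hEr : (E : ℝ) = m * (J + 1) := by rw [hE]; push_cast; rfl
  rw [← hEr]
  linarith

set_option maxHeartbeats 1000000 in
/-- A gap principle of Thue type: a rational number very close to `1` whose "power part" is `u`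
excludes a second one whose power part is close to `u ^ m`. -/
theorem thue_gap {a m : ℕ} (ha : 1 ≤ a) (hm : 100 * a ≤ m) {h : ℝ} (hh : 10 ^ 5 * (a : ℝ) ^ 4 ≤ h)
    {u v α α' : ℚ} (hu0 : u ≠ 0) (hv0 : v ≠ 0) (hα0 : α ≠ 0) (hα'0 : α' ≠ 0)
    (hu : ht u ≤ h) (hv : ht v ≤ m * h / (1000 * a ^ 2)) (hα : ht α ≤ h / (1000 * a ^ 2))
    (hα' : ht α' ≤ m * h / (1000 * a ^ 2)) (hζ : u * α ≠ 1)
    (h1 : |1 - ((u * α : ℚ) : ℝ)| ≤ Real.exp (-(h / a)))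
    (h2 : |1 - ((u ^ m * v * α' : ℚ) : ℝ)| ≤ Real.exp (-(m * h / a))) : False := by
  obtain ⟨J, hJ⟩ : ∃ J, J + 1 = 16 * a := ⟨16 * a - 1, by omega⟩
  set w := 2 * m / (16 * a)
  have hw1 : 16 * a * w ≤ 2 * m := Nat.mul_div_le _ _
  have hw2 : 2 * m < 16 * a * (w + 1) := Nat.lt_mul_div_succ _ (by omega)
  have hwm : w < m := by nlinarith
  obtain ⟨c, hc0, hvan, hc⟩ := exists_small_vector (J := J) (by omega) hwm (by rw [hJ]; omega)
  have har : (1 : ℝ) ≤ a := by exact_mod_cast ha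
  have hmr : 100 * (a : ℝ) ≤ m := by exact_mod_cast hm
  have ha3 : (1 : ℝ) ≤ a ^ 3 := one_le_pow₀ har
  have hL : 10 ^ 5 * (a : ℝ) ^ 3 ≤ h / a := by
    rw [le_div_iff₀ (by linarith)]; calc _ = 10 ^ 5 * (a : ℝ) ^ 4 := by ring
      _ ≤ h := hh
  set L := h / a with hLdef
  have hhL : h = L * a := by rw [hLdef]; field_simp
  have hL1 : 1 ≤ L := by nlinarith
  have hJr : (J : ℝ) + 1 = 16 * a := by exact_mod_cast hJ
  have ha3a : (a : ℝ) ≤ a ^ 3 := le_self_pow₀ har (by norm_num)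
  by_cases hex : ∃ s ≤ m / 2, ∑ p, (c p : ℚ) * (m * (p.1 : ℕ) + p.2).choose s *
      (u * α) ^ (m * (p.1 : ℕ) + p.2 - s) * (u ^ m * (v * α')) ^ (J - (p.1 : ℕ)) ≠ 0
  · obtain ⟨s, hs, hne⟩ := hex
    have hcard : (J + 1) * (w + 1) ≤ 2 ^ (m * (J + 1)) := by
      refine le_trans ?_ (Nat.lt_two_pow_self (n := m * (J + 1))).le
      rw [mul_comm m]
      exact Nat.mul_le_mul_left _ (by omega)
    have := gap_bound_of_ne_zero (ε := h / (1000 * a ^ 2)) (κ := 2 * (m * h / (1000 * a ^ 2)))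
      (L := L) (h := h) (z := v * α') (by omega) hwm (by omega) c hc hcard hvan
      hu0 (by rw [hhL]; positivity) hL1 hu hα
      ((ht_mul_le _ _).trans (by linarith)) h1
      (by rw [mul_assoc] at h2; convert h2 using 3; rw [hLdef]; ring) hne
    have e1 : h / (1000 * (a : ℝ) ^ 2) = L / (1000 * a) := by rw [hhL]; field_simp
    have e2 : m * h / (1000 * (a : ℝ) ^ 2) = m * L / (1000 * a) := by rw [hhL]; field_simp
    rw [e1, e2, hJr] at this
    have hJle : (J : ℝ) ≤ 16 * a := by linarith
    have hsr : (s : ℝ) ≤ m / 2 := by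
      have : 2 * s ≤ m := by omega
      have : (2 * s : ℝ) ≤ m := by exact_mod_cast this
      linarith
    have hwr : 16 * a * (w : ℝ) ≤ 2 * m := by exact_mod_cast hw1
    have t1 : (w : ℝ) * h ≤ L * m / 8 := by
      have := mul_le_mul_of_nonneg_left hwr (by linarith : 0 ≤ L)
      rw [hhL]; linarith
    have t2 : 2 * (L / (1000 * a)) * (m * (16 * a)) = 0.032 * (L * m) := by field_simp; ring
    have t3 : 2 * (m * L / (1000 * a)) * J ≤ 0.032 * (L * m) := by
      calc _ ≤ 2 * (m * L / (1000 * a)) * (16 * a) := by gcongr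
        _ = _ := by field_simp; ring
    have t4 : 7 * (m * (16 * (a : ℝ))) ≤ 0.00112 * (L * m) := by
      have : (a : ℝ) * m ≤ 10⁻¹ ^ 5 * L * m := by gcongr; linarith
      linarith
    have t5 : L * m / 2 ≤ L * (m - s) := by
      have := mul_le_mul_of_nonneg_left hsr (by linarith : 0 ≤ L)
      linarith
    have : 0 < L * m := mul_pos (by linarith) (by linarith)
    linarith
  · push Not at hex
    obtain ⟨T, hT⟩ : ∃ T, T + J = m / 2 := ⟨m / 2 - J, by omega⟩
    have hζ0 : u * α ≠ 0 := mul_ne_zero hu0 hα0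
    obtain ⟨r, hr, hle⟩ := den_pow_le_of_vanish (T := T) hwm c hc0 (4 ^ (m * (J + 1)))
      (by exact_mod_cast hc) hζ0 (mul_ne_zero (pow_ne_zero _ hu0) (mul_ne_zero hv0 hα'0))
      (fun s hs => hex s (by omega))
    have hden : Real.exp L ≤ (u * α).den := by
      have := (inv_den_le_abs_one_sub hζ).trans h1
      rw [Real.exp_neg, one_div] at this
      exact (inv_le_inv₀ (by exact_mod_cast (u * α).pos) (Real.exp_pos _)).mp this
    have hle2 : (u * α).den ^ T ≤ 2 ^ (3 * (m * (J + 1)) * (J + 1) ^ 2) := by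
      refine hle.trans ?_
      have h4 : (4 : ℕ) = 2 ^ 2 := by norm_num
      rw [h4, ← pow_mul, ← pow_mul]
      calc _ ≤ 2 ^ (2 * (m * (J + 1)) * r) * (2 ^ (m * (J + 1))) ^ (r * r) := by
            rw [← mul_assoc 2]
            exact Nat.mul_le_mul_left _ (Nat.pow_le_pow_left Nat.lt_two_pow_self _)
        _ = 2 ^ (2 * (m * (J + 1)) * r + m * (J + 1) * (r * r)) := by rw [← pow_mul, ← pow_add]
        _ ≤ _ := by
            refine Nat.pow_le_pow_right (by norm_num) ?_
            have h5 : r * r ≤ (J + 1) ^ 2 := by nlinarith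
            have h6 : r ≤ (J + 1) ^ 2 := by nlinarith
            calc 2 * (m * (J + 1)) * r + m * (J + 1) * (r * r) ≤
                2 * (m * (J + 1)) * (J + 1) ^ 2 + m * (J + 1) * (J + 1) ^ 2 := by gcongr
              _ = _ := by ring
    obtain ⟨K, hK⟩ : ∃ K, K = 3 * (m * (J + 1)) * (J + 1) ^ 2 := ⟨_, rfl⟩
    rw [← hK] at hle2
    have hle3 : Real.exp (T * L) ≤ Real.exp K := by
      rw [Real.exp_nat_mul]
      have h7 : ((u * α).den : ℝ) ^ T ≤ 2 ^ K := by
        exact_mod_cast hle2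
      refine (pow_le_pow_left₀ (Real.exp_pos _).le hden _).trans (h7.trans ?_)
      have h8 : (2 : ℝ) ≤ Real.exp 1 := by have := Real.add_one_le_exp (1 : ℝ); linarith
      refine (pow_le_pow_left₀ (by norm_num) h8 _).trans ?_
      rw [← Real.exp_nat_mul, mul_one]
    have hle4 := Real.exp_le_exp.mp hle3
    rw [hK] at hle4
    push_cast at hle4
    have hTr : (m : ℝ) / 4 ≤ T := by
      have : m ≤ 4 * T := by omega
      have : (m : ℝ) ≤ 4 * T := by exact_mod_cast this
      linarith
    rw [hJr] at hle4
    have hmL : (m : ℝ) / 4 * (10 ^ 5 * (a : ℝ) ^ 3) ≤ T * L := by gcongr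
    have hm0 : 0 < (m : ℝ) := by linarith
    have : 0 < (m : ℝ) * a ^ 3 := mul_pos hm0 (by linarith)
    linarith

end SUnit

namespace SUnit

variable {ι : Type*}

/-- The vector of powers `g i ^ e i`. -/
def pw (g : ι → ℕ) (e : ι → ℤ) (i : ι) : ℚ := (g i : ℚ) ^ e i

/-- The vector of logarithms of the powers `g i ^ e i`. -/
noncomputable def lg (g : ι → ℕ) (e : ι → ℤ) (i : ι) : ℝ := e i * Real.log (g i)

/-- The data controlling heights of quotients of powers whose bases take at most two values. -/
structure HtParam (g : ι → ℕ) (τ : ℝ) : Prop where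
  two_le : ∀ i, 2 ≤ g i
  two_bases : ∀ i j m, g i ≠ g j → g m = g i ∨ g m = g j
  nonneg : 0 ≤ τ
  le_one : τ ≤ 1
  ht_le : ∀ e i j, ht (pw g e i / pw g e j) ≤ |lg g e i - lg g e j| + τ * |lg g e i|
  ht_le_of_eq : ∀ e i j, g i = g j → ht (pw g e i / pw g e j) ≤ |lg g e i - lg g e j|
  abs_le_ht : ∀ e i j, |lg g e i - lg g e j| ≤ ht (pw g e i / pw g e j)
  le_ht : ∀ e i j, g i ≠ g j → τ * |lg g e i| ≤ ht (pw g e i / pw g e j)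
  pure : (∀ i j, g i = g j) → τ = 0

theorem exists_htParam {k l : ℕ} (hk : 2 ≤ k) (hl : 2 ≤ l) (g : ι → ℕ)
    (hg : ∀ i, g i = k ∨ g i = l) : ∃ τ, HtParam g τ := by
  have h2 : ∀ i, 2 ≤ g i := fun i => by rcases hg i with h | h <;> omega
  have htb : ∀ i j m, g i ≠ g j → g m = g i ∨ g m = g j := fun i j m h => by
    rcases hg i with h1 | h1 <;> rcases hg j with h2 | h2 <;> rcases hg m with h3 | h3 <;>
      simp_all
  have heq : ∀ (e : ι → ℤ) i j, g i = g j →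
      ht (pw g e i / pw g e j) = |lg g e i - lg g e j| := fun e i j h => by
    rw [pw, pw, lg, lg, h]; exact ht_zpow_div _ (by have := h2 j; omega) _ _
  by_cases hp : ∀ i j, g i = g j
  · exact ⟨0, h2, htb, le_rfl, zero_le_one, fun e i j => by rw [heq e i j (hp i j)]; simp,
      fun e i j h => (heq e i j h).le, fun e i j => (heq e i j (hp i j)).ge,
      fun e i j h => absurd (hp i j) h, fun _ => rfl⟩
  · obtain ⟨τ, h0, h1, H⟩ := exists_height_param k l hk hl
    have hswap : ∀ (e : ι → ℤ) i j, ht (pw g e i / pw g e j) = ht (pw g e j / pw g e i) :=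
      fun e i j => by rw [← ht_inv, inv_div]
    have hne : ∀ (e : ι → ℤ) i j, g i ≠ g j →
        ht (pw g e i / pw g e j) ≤ |lg g e i - lg g e j| + τ * |lg g e i| ∧
        |lg g e i - lg g e j| ≤ ht (pw g e i / pw g e j) ∧
        τ * |lg g e i| ≤ ht (pw g e i / pw g e j) := fun e i j h => by
      rcases hg i with hi | hi <;> rcases hg j with hj | hj
      · exact absurd (hi.trans hj.symm) h
      · obtain ⟨a, b, c, d, f⟩ := H (e i) (e j)
        simp only [pw, lg, hi, hj]; exact ⟨a, f, c⟩
      · obtain ⟨a, b, c, d, f⟩ := H (e j) (e i)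
        rw [hswap, abs_sub_comm]
        simp only [pw, lg, hi, hj]; exact ⟨b, f, d⟩
      · exact absurd (hi.trans hj.symm) h
    refine ⟨τ, h2, htb, h0, h1, fun e i j => ?_, fun e i j h => (heq e i j h).le,
      fun e i j => ?_, fun e i j h => (hne e i j h).2.2, fun h => absurd h hp⟩
    · by_cases h : g i = g j
      · rw [heq e i j h]; have := abs_nonneg (lg g e i); nlinarith
      · exact (hne e i j h).1
    · by_cases h : g i = g j
      · exact (heq e i j h).ge
      · exact (hne e i j h).2.1

namespace HtParam

variable {g : ι → ℕ} {τ : ℝ}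

theorem pw_pos (H : HtParam g τ) (e : ι → ℤ) (i : ι) : 0 < pw g e i :=
  zpow_pos (by have := H.two_le i; positivity) _

theorem pw_ne (H : HtParam g τ) (e : ι → ℤ) (i : ι) : pw g e i ≠ 0 := (H.pw_pos e i).ne'

theorem pw_add (H : HtParam g τ) (e f : ι → ℤ) (i : ι) : pw g (e + f) i = pw g e i * pw g f i :=
  zpow_add₀ (by have := H.two_le i; positivity) _ _

theorem pw_sub (H : HtParam g τ) (e f : ι → ℤ) (i : ι) : pw g (e - f) i = pw g e i / pw g f i :=
  zpow_sub₀ (by have := H.two_le i; positivity) _ _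

theorem cast_pw (H : HtParam g τ) (e : ι → ℤ) (i : ι) : (pw g e i : ℝ) = Real.exp (lg g e i) := by
  have : (0 : ℝ) < g i := by have := H.two_le i; positivity
  rw [lg, mul_comm, ← Real.rpow_def_of_pos this, Real.rpow_intCast, pw]
  push_cast; rfl

end HtParam

theorem lg_sub (g : ι → ℕ) (e f : ι → ℤ) (i : ι) : lg g (e - f) i = lg g e i - lg g f i := by
  simp [lg, sub_mul]

theorem sum_div_eq (g : ι → ℕ) (a : ι → ℚ) (e : ι → ℤ) (r p : ι) (S : Finset ι) :
    ∑ i ∈ S, a i / a r * (pw g e i / pw g e p) = (∑ i ∈ S, a i * pw g e i) / (a r * pw g e p) := by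
  rw [Finset.sum_div]
  exact Finset.sum_congr rfl fun i _ => div_mul_div_comm _ _ _ _

theorem pw_eq_pow_mul {g : ι → ℕ} {τ : ℝ} (H : HtParam g τ) (e e' : ι → ℤ) (m : ℕ) (i : ι) :
    pw g e' i = pw g e i ^ m * pw g (e' - m • e) i := by
  have h : (g i : ℚ) ≠ 0 := by have := H.two_le i; positivity
  rw [H.pw_sub, mul_div_assoc', eq_div_iff (H.pw_ne _ _), mul_comm]
  congr 1
  simp only [pw, Pi.smul_apply, nsmul_eq_mul]
  rw [← zpow_natCast, ← zpow_mul, mul_comm]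

theorem abs_lg_sub_nsmul (g : ι → ℕ) (e e' : ι → ℤ) (p : ι)
    (hs : 0 ≤ lg g e p ↔ 0 ≤ lg g e' p) (m : ℕ) :
    |lg g (e' - m • e) p| = |(|lg g e' p| - m * |lg g e p|)| := by
  have h : lg g (e' - m • e) p = lg g e' p - m * lg g e p := by
    rw [lg_sub]
    simp [lg, mul_assoc]
  rw [h]
  by_cases h0 : 0 ≤ lg g e p
  · rw [abs_of_nonneg h0, abs_of_nonneg (hs.mp h0)]
  · have h1 := fun h => h0 (hs.mpr h)
    rw [abs_of_neg (not_le.mp h0), abs_of_neg (not_le.mp h1), ← abs_neg]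
    congr 1
    ring

/-- Nondegenerate solutions of the linear equation with coefficients `a`. -/
def IsSol [Fintype ι] (g : ι → ℕ) (a : ι → ℚ) (e : ι → ℤ) : Prop :=
  ∑ i, a i * pw g e i = 0 ∧
    ∀ I : Finset ι, I.Nonempty → I ≠ Finset.univ → ∑ i ∈ I, a i * pw g e i ≠ 0

/-- `Cov g K Z`: the vectors of powers attached to `Z` satisfy one of at most `K` linear relations,
each of which involves only some of the coordinates. -/
def Cov [Fintype ι] (g : ι → ℕ) (K : ℕ) (Z : Set (ι → ℤ)) : Prop :=
  ∃ R : Finset (ι → ℚ), R.card ≤ K ∧ (∀ c ∈ R, c ≠ 0 ∧ ∃ i, c i = 0) ∧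
    ∀ e ∈ Z, ∃ c ∈ R, ∑ i, c i * pw g e i = 0

section Cov

variable [Fintype ι] {g : ι → ℕ}

theorem Cov.mono {K K' : ℕ} {Z Z' : Set (ι → ℤ)} (h : Cov g K Z) (hK : K ≤ K') (hZ : Z' ⊆ Z) :
    Cov g K' Z' := by
  obtain ⟨R, h1, h2, h3⟩ := h
  exact ⟨R, h1.trans hK, h2, fun e he => h3 e (hZ he)⟩

theorem Cov.empty : Cov g 0 ∅ := ⟨∅, by simp, by simp, by simp⟩

theorem Cov.of_relation {Z : Set (ι → ℤ)} {c : ι → ℚ} (hc : c ≠ 0) (hc' : ∃ i, c i = 0)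
    (h : ∀ e ∈ Z, ∑ i, c i * pw g e i = 0) : Cov g 1 Z :=
  ⟨{c}, by simp, by simpa using ⟨hc, hc'⟩, fun e he => ⟨c, by simp, h e he⟩⟩

theorem Cov.union {K K' : ℕ} {Z Z' : Set (ι → ℤ)} (h : Cov g K Z) (h' : Cov g K' Z') :
    Cov g (K + K') (Z ∪ Z') := by
  classical
  obtain ⟨R, h1, h2, h3⟩ := h
  obtain ⟨R', h1', h2', h3'⟩ := h'
  refine ⟨R ∪ R', (Finset.card_union_le _ _).trans (add_le_add h1 h1'), fun c hc => ?_,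
    fun e he => ?_⟩
  · rcases Finset.mem_union.mp hc with hc | hc
    · exact h2 c hc
    · exact h2' c hc
  · rcases he with he | he
    · obtain ⟨c, hc, h⟩ := h3 e he
      exact ⟨c, Finset.mem_union_left _ hc, h⟩
    · obtain ⟨c, hc, h⟩ := h3' e he
      exact ⟨c, Finset.mem_union_right _ hc, h⟩

theorem Cov.of_fiber {β : Type*} {K M : ℕ} {Z : Set (ι → ℤ)} (φ : (ι → ℤ) → β) (t : Finset β)
    (ht : t.card ≤ M) (hφ : ∀ e ∈ Z, φ e ∈ t) (h : ∀ b ∈ t, Cov g K {e ∈ Z | φ e = b}) :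
    Cov g (M * K) Z := by
  classical
  choose! R h1 h2 h3 using h
  refine ⟨t.biUnion R, ?_, fun c hc => ?_, fun e he => ?_⟩
  · exact (Finset.card_biUnion_le_card_mul _ _ _ h1).trans (Nat.mul_le_mul_right _ ht)
  · obtain ⟨b, hb, hc⟩ := Finset.mem_biUnion.mp hc
    exact h2 b hb c hc
  · obtain ⟨c, hc, h⟩ := h3 (φ e) (hφ e he) e ⟨he, rfl⟩
    exact ⟨c, Finset.mem_biUnion.mpr ⟨_, hφ e he, hc⟩, h⟩

end Cov

/-- The size of an exponent vector, relative to a base point. -/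
noncomputable def size [Fintype ι] (g : ι → ℕ) (τ : ℝ) (i0 : ι) (e : ι → ℤ) : ℝ :=
  ‖fun i => lg g e i - lg g e i0‖ + τ * |lg g e i0|

/-- The largest height of a quotient of two coordinates. -/
noncomputable def hr [Fintype ι] (w : ι → ℚ) : ℝ :=
  Real.log (Finset.univ.sup fun p : ι × ι => mulHeight (w p.1 / w p.2) : ℕ)

section hr

variable [Fintype ι]

theorem ht_le_hr (w : ι → ℚ) (i j : ι) : ht (w i / w j) ≤ hr w := by
  refine Real.log_le_log (by exact_mod_cast one_le_mulHeight _) ?_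
  exact_mod_cast Finset.le_sup (f := fun p : ι × ι => mulHeight (w p.1 / w p.2))
    (Finset.mem_univ (i, j))

theorem exists_ht_eq_hr [Nonempty ι] (w : ι → ℚ) : ∃ i j, ht (w i / w j) = hr w := by
  obtain ⟨p, _, hp⟩ := Finset.exists_mem_eq_sup Finset.univ Finset.univ_nonempty
    (fun p : ι × ι => mulHeight (w p.1 / w p.2))
  exact ⟨p.1, p.2, by rw [hr, hp, ht]⟩

theorem hr_nonneg [Nonempty ι] (w : ι → ℚ) : 0 ≤ hr w := by
  obtain ⟨i⟩ := ‹Nonempty ι›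
  exact (ht_nonneg _).trans (ht_le_hr w i i)

end hr

section size

variable [Fintype ι] {g : ι → ℕ} {τ : ℝ}

theorem size_nonneg (H : HtParam g τ) (i0 : ι) (e : ι → ℤ) : 0 ≤ size g τ i0 e :=
  add_nonneg (norm_nonneg _) (mul_nonneg H.nonneg (abs_nonneg _))

theorem abs_lg_sub_le_size (H : HtParam g τ) (i0 : ι) (e : ι → ℤ) (i : ι) :
    |lg g e i - lg g e i0| ≤ size g τ i0 e :=
  (norm_le_pi_norm (fun i => lg g e i - lg g e i0) i).trans
    (le_add_of_nonneg_right (mul_nonneg H.nonneg (abs_nonneg _)))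

theorem mul_abs_lg_base_le_size (i0 : ι) (e : ι → ℤ) : τ * |lg g e i0| ≤ size g τ i0 e :=
  le_add_of_nonneg_left (norm_nonneg _)

theorem mul_abs_lg_le_size (H : HtParam g τ) (i0 : ι) (e : ι → ℤ) (i : ι) :
    τ * |lg g e i| ≤ size g τ i0 e := by
  have h1 := norm_le_pi_norm (fun i => lg g e i - lg g e i0) i
  rw [Real.norm_eq_abs] at h1
  have h2 := abs_add_le (lg g e i - lg g e i0) (lg g e i0)
  rw [sub_add_cancel] at h2
  have h3 := mul_le_mul_of_nonneg_left h2 H.nonneg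
  have h4 := mul_le_of_le_one_left (abs_nonneg (lg g e i - lg g e i0)) H.le_one
  rw [size]; linarith

theorem exists_abs_lg_sub_eq (i0 : ι) (e : ι → ℤ) :
    ∃ i, |lg g e i - lg g e i0| = ‖fun i => lg g e i - lg g e i0‖ := by
  have : Nonempty ι := ⟨i0⟩
  by_contra! h
  have h1 : ∀ i, ‖lg g e i - lg g e i0‖ < ‖fun i => lg g e i - lg g e i0‖ := fun i =>
    lt_of_le_of_ne (norm_le_pi_norm (fun i => lg g e i - lg g e i0) i) (h i)
  have h2 := (pi_norm_lt_iff ((norm_nonneg _).trans_lt (h1 i0))).mpr h1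
  exact lt_irrefl _ h2

theorem exists_half_size_le_ht (H : HtParam g τ) (i0 : ι) (e : ι → ℤ) :
    ∃ i j, size g τ i0 e / 2 ≤ ht (pw g e i / pw g e j) := by
  by_cases h : size g τ i0 e / 2 ≤ ‖fun i => lg g e i - lg g e i0‖
  · obtain ⟨i, hi⟩ := exists_abs_lg_sub_eq (g := g) i0 e
    exact ⟨i, i0, h.trans (hi ▸ H.abs_le_ht e i i0)⟩
  · push Not at h
    have h1 : size g τ i0 e / 2 ≤ τ * |lg g e i0| := by rw [size] at h ⊢; linarith
    have hτ : τ ≠ 0 := by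
      rintro rfl
      have := norm_nonneg fun i => lg g e i - lg g e i0
      rw [zero_mul] at h1
      linarith
    have hmix : ∃ j, g i0 ≠ g j := by
      by_contra! hc
      exact hτ (H.pure fun i j => (hc i).symm.trans (hc j))
    obtain ⟨j, hj⟩ := hmix
    exact ⟨i0, j, h1.trans (H.le_ht e i0 j hj)⟩

/-- Solutions of large size have large height, if the coefficients have minimal height. -/
theorem quarter_size_le_hr (H : HtParam g τ) (i0 : ι) (e : ι → ℤ) {a : ι → ℚ}
    (ha : ∀ i, a i ≠ 0)
    (hmin : hr a ≤ hr fun i => a i * pw g e i) :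
    size g τ i0 e / 4 ≤ hr fun i => a i * pw g e i := by
  obtain ⟨i, j, h⟩ := exists_half_size_le_ht H i0 e
  have h1 : pw g e i / pw g e j = (a i * pw g e i) / (a j * pw g e j) * (a j / a i) := by
    have := ha i; have := ha j; have := H.pw_ne e j
    field_simp
  have h2 := ht_mul_le ((a i * pw g e i) / (a j * pw g e j)) (a j / a i)
  rw [← h1] at h2
  have h3 := ht_le_hr (fun i => a i * pw g e i) i j
  have h4 := ht_le_hr a j i
  linarith

end size

end SUnit

namespace SUnit

attribute [local instance] Matrix.seminormedAddCommGroup in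
/-- A system of fewer than `card ι` equations with solution vectors of small height has a
solution of small height. -/
theorem exists_small_relation {ι : Type*} [Fintype ι] {w : ι → ℚ} (hw : ∀ i, w i ≠ 0)
    {Y : Set (ι → ℚ)} (hY : Y.Nonempty) (i0 : ι) {ρ : ℝ} (hY0 : ∀ y ∈ Y, ∀ i, y i ≠ 0)
    (hYw : ∀ y ∈ Y, ∑ i, w i * y i = 0) (hρ : ∀ y ∈ Y, ∀ i j, ht (y i / y j) ≤ ρ) :
    ∃ t : ι → ℤ, t ≠ 0 ∧ (∀ y ∈ Y, ∑ i, (t i : ℚ) * y i = 0) ∧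
      ∀ i j, ht (t i / t j) ≤
        (Fintype.card ι - 1) * (Real.log (Fintype.card ι) + Fintype.card ι * ρ) := by
  classical
  set N := Fintype.card ι with hN
  have hN1 : 1 ≤ N := Fintype.card_pos_iff.mpr ⟨i0⟩
  have hN1' : (1 : ℝ) ≤ N := by exact_mod_cast hN1
  obtain ⟨y0, hy0⟩ := hY
  have hρ0 : 0 ≤ ρ := (ht_nonneg _).trans (hρ y0 hy0 i0 i0)
  obtain ⟨b, hbY, hspan, hli⟩ := exists_linearIndependent ℚ Y
  have : Finite b := hli.finite
  have : Fintype b := Fintype.ofFinite b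
  let F : (ι → ℚ) →ₗ[ℚ] ℚ := ∑ i, w i • LinearMap.proj i
  have hF : ∀ y, F y = ∑ i, w i * y i := fun y => by simp [F]
  have hker : Submodule.span ℚ b ≤ LinearMap.ker F := by
    rw [Submodule.span_le]
    intro y hy
    simp [hF, hYw y (hbY hy)]
  have hker' : LinearMap.ker F < ⊤ := by
    rw [lt_top_iff_ne_top]
    intro h
    have h1 : Pi.single i0 1 ∈ LinearMap.ker F := h ▸ Submodule.mem_top
    rw [LinearMap.mem_ker, hF] at h1
    simp [Pi.single_apply, hw i0] at h1
  have hcard : Fintype.card b < N := by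
    have h1 : Module.finrank ℚ (Submodule.span ℚ b) = Fintype.card b := by
      have h := finrank_span_eq_card hli
      rwa [Subtype.range_coe] at h
    have h2 := Submodule.finrank_mono hker
    have h3 := Submodule.finrank_lt hker'.ne
    rw [Module.finrank_fintype_fun_eq_card] at h3
    omega
  have hbne : 0 < Fintype.card b := by
    rw [Fintype.card_pos_iff]
    by_contra hb
    have hb' : b = ∅ := Set.not_nonempty_iff_eq_empty.mp fun ⟨y, hy⟩ => hb ⟨⟨y, hy⟩⟩
    have h1 : y0 ∈ Submodule.span ℚ b := hspan ▸ Submodule.subset_span hy0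
    rw [hb', Submodule.span_empty, Submodule.mem_bot] at h1
    exact hY0 y0 hy0 i0 (by simp [h1])
  let q : (ι → ℚ) → ι → ℚ := fun y i => y i / y i0
  let A : Matrix b ι ℤ := fun y i => (q y i).num * ∏ j ∈ Finset.univ.erase i, ((q y j).den : ℤ)
  have hA : ∀ (y : b) i, ((A y i : ℤ) : ℚ) = q y i * ∏ j, ((q y j).den : ℚ) := fun y i => by
    rw [← Finset.mul_prod_erase _ _ (Finset.mem_univ i), ← mul_assoc, Rat.mul_den_eq_num]
    simp [A]
  have hAle : ‖A‖ ≤ Real.exp (N * ρ) := by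
    rw [Matrix.norm_le_iff (Real.exp_pos _).le]
    intro y i
    have hq : ∀ j, ht (q y j) ≤ ρ := fun j => hρ y (hbY y.2) j i0
    have h1 : ‖A y i‖ = |((q y i).num : ℝ)| * ∏ j ∈ Finset.univ.erase i, ((q y j).den : ℝ) := by
      rw [Int.norm_eq_abs]
      simp only [A]
      push_cast
      rw [abs_mul, abs_of_nonneg (a := ∏ j ∈ Finset.univ.erase i, ((q y j).den : ℝ))
        (Finset.prod_nonneg fun j _ => by positivity)]
    rw [h1]
    calc |((q y i).num : ℝ)| * ∏ j ∈ Finset.univ.erase i, ((q y j).den : ℝ)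
        ≤ Real.exp ρ * ∏ j ∈ Finset.univ.erase i, Real.exp ρ := by
          refine mul_le_mul ((abs_num_le_exp_ht _).trans (Real.exp_le_exp.mpr (hq i)))
            (Finset.prod_le_prod (fun j _ => by positivity) fun j _ =>
              (den_le_exp_ht _).trans (Real.exp_le_exp.mpr (hq j)))
            (Finset.prod_nonneg fun j _ => by positivity) (Real.exp_pos _).le
      _ = Real.exp (N * ρ) := by
          rw [Finset.mul_prod_erase _ (fun _ => Real.exp ρ) (Finset.mem_univ i), Finset.prod_const,
            Finset.card_univ, ← Real.exp_nat_mul]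
  obtain ⟨t, ht0, htA, htn⟩ := Int.Matrix.exists_ne_zero_int_vec_norm_le A hcard hbne
  refine ⟨t, ht0, fun y hy => ?_, fun i j => ?_⟩
  · let G : (ι → ℚ) →ₗ[ℚ] ℚ := ∑ i, (t i : ℚ) • LinearMap.proj i
    have hG : ∀ y, G y = ∑ i, (t i : ℚ) * y i := fun y => by simp [G]
    have hGk : Submodule.span ℚ b ≤ LinearMap.ker G := by
      rw [Submodule.span_le]
      intro y hy
      have h1 := congrFun htA ⟨y, hy⟩
      rw [Matrix.mulVec, dotProduct] at h1
      have h2 : ((∑ i, A ⟨y, hy⟩ i * t i : ℤ) : ℚ) = 0 := by rw [h1]; simp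
      push_cast at h2
      have h3 : ∏ j, ((q y j).den : ℚ) ≠ 0 :=
        Finset.prod_ne_zero_iff.mpr fun j _ => by exact_mod_cast (q y j).den_ne_zero
      have h4 : y i0 ≠ 0 := hY0 y (hbY hy) i0
      have h5 : (∏ j, ((q y j).den : ℚ)) / y i0 * ∑ i, (t i : ℚ) * y i = 0 := by
        rw [← h2, Finset.mul_sum]
        refine Finset.sum_congr rfl fun i _ => ?_
        rw [hA]
        simp only [q]
        ring
      rw [SetLike.mem_coe, LinearMap.mem_ker, hG]
      exact (mul_eq_zero.mp h5).resolve_left (div_ne_zero h3 h4)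
    have h1 : y ∈ Submodule.span ℚ b := hspan ▸ Submodule.subset_span hy
    rw [← hG]
    exact hGk h1
  · have hlogN : 0 ≤ Real.log N := Real.log_nonneg hN1'
    by_cases hj : t j = 0
    · rw [hj]
      simp only [Int.cast_zero, div_zero, ht_zero]
      have : 0 ≤ (N : ℝ) - 1 := by linarith
      positivity
    have hB1 : (1 : ℝ) ≤ N * Real.exp (N * ρ) :=
      one_le_mul_of_one_le_of_one_le hN1' (Real.one_le_exp (by positivity))
    have hB : ‖t‖ ≤ (N * Real.exp (N * ρ)) ^ ((N : ℝ) - 1) := by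
      have hc1 : (Fintype.card b : ℝ) + 1 ≤ N := by exact_mod_cast hcard
      have hc2 : (1 : ℝ) ≤ Fintype.card b := by exact_mod_cast hbne
      refine htn.trans ((Real.rpow_le_rpow (by positivity) ?_ ?_).trans
        (Real.rpow_le_rpow_of_exponent_le hB1 ?_))
      · exact mul_le_mul_of_nonneg_left
          (max_le (Real.one_le_exp (by positivity)) hAle) (by positivity)
      · exact div_nonneg (by positivity) (by linarith)
      · rw [div_le_iff₀ (by linarith)]
        nlinarith
    have hle : ∀ i, |(t i : ℝ)| ≤ (N * Real.exp (N * ρ)) ^ ((N : ℝ) - 1) := fun i => by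
      have := norm_le_pi_norm t i
      rw [Int.norm_eq_abs] at this
      exact this.trans hB
    refine (ht_div_le hj (hle i) (hle j)).trans ?_
    rw [Real.log_rpow (by linarith), Real.log_mul (by positivity) (Real.exp_pos _).ne',
      Real.log_exp]

/-- If the coefficient vector has large height, then its solutions of small height satisfy a
further linear relation, which may be chosen to involve only some of the coordinates. -/
theorem exists_relation_of_lt {ι : Type*} [Fintype ι] {w : ι → ℚ} (hw : ∀ i, w i ≠ 0)
    {Y : Set (ι → ℚ)} (hY : Y.Nonempty) {ρ : ℝ} (hY0 : ∀ y ∈ Y, ∀ i, y i ≠ 0)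
    (hYw : ∀ y ∈ Y, ∑ i, w i * y i = 0) (hρ : ∀ y ∈ Y, ∀ i j, ht (y i / y j) ≤ ρ) {i j : ι}
    (hij : (Fintype.card ι - 1) * (Real.log (Fintype.card ι) + Fintype.card ι * ρ)
      < ht (w i / w j)) :
    ∃ c : ι → ℚ, c ≠ 0 ∧ (∃ i, c i = 0) ∧ ∀ y ∈ Y, ∑ i, c i * y i = 0 := by
  obtain ⟨t, ht0, htY, hth⟩ := exists_small_relation hw hY i hY0 hYw hρ
  refine ⟨fun m => t m - t i / w i * w m, fun hc => ?_, ⟨i, ?_⟩, fun y hy => ?_⟩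
  · have h1 : ∀ m, (t m : ℚ) = t i / w i * w m := fun m => sub_eq_zero.mp (congrFun hc m)
    have hti : (t i : ℚ) ≠ 0 := fun h => ht0 (funext fun m => by
      have := h1 m
      rw [h, zero_div, zero_mul] at this
      exact_mod_cast this)
    have h2 : (t i : ℚ) / t j = w i / w j := by
      rw [h1 j]
      have := hw i; have := hw j
      field_simp
    exact absurd (hth i j) (by rw [h2]; exact not_le.mpr hij)
  · have := hw i
    field_simp
    ring
  · simp only [sub_mul, Finset.sum_sub_distrib, htY y hy, mul_assoc, ← Finset.mul_sum, hYw y hy]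
    simp

end SUnit

namespace SUnit

variable {ι : Type*} [Fintype ι] {g : ι → ℕ} {τ : ℝ} {i0 : ι}

theorem abs_sub_le_of_floor_div_eq {x y ρ : ℝ} (hρ : 0 < ρ) (h : ⌊x / ρ⌋ = ⌊y / ρ⌋) :
    |x - y| ≤ ρ := by
  have h1 := (Int.abs_sub_lt_one_of_floor_eq_floor h).le
  rwa [← sub_div, abs_div, abs_of_pos hρ, div_le_one hρ] at h1

theorem floor_div_mem_Icc {x ρ : ℝ} {R : ℕ} (hρ : 0 < ρ) (h : |x| ≤ R * ρ) :
    ⌊x / ρ⌋ ∈ Finset.Icc (-R : ℤ) R := by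
  obtain ⟨h1, h2⟩ := abs_le.mp h
  rw [Finset.mem_Icc, Int.le_floor]
  constructor
  · push_cast
    rw [le_div_iff₀ hρ]
    linarith
  · have : (⌊x / ρ⌋ : ℝ) ≤ R := (Int.floor_le _).trans ((div_le_iff₀ hρ).mpr h2)
    exact_mod_cast this

/-- A set of bounded size is covered by boxes within which all height differences are small. -/
theorem cov_of_box (H : HtParam g τ) {Z : Set (ι → ℤ)} {ρ : ℝ} (hρ : 0 < ρ) {R : ℕ}
    (hZ : ∀ e ∈ Z, size g τ i0 e ≤ R * ρ)
    (h : ∀ e0 ∈ Z, ∀ Z' ⊆ Z, e0 ∈ Z' →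
      (∀ e ∈ Z', ∀ i j, ht (pw g (e - e0) i / pw g (e - e0) j) ≤ 4 * ρ) → Cov g 1 Z') :
    Cov g ((2 * R + 1) ^ Fintype.card ι) Z := by
  classical
  let x : (ι → ℤ) → ι → ℝ := fun e i => if i = i0 then τ * lg g e i0 else lg g e i - lg g e i0
  have hx : ∀ e i, |x e i| ≤ size g τ i0 e := fun e i => by
    simp only [x]
    split_ifs
    · rw [abs_mul, abs_of_nonneg H.nonneg]
      exact mul_abs_lg_base_le_size i0 e
    · exact abs_lg_sub_le_size H i0 e i
  have hcard : (Fintype.piFinset fun _ : ι => Finset.Icc (-R : ℤ) R).card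
      ≤ (2 * R + 1) ^ Fintype.card ι := by
    rw [Fintype.card_piFinset, Finset.prod_const, Finset.card_univ, Int.card_Icc]
    exact Nat.pow_le_pow_left (by omega) _
  have := Cov.of_fiber (g := g) (K := 1) (Z := Z) (fun e i => ⌊x e i / ρ⌋) _ hcard
    (fun e he => Fintype.mem_piFinset.mpr fun i =>
      floor_div_mem_Icc hρ ((hx e i).trans (hZ e he))) ?_
  · simpa using this
  intro b _
  rcases Set.eq_empty_or_nonempty {e ∈ Z | (fun i => ⌊x e i / ρ⌋) = b} with h0 | ⟨e0, he0, hb⟩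
  · rw [h0]
    exact Cov.empty.mono zero_le_one subset_rfl
  refine h e0 he0 _ (fun e he => he.1) ⟨he0, hb⟩ fun e he i j => ?_
  have hfl : ∀ i, |x e i - x e0 i| ≤ ρ := fun i =>
    abs_sub_le_of_floor_div_eq hρ (congrFun (he.2.trans hb.symm) i)
  have h1 : ∀ i, |lg g (e - e0) i - lg g (e - e0) i0| ≤ ρ := fun i => by
    by_cases hi : i = i0
    · rw [hi, sub_self, abs_zero]; exact hρ.le
    · have := hfl i
      simp only [x, if_neg hi] at this
      rw [lg_sub, lg_sub]
      convert this using 2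
      ring
  have h2 : τ * |lg g (e - e0) i0| ≤ ρ := by
    have := hfl i0
    simp only [x, if_pos] at this
    rwa [← mul_sub, abs_mul, abs_of_nonneg H.nonneg, ← lg_sub] at this
  have h3 : τ * |lg g (e - e0) i| ≤ 2 * ρ := by
    have h4 := abs_add_le (lg g (e - e0) i - lg g (e - e0) i0) (lg g (e - e0) i0)
    rw [sub_add_cancel] at h4
    have h5 := mul_le_mul_of_nonneg_left h4 H.nonneg
    have h6 := mul_le_of_le_one_left (abs_nonneg (lg g (e - e0) i - lg g (e - e0) i0)) H.le_one
    linarith [h1 i]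
  have h4 := H.ht_le (e - e0) i j
  have h5 := abs_sub_le (lg g (e - e0) i) (lg g (e - e0) i0) (lg g (e - e0) j)
  rw [abs_sub_comm (lg g (e - e0) i0)] at h5
  linarith [h1 i, h1 j]

/-- Solutions of bounded size and comparably large height. -/
theorem cov_of_size_le_two_mul (H : HtParam g τ) {a : ι → ℚ} (ha : ∀ i, a i ≠ 0) {σ : ℝ}
    (hσ : 10 * (Fintype.card ι : ℝ) ^ 2 ≤ σ) {Z : Set (ι → ℤ)}
    (hZ0 : ∀ e ∈ Z, ∑ i, a i * pw g e i = 0) (hZ : ∀ e ∈ Z, size g τ i0 e ≤ 2 * σ)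
    (hZ' : ∀ e ∈ Z, σ / 4 ≤ hr fun i => a i * pw g e i) :
    Cov g ((400 * Fintype.card ι ^ 2 + 1) ^ Fintype.card ι) Z := by
  have : Nonempty ι := ⟨i0⟩
  set N := Fintype.card ι with hN
  have hN1 : (1 : ℝ) ≤ N := by exact_mod_cast Fintype.card_pos (α := ι)
  have hσ0 : 0 < σ := lt_of_lt_of_le (by positivity) hσ
  have hbox := cov_of_box (i0 := i0) H (Z := Z) (ρ := σ / (100 * N ^ 2)) (R := 200 * N ^ 2)
    (by positivity) (fun e he => (hZ e he).trans_eq (by push_cast; field_simp; norm_num)) ?_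
  · exact hbox.mono (le_of_eq (by ring)) subset_rfl
  intro e0 he0 Z' hZ'Z he0' hht
  have hw : ∀ i, a i * pw g e0 i ≠ 0 := fun i => mul_ne_zero (ha i) (H.pw_ne e0 i)
  obtain ⟨i, j, hij⟩ := exists_ht_eq_hr fun i => a i * pw g e0 i
  have hY0 : ∀ y ∈ (fun e => pw g (e - e0)) '' Z', ∀ i, y i ≠ 0 := by
    rintro _ ⟨e, _, rfl⟩ i
    exact H.pw_ne _ _
  have hYw : ∀ y ∈ (fun e => pw g (e - e0)) '' Z', ∑ i, a i * pw g e0 i * y i = 0 := by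
    rintro _ ⟨e, he, rfl⟩
    rw [← hZ0 e (hZ'Z he)]
    refine Finset.sum_congr rfl fun i _ => ?_
    simp only [H.pw_sub]
    have := H.pw_ne e0 i
    field_simp
  have hYh : ∀ y ∈ (fun e => pw g (e - e0)) '' Z', ∀ i j,
      ht (y i / y j) ≤ 4 * (σ / (100 * N ^ 2)) := by
    rintro _ ⟨e, he, rfl⟩ i j
    exact hht e he i j
  obtain ⟨c, hc, ⟨m, hm⟩, hcY⟩ := exists_relation_of_lt hw (Set.Nonempty.image _ ⟨e0, he0'⟩)
    hY0 hYw hYh (i := i) (j := j) (by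
      rw [← hN]
      refine lt_of_lt_of_le ?_ ((hZ' e0 he0).trans hij.ge)
      have h1 : Real.log N ≤ N := (Real.log_le_sub_one_of_pos (by linarith)).trans (by linarith)
      have h2 : (N : ℝ) * (4 * (σ / (100 * N ^ 2))) = σ / (25 * N) := by field_simp; norm_num
      have h3 : (N : ℝ) * (σ / (25 * N)) = σ / 25 := by field_simp
      have h4 : 0 ≤ σ / (25 * N) := by positivity
      rw [h2]
      nlinarith)
  refine Cov.of_relation (c := fun i => c i / pw g e0 i) (fun h => hc (funext fun i => ?_))
    ⟨m, by simp [hm]⟩ fun e he => ?_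
  · simpa [H.pw_ne e0 i] using congrFun h i
  · rw [← hcY _ ⟨e, he, rfl⟩]
    refine Finset.sum_congr rfl fun i _ => ?_
    simp only [H.pw_sub]
    ring

theorem eq_one_of_ht_lt {q : ℚ} (hq : 0 < q) (h : ht q < Real.log 2) : q = 1 := by
  have h1 : (mulHeight q : ℝ) < 2 := by
    rwa [ht, Real.log_lt_log_iff (by exact_mod_cast one_le_mulHeight q) (by norm_num)] at h
  have h2 : mulHeight q < 2 := by exact_mod_cast h1
  have h3 : q.num.natAbs < 2 := (le_max_left _ _).trans_lt h2
  have h4 : q.den < 2 := (le_max_right _ _).trans_lt h2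
  have h5 := q.den_pos
  have h6 := Rat.num_pos.mpr hq
  rw [← Rat.num_div_den q, show q.num = 1 by omega, show q.den = 1 by omega]
  simp

/-- Solutions of bounded size. -/
theorem cov_of_size_le (H : HtParam g τ) (hN : 3 ≤ Fintype.card ι) {Z : Set (ι → ℤ)}
    (hZ : ∀ e ∈ Z, size g τ i0 e ≤ 10 * (Fintype.card ι : ℝ) ^ 2) :
    Cov g ((400 * Fintype.card ι ^ 2 + 1) ^ Fintype.card ι) Z := by
  classical
  have hbox := cov_of_box (i0 := i0) H (Z := Z) (ρ := 1 / 6) (R := 60 * Fintype.card ι ^ 2)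
    (by norm_num) (fun e he => (hZ e he).trans_eq (by push_cast; ring)) ?_
  · exact hbox.mono (Nat.pow_le_pow_left (by nlinarith) _) subset_rfl
  intro e0 _ Z' _ _ hht
  obtain ⟨i, j, m, hij, him, hjm⟩ := Fintype.two_lt_card_iff.mp hN
  refine Cov.of_relation (c := Pi.single i (1 / pw g e0 i) - Pi.single j (1 / pw g e0 j))
    (fun h => ?_) ⟨m, by simp [him.symm, hjm.symm]⟩ fun e he => ?_
  · have := congrFun h i
    simp [hij, H.pw_ne e0 i] at this
  · have h1 := eq_one_of_ht_lt (div_pos (H.pw_pos (e - e0) i) (H.pw_pos (e - e0) j))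
      ((hht e he i j).trans_lt (by linarith [Real.log_two_gt_d9]))
    rw [div_eq_one_iff_eq (H.pw_ne _ _), H.pw_sub, H.pw_sub] at h1
    simp only [Pi.sub_apply, sub_mul, Finset.sum_sub_distrib, Pi.single_apply, ite_mul, zero_mul,
      Finset.sum_ite_eq', Finset.mem_univ, if_true]
    rw [one_div_mul_eq_div, one_div_mul_eq_div, h1, sub_self]

end SUnit

namespace SUnit

variable {ι : Type*} [Fintype ι] {g : ι → ℕ} {τ : ℝ} {a : ι → ℚ} {e : ι → ℤ}

theorem ht_block_le (H : HtParam g τ) (a : ι → ℚ) (e : ι → ℤ) (r p : ι) {S : Finset ι}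
    (hS : S.Nonempty) (hg : ∀ i ∈ S, g i = g p) {δ : ℝ} (hδ : ∀ i ∈ S, |lg g e i - lg g e p| ≤ δ) :
    ht (∑ i ∈ S, a i / a r * (pw g e i / pw g e p)) ≤
      Fintype.card ι * (hr a + δ) + Real.log (Fintype.card ι) := by
  have : Nonempty ι := ⟨p⟩
  have hδ0 : 0 ≤ δ := by
    obtain ⟨i, hi⟩ := hS
    exact (abs_nonneg _).trans (hδ i hi)
  have hc : S.card ≤ Fintype.card ι := Finset.card_le_univ S
  refine (ht_sum_le S hS _).trans (add_le_add ?_ (Real.log_le_log ?_ (by exact_mod_cast hc)))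
  · calc ∑ i ∈ S, ht (a i / a r * (pw g e i / pw g e p)) ≤ ∑ i ∈ S, (hr a + δ) :=
          Finset.sum_le_sum fun i hi => (ht_mul_le _ _).trans
            (add_le_add (ht_le_hr a i r) ((H.ht_le_of_eq e i p (hg i hi)).trans (hδ i hi)))
      _ = S.card * (hr a + δ) := by rw [Finset.sum_const, nsmul_eq_mul]
      _ ≤ _ := mul_le_mul_of_nonneg_right (by exact_mod_cast hc) (add_nonneg (hr_nonneg a) hδ0)
  · exact_mod_cast hS.card_pos

theorem abs_tail_le (H : HtParam g τ) (a : ι → ℚ) (e : ι → ℤ) (r q : ι) {S : Finset ι} {δ : ℝ}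
    (hδ : ∀ i ∈ S, lg g e i ≤ lg g e q - δ) :
    |((∑ i ∈ S, a i / a r * (pw g e i / pw g e q) : ℚ) : ℝ)| ≤
      Real.exp (Real.log (Fintype.card ι) + hr a - δ) := by
  have hc : S.card ≤ Fintype.card ι := Finset.card_le_univ S
  have hc0 : (0 : ℝ) < Fintype.card ι := by exact_mod_cast Fintype.card_pos_iff.mpr ⟨q⟩
  rw [show Real.log (Fintype.card ι) + hr a - δ = Real.log (Fintype.card ι) + (hr a - δ) by ring,
    Real.exp_add, Real.exp_log hc0]
  push_cast
  calc |∑ i ∈ S, (a i / a r : ℝ) * (pw g e i / pw g e q)|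
      ≤ ∑ i ∈ S, |(a i / a r : ℝ) * (pw g e i / pw g e q)| := Finset.abs_sum_le_sum_abs _ _
    _ ≤ ∑ i ∈ S, Real.exp (hr a - δ) := Finset.sum_le_sum fun i hi => by
        rw [abs_mul, H.cast_pw, H.cast_pw, ← Real.exp_sub, abs_of_pos (Real.exp_pos _),
          show hr a - δ = hr a + -δ by ring, Real.exp_add]
        refine mul_le_mul ?_ (Real.exp_le_exp.mpr (by linarith [hδ i hi])) (Real.exp_pos _).le
          (Real.exp_pos _).le
        have h1 := abs_le_exp_ht (a i / a r)
        push_cast at h1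
        exact h1.trans (Real.exp_le_exp.mpr (ht_le_hr a i r))
    _ = S.card * Real.exp (hr a - δ) := by rw [Finset.sum_const, nsmul_eq_mul]
    _ ≤ _ := mul_le_mul_of_nonneg_right (by exact_mod_cast hc) (Real.exp_pos _).le

theorem block_ne_zero (H : HtParam g τ) (ha : ∀ i, a i ≠ 0) (he : IsSol g a e) (r p : ι)
    {S : Finset ι} (hS : S.Nonempty) (hS' : S ≠ Finset.univ) :
    ∑ i ∈ S, a i / a r * (pw g e i / pw g e p) ≠ 0 := by
  rw [sum_div_eq]
  exact div_ne_zero (he.2 S hS hS') (mul_ne_zero (ha r) (H.pw_ne e p))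

/-- The indices in `D` are those of the dominant terms of a solution of size `n`. -/
structure IsPattern (g : ι → ℕ) (n : ℝ) (A : ℕ) (D : Finset ι) (e : ι → ℤ) : Prop where
  mixed : ∃ p ∈ D, ∃ q ∈ D, g p ≠ g q
  ne_univ : D ≠ Finset.univ
  close : ∀ i ∈ D, ∀ j ∈ D, |lg g e i - lg g e j| ≤ n / A ^ 20
  far : ∀ i ∉ D, ∀ j ∈ D, lg g e i ≤ lg g e j - (n / A - n / A ^ 20)

theorem log_card_le [Nonempty ι] : Real.log (Fintype.card ι) ≤ Fintype.card ι :=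
  (Real.log_le_sub_one_of_pos (by exact_mod_cast Fintype.card_pos)).trans (by linarith)

theorem div_pow_mul_le {n c : ℝ} {A : ℕ} (hc : 1 ≤ c) (hA : c ≤ A) (hn : 0 ≤ n) :
    n / A ^ 20 * c ≤ n / A := by
  have hA1 : (1 : ℝ) ≤ A := hc.trans hA
  rw [div_mul_eq_mul_div, div_le_div_iff₀ (by positivity) (by positivity), mul_assoc]
  refine mul_le_mul_of_nonneg_left ?_ hn
  calc c * A ≤ A * A := by gcongr
    _ = (A : ℝ) ^ 2 := by ring
    _ ≤ A ^ 20 := pow_le_pow_right₀ hA1 (by norm_num)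

/-- The dominant terms give a good approximation to one. -/
theorem IsPattern.exists_approx (H : HtParam g τ) (ha : ∀ i, a i ≠ 0) (he : IsSol g a e)
    {n : ℝ} {A : ℕ} {D : Finset ι} (hD : IsPattern g n A D e) {p q : ι} (hp : p ∈ D) (hq : q ∈ D)
    (hpq : g p ≠ g q) (hA : 100 * Fintype.card ι ≤ A) (hra : hr a ≤ n / A ^ 20)
    (hN : (Fintype.card ι : ℝ) ≤ n / A ^ 20) :
    ∃ α : ℚ, α ≠ 0 ∧ ht α ≤ 6 * Fintype.card ι * (n / A ^ 20) ∧ pw g e p / pw g e q * α ≠ 1 ∧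
      |1 - ((pw g e p / pw g e q * α : ℚ) : ℝ)| ≤ Real.exp (-(n / (2 * A))) := by
  classical
  have : Nonempty ι := ⟨p⟩
  set N := Fintype.card ι with hNdef
  have hN1 : (1 : ℝ) ≤ N := by exact_mod_cast Fintype.card_pos (α := ι)
  have hA' : 100 * (N : ℝ) ≤ A := by exact_mod_cast hA
  have hA1 : (1 : ℝ) ≤ A := by linarith
  set x := n / (A : ℝ) ^ 20 with hx
  have hx0 : 0 < x := by linarith
  have hn : 0 ≤ n := by
    rw [hx, lt_div_iff₀ (by positivity)] at hx0
    linarith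
  have hxy : x * (100 * N) ≤ n / A := div_pow_mul_le (by linarith) hA' hn
  have hlog : Real.log N ≤ x := log_card_le.trans hN
  have hp' : D.filter (fun i => g i = g p) ≠ Finset.univ := fun h =>
    hpq (Finset.mem_filter.mp (h ▸ Finset.mem_univ q)).2.symm
  have hq' : D.filter (fun i => ¬ g i = g p) ≠ Finset.univ := fun h => by
    have h1 : p ∈ D.filter (fun i => ¬ g i = g p) := h ▸ Finset.mem_univ p
    simp at h1
  have hpne : (D.filter (fun i => g i = g p)).Nonempty := ⟨p, by simp [hp]⟩
  have hqne : (D.filter (fun i => ¬ g i = g p)).Nonempty := ⟨q, by simp [hq, hpq.symm]⟩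
  set P := ∑ i ∈ D.filter (fun i => g i = g p), a i / a p * (pw g e i / pw g e p) with hP
  set B := ∑ i ∈ D.filter (fun i => ¬ g i = g p), a i / a p * (pw g e i / pw g e q) with hB
  have hP0 : P ≠ 0 := block_ne_zero H ha he p p hpne hp'
  have hB0 : B ≠ 0 := block_ne_zero H ha he p q hqne hq'
  have hPh : ht P ≤ N * (hr a + x) + Real.log N :=
    ht_block_le H a e p p hpne (fun i hi => (Finset.mem_filter.mp hi).2)
      fun i hi => hD.close i (Finset.mem_filter.mp hi).1 p hp
  have hBh : ht B ≤ N * (hr a + x) + Real.log N := by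
    refine ht_block_le H a e p q hqne (fun i hi => ?_)
      fun i hi => hD.close i (Finset.mem_filter.mp hi).1 q hq
    exact (H.two_bases p q i hpq).resolve_left (Finset.mem_filter.mp hi).2
  have hbd : (N : ℝ) * (hr a + x) + Real.log N ≤ 3 * N * x := by nlinarith
  have hDne : D.Nonempty := ⟨p, hp⟩
  have huP : pw g e p / pw g e q * P
      = ∑ i ∈ D.filter (fun i => g i = g p), a i / a p * (pw g e i / pw g e q) := by
    rw [hP, Finset.mul_sum]
    refine Finset.sum_congr rfl fun i _ => ?_
    have := H.pw_ne e p
    field_simp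
  have hsumD : pw g e p / pw g e q * P + B = ∑ i ∈ D, a i / a p * (pw g e i / pw g e q) := by
    rw [huP, Finset.sum_filter_add_sum_filter_not]
  have hsum : ∑ i ∈ D, a i / a p * (pw g e i / pw g e q)
      + ∑ i ∈ Dᶜ, a i / a p * (pw g e i / pw g e q) = 0 := by
    rw [Finset.sum_add_sum_compl, sum_div_eq, he.1, zero_div]
  have key : 1 - pw g e p / pw g e q * (P / -B)
      = (∑ i ∈ D, a i / a p * (pw g e i / pw g e q)) / B := by
    rw [← hsumD]
    field_simp
    ring
  refine ⟨P / -B, div_ne_zero hP0 (neg_ne_zero.mpr hB0), ?_, fun h => ?_, ?_⟩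
  · refine (ht_div_le_add P (-B)).trans ?_
    rw [ht_neg]
    linarith
  · rw [h, sub_self] at key
    exact div_ne_zero (block_ne_zero H ha he p q hDne hD.ne_univ) hB0 key.symm
  · have htail := abs_tail_le H a e p q (S := Dᶜ) (δ := n / A - x)
      fun i hi => hD.far i (Finset.mem_compl.mp hi) q hq
    have hBl := exp_neg_ht_le_abs hB0
    have hcast : |1 - ((pw g e p / pw g e q * (P / -B) : ℚ) : ℝ)|
        = |((∑ i ∈ Dᶜ, a i / a p * (pw g e i / pw g e q) : ℚ) : ℝ)| / |(B : ℝ)| := by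
      rw [← Rat.cast_one, ← Rat.cast_sub, key, eq_neg_of_add_eq_zero_left hsum, Rat.cast_div,
        Rat.cast_neg, abs_div, abs_neg]
    rw [hcast, div_le_iff₀ (abs_pos.mpr (Rat.cast_ne_zero.mpr hB0))]
    refine htail.trans (le_trans ?_ (mul_le_mul_of_nonneg_left hBl (Real.exp_pos _).le))
    rw [← Real.exp_add, Real.exp_le_exp, ← hNdef]
    have h2 : n / (2 * A) = n / A / 2 := by rw [mul_comm, div_div]
    rw [h2]
    nlinarith

end SUnit

namespace SUnit

variable {ι : Type*} [Fintype ι] {g : ι → ℕ} {τ : ℝ} {a : ι → ℚ} {e : ι → ℤ} {i0 : ι}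

/-- The scales at which gaps between the terms of a solution are measured. -/
def scale (N t : ℕ) : ℕ := (100 * N) ^ 20 ^ t

theorem scale_zero (N : ℕ) : scale N 0 = 100 * N := by simp [scale]

theorem scale_succ (N t : ℕ) : scale N (t + 1) = scale N t ^ 20 := by
  rw [scale, scale, ← pow_mul, pow_succ]

theorem scale_mono {N : ℕ} (hN : 1 ≤ N) : Monotone (scale N) := fun _ _ h =>
  Nat.pow_le_pow_right (by omega) (Nat.pow_le_pow_right (by norm_num) h)

theorem le_scale {N : ℕ} (hN : 1 ≤ N) (t : ℕ) : 100 * N ≤ scale N t :=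
  (scale_zero N).ge.trans (scale_mono hN (Nat.zero_le t))

/-- A large solution is spread out. -/
theorem div_le_spread (H : HtParam g τ) (ha : ∀ i, a i ≠ 0) (he : IsSol g a e)
    (hn : 0 < size g τ i0 e) (hra : hr a ≤ size g τ i0 e / (100 * Fintype.card ι))
    (hN : (Fintype.card ι : ℝ) ≤ size g τ i0 e / (100 * Fintype.card ι)) :
    size g τ i0 e / (100 * Fintype.card ι) ≤ ‖fun i => lg g e i - lg g e i0‖ := by
  classical
  have : Nonempty ι := ⟨i0⟩
  by_contra! hlt
  set N := Fintype.card ι with hNdef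
  set n := size g τ i0 e with hndef
  have hN1 : (1 : ℝ) ≤ N := by exact_mod_cast Fintype.card_pos (α := ι)
  set x := n / (100 * (N : ℝ)) with hx
  have hx0 : 0 < x := by positivity
  have hxn : n = 100 * N * x := by rw [hx]; field_simp
  have hnorm : ∀ i, |lg g e i - lg g e i0| ≤ x := fun i =>
    (norm_le_pi_norm (fun i => lg g e i - lg g e i0) i).trans hlt.le
  have hτ : n - x ≤ τ * |lg g e i0| := by
    have : n = ‖fun i => lg g e i - lg g e i0‖ + τ * |lg g e i0| := rfl
    linarith
  have hmix : ∃ j, g i0 ≠ g j := by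
    by_contra! hc
    have := H.pure fun i j => (hc i).symm.trans (hc j)
    rw [this, zero_mul] at hτ
    nlinarith
  obtain ⟨j, hj⟩ := hmix
  have hpne : (Finset.univ.filter (fun i => g i = g i0)).Nonempty := ⟨i0, by simp⟩
  have hqne : (Finset.univ.filter (fun i => ¬ g i = g i0)).Nonempty := ⟨j, by simp [hj.symm]⟩
  have hp' : Finset.univ.filter (fun i => g i = g i0) ≠ Finset.univ := fun h => by
    have h1 : j ∈ Finset.univ.filter (fun i => g i = g i0) := by rw [h]; exact Finset.mem_univ j
    simp [hj.symm] at h1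
  have hq' : Finset.univ.filter (fun i => ¬ g i = g i0) ≠ Finset.univ := fun h => by
    have h1 : i0 ∈ Finset.univ.filter (fun i => ¬ g i = g i0) := by rw [h]; exact Finset.mem_univ i0
    simp at h1
  set P := ∑ i ∈ Finset.univ.filter (fun i => g i = g i0),
    a i / a i0 * (pw g e i / pw g e i0) with hP
  set B := ∑ i ∈ Finset.univ.filter (fun i => ¬ g i = g i0),
    a i / a i0 * (pw g e i / pw g e j) with hB
  have hP0 : P ≠ 0 := block_ne_zero H ha he i0 i0 hpne hp'
  have hB0 : B ≠ 0 := block_ne_zero H ha he i0 j hqne hq'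
  have hPh : ht P ≤ N * (hr a + 2 * x) + Real.log N :=
    ht_block_le H a e i0 i0 hpne (fun i hi => (Finset.mem_filter.mp hi).2)
      fun i hi => (hnorm i).trans (by linarith)
  have hBh : ht B ≤ N * (hr a + 2 * x) + Real.log N := by
    refine ht_block_le H a e i0 j hqne (fun i hi => ?_) fun i hi => ?_
    · exact (H.two_bases i0 j i hj).resolve_left (Finset.mem_filter.mp hi).2
    · have h1 := abs_sub_le (lg g e i) (lg g e i0) (lg g e j)
      rw [abs_sub_comm (lg g e i0)] at h1
      linarith [hnorm i, hnorm j]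
  have huP : pw g e i0 / pw g e j * P
      = ∑ i ∈ Finset.univ.filter (fun i => g i = g i0), a i / a i0 * (pw g e i / pw g e j) := by
    rw [hP, Finset.mul_sum]
    refine Finset.sum_congr rfl fun i _ => ?_
    have := H.pw_ne e i0
    field_simp
  have hsum : pw g e i0 / pw g e j * P + B = 0 := by
    rw [huP, Finset.sum_filter_add_sum_filter_not, sum_div_eq, he.1, zero_div]
  have hu : pw g e i0 / pw g e j = -B / P := by
    rw [eq_div_iff hP0]
    linarith
  have h1 := H.le_ht e i0 j hj
  have h2 := ht_div_le_add (-B) P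
  rw [← hu, ht_neg] at h2
  have h3 : Real.log N ≤ x := log_card_le.trans hN
  nlinarith

theorem exists_gap (f : ι → ℝ) (c : ℕ → ℝ) (hc : Antitone c) (i : ι)
    (hi : f i ≤ c (Fintype.card ι)) :
    ∃ t < Fintype.card ι, ∀ j, f j ≤ c (t + 1) ∨ c t < f j := by
  by_contra! h
  choose F hF1 hF2 using fun t : Fin (Fintype.card ι) => h t t.2
  have hinj : Function.Injective F := fun s t hst => by
    rcases lt_trichotomy s t with hlt | heq | hlt
    · have h1 := hF1 s
      have h2 := hF2 t
      have h3 := hc (show (s : ℕ) + 1 ≤ t from hlt)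
      rw [hst] at h1
      linarith
    · exact heq
    · have h1 := hF1 t
      have h2 := hF2 s
      have h3 := hc (show (t : ℕ) + 1 ≤ s from hlt)
      rw [hst] at h2
      linarith
  obtain ⟨t, ht⟩ := ((Fintype.bijective_iff_injective_and_card F).mpr ⟨hinj, by simp⟩).2 i
  have h1 := hF1 t
  have h2 := hc (show (t : ℕ) + 1 ≤ Fintype.card ι from t.2)
  rw [ht] at h1
  linarith

/-- Every large solution has a pattern. -/
theorem exists_pattern (H : HtParam g τ) (ha : ∀ i, a i ≠ 0) (he : IsSol g a e)
    (hn : 0 < size g τ i0 e)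
    (hra : hr a ≤ size g τ i0 e / scale (Fintype.card ι) (Fintype.card ι))
    (hN : (Fintype.card ι : ℝ) ≤ size g τ i0 e / scale (Fintype.card ι) (Fintype.card ι)) :
    ∃ D, ∃ t < Fintype.card ι,
      IsPattern g (size g τ i0 e) (scale (Fintype.card ι) t) D e := by
  classical
  have : Nonempty ι := ⟨i0⟩
  set N := Fintype.card ι with hNdef
  set n := size g τ i0 e with hndef
  have hNpos : 1 ≤ N := Fintype.card_pos
  have hN1 : (1 : ℝ) ≤ N := by exact_mod_cast hNpos
  have hspos : ∀ t, (0 : ℝ) < scale N t := fun t => by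
    have := le_scale hNpos t
    exact_mod_cast (show 0 < scale N t by omega)
  have hanti : Antitone fun t => n / (scale N t : ℝ) := fun s t hst =>
    div_le_div_of_nonneg_left hn.le (hspos s) (by exact_mod_cast scale_mono hNpos hst)
  have hs0 : n / (100 * (N : ℝ)) = n / scale N 0 := by rw [scale_zero]; push_cast; rfl
  have hspread : n / scale N 0 ≤ ‖fun i => lg g e i - lg g e i0‖ := by
    have h1 := hanti (Nat.zero_le N)
    rw [← hs0]
    exact div_le_spread H ha he hn (hra.trans (h1.trans hs0.ge)) (hN.trans (h1.trans hs0.ge))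
  obtain ⟨q, hq⟩ := Finite.exists_max fun i => lg g e i
  obtain ⟨t, htN, hgap⟩ := exists_gap (fun i => lg g e q - lg g e i) _ hanti q
    (by rw [sub_self]; exact (div_pos hn (hspos _)).le)
  set A := scale N t with hA
  have hA20 : (scale N (t + 1) : ℝ) = (A : ℝ) ^ 20 := by rw [scale_succ]; push_cast; rfl
  simp only [hA20] at hgap
  set x := n / (A : ℝ) ^ 20 with hx
  have hx0 : 0 < x := div_pos hn (pow_pos (hspos t) 20)
  have hNx : n / scale N N ≤ x := by
    rw [hx, ← hA20]
    exact hanti (show t + 1 ≤ N from htN)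
  have hlog : Real.log N ≤ x := log_card_le.trans (hN.trans hNx)
  have hA100 : 100 * (N : ℝ) ≤ A := by exact_mod_cast le_scale hNpos t
  have hxy : x * (100 * N) ≤ n / A := div_pow_mul_le (by linarith) hA100 hn.le
  set D := Finset.univ.filter fun i => lg g e q - lg g e i ≤ x with hD
  have hqD : q ∈ D := by simp [hD, hx0.le]
  have hfar : ∀ i ∉ D, n / A < lg g e q - lg g e i := fun i hi =>
    (hgap i).resolve_left fun h => hi (by simp [hD]; linarith)
  have hclose : ∀ i ∈ D, lg g e q - lg g e i ≤ x := fun i hi => (Finset.mem_filter.mp hi).2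
  have hDuniv : D ≠ Finset.univ := fun h => by
    have h1 : ∀ i, lg g e q - lg g e i ≤ x := fun i => hclose i (h ▸ Finset.mem_univ i)
    obtain ⟨i, hi⟩ := exists_abs_lg_sub_eq (g := g) i0 e
    have h2 : n / A ≤ |lg g e i - lg g e i0| := by
      rw [hi]
      exact (hanti (Nat.zero_le t)).trans hspread
    have h3 : |lg g e i - lg g e i0| ≤ x := by
      rw [abs_le]
      constructor <;> linarith [h1 i, h1 i0, hq i, hq i0]
    nlinarith
  refine ⟨D, t, htN, ⟨?_, hDuniv, fun i hi j hj => ?_, fun i hi j hj => ?_⟩⟩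
  · by_contra! hpure
    have hb0 := block_ne_zero H ha he q q ⟨q, hqD⟩ hDuniv
    have hbh := ht_block_le H a e q q ⟨q, hqD⟩ (fun i hi => hpure i hi q hqD) (δ := x)
      fun i hi => by
        rw [abs_le]
        constructor <;> linarith [hq i, hclose i hi]
    have htail := abs_tail_le H a e q q (S := Dᶜ) (δ := n / A)
      fun i hi => by linarith [hfar i (Finset.mem_compl.mp hi)]
    have hsum : ∑ i ∈ D, a i / a q * (pw g e i / pw g e q)
        + ∑ i ∈ Dᶜ, a i / a q * (pw g e i / pw g e q) = 0 := by
      rw [Finset.sum_add_sum_compl, sum_div_eq, he.1, zero_div]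
    have hlow := exp_neg_ht_le_abs hb0
    rw [eq_neg_of_add_eq_zero_left hsum, Rat.cast_neg, abs_neg, ht_neg] at hlow
    rw [eq_neg_of_add_eq_zero_left hsum, ht_neg] at hbh
    have h1 := Real.exp_le_exp.mp (hlow.trans htail)
    rw [← hNdef] at h1 hbh
    have h2 := hra.trans hNx
    nlinarith
  · rw [abs_le]
    constructor <;> linarith [hq i, hq j, hclose i hi, hclose j hj]
  · linarith [hfar i hi, hclose j hj]

end SUnit

namespace SUnit

variable {ι : Type*} [Fintype ι] {g : ι → ℕ} {τ : ℝ} {a : ι → ℚ} {e : ι → ℤ} {i0 : ι}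

theorem exp_neg_ht_le_abs_one_sub {q : ℚ} (hq : q ≠ 1) :
    Real.exp (-ht q) ≤ |1 - (q : ℝ)| := by
  refine le_trans ?_ (inv_den_le_abs_one_sub hq)
  rw [Real.exp_neg, one_div]
  exact inv_anti₀ (by exact_mod_cast q.den_pos) (den_le_exp_ht q)

/-- In a solution with a pattern, the dominant terms are far from one. -/
theorem IsPattern.le_mul_abs_lg (H : HtParam g τ) (ha : ∀ i, a i ≠ 0) (he : IsSol g a e)
    {n : ℝ} {A : ℕ} {D : Finset ι} (hD : IsPattern g n A D e) {p q : ι} (hp : p ∈ D) (hq : q ∈ D)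
    (hpq : g p ≠ g q) (hA : 100 * Fintype.card ι ≤ A) (hra : hr a ≤ n / A ^ 20)
    (hN : (Fintype.card ι : ℝ) ≤ n / A ^ 20) : n / (8 * A) ≤ τ * |lg g e p| := by
  have : Nonempty ι := ⟨p⟩
  obtain ⟨α, -, hαh, hne, hle⟩ := hD.exists_approx H ha he hp hq hpq hA hra hN
  have h1 := Real.exp_le_exp.mp ((exp_neg_ht_le_abs_one_sub hne).trans hle)
  have h2 := ht_mul_le (pw g e p / pw g e q) α
  have h3 := H.ht_le e p q
  have h4 := hD.close p hp q hq
  have hN1 : (1 : ℝ) ≤ Fintype.card ι := by exact_mod_cast Fintype.card_pos (α := ι)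
  have hA' : 100 * (Fintype.card ι : ℝ) ≤ A := by exact_mod_cast hA
  have hA0 : (0 : ℝ) < A := by linarith
  have hn : 0 ≤ n := by
    by_contra! hc
    have := div_neg_of_neg_of_pos hc (pow_pos hA0 20)
    linarith
  have h5 := div_pow_mul_le (by linarith) hA' hn
  have h6 : n / (2 * A) = n / A / 2 := by rw [mul_comm, div_div]
  have h7 : n / (8 * A) = n / A / 8 := by rw [mul_comm, div_div]
  rw [h6] at h1
  rw [h7]
  nlinarith

theorem base_numerics {A : ℝ} (hA : 100 ≤ A) :
    100 * (32 * A ^ 2) ≤ A ^ 18 ∧ 10 ^ 5 * (32 * A ^ 2) ^ 4 ≤ A ^ 20 := by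
  have hApos : 0 < A := by linarith
  constructor
  · calc 100 * (32 * A ^ 2) = 3200 * A ^ 2 := by ring
      _ ≤ (100 : ℝ) ^ 16 * A ^ 2 := by gcongr; norm_num
      _ ≤ A ^ 16 * A ^ 2 := by gcongr
      _ = A ^ 18 := by ring
  · calc (10 : ℝ) ^ 5 * (32 * A ^ 2) ^ 4 = 10 ^ 5 * 32 ^ 4 * A ^ 8 := by ring
      _ ≤ (100 : ℝ) ^ 12 * A ^ 8 := by gcongr; norm_num
      _ ≤ A ^ 12 * A ^ 8 := by gcongr
      _ = A ^ 20 := by ring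

theorem gap_numerics {A n n' m N : ℝ} (hA : 100 ≤ A) (hN : 100 * N ≤ A) (hn : 0 < n)
    (hn' : 0 ≤ n') (hm : A ^ 18 ≤ m) (h : n' ≤ 16 * A * m * n) :
    n + n' / A ^ 20 + m * (n / A ^ 20) ≤ m * (n / A ^ 4 / 512000) ∧
      6 * N * (n / A ^ 20) ≤ n / A ^ 4 / 512000 ∧
      6 * N * (n' / A ^ 20) ≤ m * (n / A ^ 4 / 512000) := by
  have hApos : 0 < A := by linarith
  have hApow : ∀ k, 0 < A ^ k := fun k => pow_pos hApos k
  have hm0 : 0 < m := (hApow 18).trans_le hm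
  have hbig : (10 : ℝ) ^ 20 * A ^ 4 ≤ A ^ 18 := by
    calc (10 : ℝ) ^ 20 * A ^ 4 ≤ (100 : ℝ) ^ 14 * A ^ 4 := by gcongr; norm_num
      _ ≤ A ^ 14 * A ^ 4 := by gcongr
      _ = A ^ 18 := by ring
  have hz : (10 : ℝ) ^ 20 * (n / A ^ 18) ≤ n / A ^ 4 := by
    rw [mul_div_assoc', div_le_div_iff₀ (hApow _) (hApow _)]
    calc (10 : ℝ) ^ 20 * n * A ^ 4 = n * (10 ^ 20 * A ^ 4) := by ring
      _ ≤ n * A ^ 18 := by gcongr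
  have hz3 : n ≤ m * (n / A ^ 18) := by
    rw [mul_div_assoc', le_div_iff₀ (hApow _), mul_comm]
    gcongr
  have hz4 : A * (n' / A ^ 20) ≤ 16 * (m * (n / A ^ 18)) := by
    rw [mul_div_assoc', mul_div_assoc', mul_div_assoc', div_le_div_iff₀ (hApow _) (hApow _)]
    calc A * n' * A ^ 18 ≤ A * (16 * A * m * n) * A ^ 18 := by gcongr
      _ = 16 * (m * n) * A ^ 20 := by ring
  have hz5 : A * (n / A ^ 20) ≤ n / A ^ 18 := by
    rw [mul_div_assoc', div_le_div_iff₀ (hApow _) (hApow _)]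
    calc A * n * A ^ 18 ≤ A ^ 2 * n * A ^ 18 := by gcongr; nlinarith
      _ = n * A ^ 20 := by ring
  have h20 : 0 ≤ n / A ^ 20 := by positivity
  have h20' : 0 ≤ n' / A ^ 20 := by positivity
  have h18 : 0 ≤ n / A ^ 18 := by positivity
  have hN1 : 6 * N * (n / A ^ 20) ≤ A * (n / A ^ 20) := by gcongr; linarith
  have hN2 : 6 * N * (n' / A ^ 20) ≤ A * (n' / A ^ 20) := by gcongr; linarith
  have hA1 : n / A ^ 20 ≤ A * (n / A ^ 20) := le_mul_of_one_le_left h20 (by linarith)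
  have hA2 : n' / A ^ 20 ≤ A * (n' / A ^ 20) := le_mul_of_one_le_left h20' (by linarith)
  have hmz : m * (n / A ^ 20) ≤ m * (n / A ^ 18) := by gcongr m * ?_; linarith
  have hmw : m * ((10 : ℝ) ^ 14 * (n / A ^ 18)) ≤ m * (n / A ^ 4 / 512000) := by
    gcongr m * ?_; linarith
  refine ⟨?_, ?_, ?_⟩
  · linarith
  · linarith
  · linarith

/-- Two solutions with the same pattern cannot have very different sizes. -/
theorem IsPattern.lt_of_isPattern (H : HtParam g τ) (ha : ∀ i, a i ≠ 0) {e' : ι → ℤ}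
    (he : IsSol g a e) (he' : IsSol g a e') {A : ℕ} {D : Finset ι}
    (hD : IsPattern g (size g τ i0 e) A D e) (hD' : IsPattern g (size g τ i0 e') A D e')
    (hs : ∀ i, 0 ≤ lg g e i ↔ 0 ≤ lg g e' i) (hA : 100 * Fintype.card ι ≤ A)
    (hra : hr a ≤ size g τ i0 e / A ^ 20) (hN : (Fintype.card ι : ℝ) ≤ size g τ i0 e / A ^ 20) :
    size g τ i0 e' < A ^ 20 * size g τ i0 e := by
  have : Nonempty ι := ⟨i0⟩
  by_contra! hlt
  have hn' := mul_abs_lg_le_size H i0 e'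
  have hn1 := mul_abs_lg_le_size H i0 e
  set n := size g τ i0 e with hndef
  set n' := size g τ i0 e' with hndef'
  have hN1 : (1 : ℝ) ≤ Fintype.card ι := by exact_mod_cast Fintype.card_pos (α := ι)
  have hA' : 100 * (Fintype.card ι : ℝ) ≤ A := by exact_mod_cast hA
  have hA100 : (100 : ℝ) ≤ A := by linarith
  have hApos : (0 : ℝ) < A := by linarith
  have hApow : ∀ k, (0 : ℝ) < (A : ℝ) ^ k := fun k => pow_pos hApos k
  have hAn : (A : ℝ) ^ 20 ≤ n := by
    have := hN1.trans hN
    rwa [one_le_div (hApow 20)] at this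
  have hn : 0 < n := (hApow 20).trans_le hAn
  have hnn' : n ≤ n' := by
    have := one_le_pow₀ (n := 20) (show (1 : ℝ) ≤ A by linarith)
    nlinarith
  have hra' : hr a ≤ n' / A ^ 20 := hra.trans (by gcongr)
  have hN' : (Fintype.card ι : ℝ) ≤ n' / A ^ 20 := hN.trans (by gcongr)
  obtain ⟨p, hp, q, hq, hpq⟩ := hD.mixed
  have hX := hD.le_mul_abs_lg H ha he hp hq hpq hA hra hN
  have hX' := hD'.le_mul_abs_lg H ha he' hp hq hpq hA hra' hN'
  obtain ⟨α, hα0, hαh, hαne, hα⟩ := hD.exists_approx H ha he hp hq hpq hA hra hN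
  obtain ⟨α', hα0', hαh', hαne', hα'⟩ := hD'.exists_approx H ha he' hp hq hpq hA hra' hN'
  have hXpos : 0 < |lg g e p| := by
    rcases (abs_nonneg (lg g e p)).eq_or_lt with h | h
    · rw [← h, mul_zero] at hX
      have : 0 < n / (8 * A) := by positivity
      linarith
    · exact h
  have hτ : 0 ≤ τ := H.nonneg
  set m := ⌊|lg g e' p| / |lg g e p|⌋₊ with hm
  have hm1 : m * |lg g e p| ≤ |lg g e' p| :=
    (le_div_iff₀ hXpos).mp (Nat.floor_le (by positivity))
  have hm2 : |lg g e' p| ≤ (m + 1) * |lg g e p| :=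
    (div_le_iff₀ hXpos).mp (Nat.lt_floor_add_one _).le
  rw [div_le_iff₀ (by positivity)] at hX hX'
  have hmn : m * n ≤ 8 * A * n' := by
    calc m * n ≤ m * (τ * |lg g e p| * (8 * A)) := by gcongr
      _ = τ * (m * |lg g e p|) * (8 * A) := by ring
      _ ≤ τ * |lg g e' p| * (8 * A) := by gcongr
      _ ≤ n' * (8 * A) := by gcongr; exact hn' p
      _ = 8 * A * n' := by ring
  have hn'm : n' ≤ 8 * A * (m + 1) * n := by
    calc n' ≤ τ * |lg g e' p| * (8 * A) := hX'
      _ ≤ τ * ((m + 1) * |lg g e p|) * (8 * A) := by gcongr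
      _ = (m + 1) * (τ * |lg g e p|) * (8 * A) := by ring
      _ ≤ (m + 1) * n * (8 * A) := by gcongr; exact hn1 p
      _ = 8 * A * (m + 1) * n := by ring
  have hm18 : (A : ℝ) ^ 18 ≤ m := by
    have h1 : (A : ℝ) ^ 20 ≤ 8 * A * (m + 1) := by
      have := hlt.trans hn'm
      exact le_of_mul_le_mul_right this hn
    have h2 : (A : ℝ) ^ 20 = A ^ 18 * A * A := by ring
    have h3 : (A : ℝ) ^ 18 * A ≤ 8 * (m + 1) := by
      rw [h2] at h1
      exact le_of_mul_le_mul_right (by linarith) hApos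
    have h4 : (1 : ℝ) ≤ A ^ 18 := one_le_pow₀ (by linarith)
    nlinarith
  have hm1' : (1 : ℝ) ≤ m := (one_le_pow₀ (by linarith)).trans hm18
  have hn'm2 : n' ≤ 16 * A * m * n := by
    refine hn'm.trans ?_
    have : 8 * (A : ℝ) * (m + 1) ≤ 16 * A * m := by nlinarith
    gcongr
  set u := pw g e p / pw g e q with hu
  set v := pw g (e' - m • e) p / pw g (e' - m • e) q with hv
  have huv : pw g e' p / pw g e' q = u ^ m * v := by
    rw [pw_eq_pow_mul H e e' m p, pw_eq_pow_mul H e e' m q, hu, hv, div_pow, div_mul_div_comm]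
  have hpq_close := hD.close p hp q hq
  have hpq_close' := hD'.close p hp q hq
  have hx : n / A ^ 20 ≤ n := div_le_self hn.le (one_le_pow₀ (by linarith))
  have hu_ht : ht u ≤ 2 * n := by
    have := H.ht_le e p q
    linarith [hn1 p]
  have hv_ht : ht v ≤ n + n' / A ^ 20 + m * (n / A ^ 20) := by
    refine (H.ht_le (e' - m • e) p q).trans ?_
    have h1 : |lg g (e' - m • e) p| ≤ |lg g e p| := by
      rw [abs_lg_sub_nsmul g e e' p (hs p), abs_of_nonneg (by linarith)]
      linarith
    have h2 : lg g (e' - m • e) p - lg g (e' - m • e) q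
        = (lg g e' p - lg g e' q) - m * (lg g e p - lg g e q) := by
      rw [lg_sub, lg_sub]
      simp only [lg, Pi.smul_apply, nsmul_eq_mul]
      push_cast
      ring
    have h3 : |lg g (e' - m • e) p - lg g (e' - m • e) q| ≤ n' / A ^ 20 + m * (n / A ^ 20) := by
      rw [h2]
      refine (abs_sub _ _).trans (add_le_add hpq_close' ?_)
      rw [abs_mul, Nat.abs_cast]
      exact mul_le_mul_of_nonneg_left hpq_close (by positivity)
    have h4 := mul_le_mul_of_nonneg_left h1 hτ
    linarith [hn1 p]
  obtain ⟨hz1, hz2, hz3⟩ := gap_numerics hA100 hA' hn (hn.le.trans hnn') hm18 hn'm2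
  have hcast : ((32 * A ^ 2 : ℕ) : ℝ) = 32 * (A : ℝ) ^ 2 := by push_cast; rfl
  have hT : 2 * n / (1000 * (32 * (A : ℝ) ^ 2) ^ 2) = n / A ^ 4 / 512000 := by
    field_simp
    norm_num
  have hT' : m * (2 * n) / (1000 * (32 * (A : ℝ) ^ 2) ^ 2) = m * (n / A ^ 4 / 512000) := by
    rw [← hT]
    ring
  refine thue_gap (a := 32 * A ^ 2) (m := m) (h := 2 * n) (u := u) (v := v) (α := α) (α' := α')
    ?_ ?_ ?_ (div_ne_zero (H.pw_ne _ _) (H.pw_ne _ _)) (div_ne_zero (H.pw_ne _ _) (H.pw_ne _ _))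
    hα0 hα0' hu_ht ?_ ?_ ?_ hαne ?_ ?_
  · have h1 : 0 < A := by exact_mod_cast hApos
    exact Nat.one_le_iff_ne_zero.mpr (by positivity)
  · exact_mod_cast (base_numerics hA100).1.trans hm18
  · rw [hcast]
    exact (base_numerics hA100).2.trans (by linarith)
  · rw [hcast, hT']
    exact hv_ht.trans hz1
  · rw [hcast, hT]
    exact hαh.trans hz2
  · rw [hcast, hT']
    exact hαh'.trans hz3
  · refine hα.trans (Real.exp_le_exp.mpr (neg_le_neg ?_))
    rw [hcast, div_le_div_iff₀ (by positivity) (by positivity)]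
    calc 2 * n * (2 * A) = n * (4 * A) := by ring
      _ ≤ n * (32 * A ^ 2) := by
        have h1 : (A : ℝ) ≤ A ^ 2 := le_self_pow₀ (by linarith) (by norm_num)
        exact mul_le_mul_of_nonneg_left (by linarith) hn.le
  · rw [← huv]
    refine hα'.trans (Real.exp_le_exp.mpr (neg_le_neg ?_))
    rw [hcast, div_le_div_iff₀ (by positivity) (by positivity)]
    calc m * (2 * n) * (2 * A) = 4 * A * (m * n) := by ring
      _ ≤ 4 * A * (8 * A * n') := by gcongr
      _ = n' * (32 * A ^ 2) := by ring

end SUnit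

namespace SUnit

variable {ι : Type*} [Fintype ι] {g : ι → ℕ} {τ : ℝ} {a : ι → ℚ} {i0 : ι}

/-- Solutions with size in an interval. -/
theorem cov_of_size_mem_Icc (H : HtParam g τ) (ha : ∀ i, a i ≠ 0) {σ : ℝ}
    (hσ : 10 * (Fintype.card ι : ℝ) ^ 2 ≤ σ) {Z : Set (ι → ℤ)}
    (hZ0 : ∀ e ∈ Z, ∑ i, a i * pw g e i = 0)
    (hmin : ∀ e ∈ Z, hr a ≤ hr fun i => a i * pw g e i) (R : ℕ)
    (hl : ∀ e ∈ Z, σ ≤ size g τ i0 e) (hu : ∀ e ∈ Z, size g τ i0 e ≤ 2 ^ R * σ) :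
    Cov g ((R + 1) * (400 * Fintype.card ι ^ 2 + 1) ^ Fintype.card ι) Z := by
  have hσ0 : 0 ≤ σ := le_trans (by positivity) hσ
  induction R generalizing Z with
  | zero =>
    refine (cov_of_size_le_two_mul H ha hσ hZ0 (fun e he => (hu e he).trans (by linarith))
      fun e he => le_trans ?_ (quarter_size_le_hr H i0 e ha (hmin e he))).mono (by simp) subset_rfl
    linarith [hl e he]
  | succ R ih =>
    have h1 := ih (Z := {e ∈ Z | size g τ i0 e ≤ 2 ^ R * σ}) (fun e he => hZ0 e he.1)
      (fun e he => hmin e he.1) (fun e he => hl e he.1) fun e he => he.2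
    have h2 := cov_of_size_le_two_mul (i0 := i0) H ha (σ := 2 ^ R * σ)
      (hσ.trans (le_mul_of_one_le_left hσ0 (one_le_pow₀ one_le_two)))
      (Z := {e ∈ Z | 2 ^ R * σ ≤ size g τ i0 e}) (fun e he => hZ0 e he.1)
      (fun e he => (hu e he.1).trans_eq (by ring))
      fun e he => le_trans (by linarith [he.2]) (quarter_size_le_hr H i0 e ha (hmin e he.1))
    refine (h1.union h2).mono (le_of_eq (by ring)) fun e he => ?_
    rcases le_total (size g τ i0 e) (2 ^ R * σ) with h | h
    · exact Or.inl ⟨he, h⟩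
    · exact Or.inr ⟨he, h⟩

/-- The binary logarithm of the largest scale, rounded up. -/
def logScale (N : ℕ) : ℕ := (7 + N) * 20 ^ N

theorem scale_le_two_pow (N : ℕ) : scale N N ≤ 2 ^ logScale N := by
  rw [scale, logScale, pow_mul]
  refine Nat.pow_le_pow_left ?_ _
  rw [pow_add]
  exact Nat.mul_le_mul (by norm_num) N.lt_two_pow_self.le

/-- Large solutions with a given pattern. -/
theorem cov_of_pattern (H : HtParam g τ) (ha : ∀ i, a i ≠ 0) {s : ℝ}
    (hs : 10 * (Fintype.card ι : ℝ) ^ 2 ≤ s) (hra : hr a ≤ s) {Z : Set (ι → ℤ)}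
    (hZ : ∀ e ∈ Z, IsSol g a e) (hmin : ∀ e ∈ Z, hr a ≤ hr fun i => a i * pw g e i)
    (hl : ∀ e ∈ Z, 2 ^ logScale (Fintype.card ι) * s ≤ size g τ i0 e) {D : Finset ι} {t : ℕ}
    (htN : t < Fintype.card ι)
    (hD : ∀ e ∈ Z, IsPattern g (size g τ i0 e) (scale (Fintype.card ι) t) D e)
    (hsgn : ∀ e ∈ Z, ∀ e' ∈ Z, ∀ i, 0 ≤ lg g e i ↔ 0 ≤ lg g e' i) :
    Cov g ((2 * logScale (Fintype.card ι) + 1) *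
      (400 * Fintype.card ι ^ 2 + 1) ^ Fintype.card ι) Z := by
  have : Nonempty ι := ⟨i0⟩
  set N := Fintype.card ι with hN
  set W := logScale N
  have hNpos : 1 ≤ N := Fintype.card_pos
  have hN1 : (1 : ℝ) ≤ N := by exact_mod_cast hNpos
  have hs0 : 0 < s := lt_of_lt_of_le (by positivity) hs
  have hsN : (N : ℝ) ≤ s := by nlinarith
  have hA20 : ((scale N t : ℕ) : ℝ) ^ 20 ≤ 2 ^ W := by
    have h1 : scale N t ^ 20 ≤ 2 ^ W := by
      rw [← scale_succ]
      exact (scale_mono hNpos (show t + 1 ≤ N from htN)).trans (scale_le_two_pow N)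
    exact_mod_cast h1
  have hA0 : (0 : ℝ) < ((scale N t : ℕ) : ℝ) ^ 20 := by
    have := le_scale hNpos t
    have : 0 < scale N t := by omega
    positivity
  have hle : ∀ e ∈ Z, s ≤ size g τ i0 e / ((scale N t : ℕ) : ℝ) ^ 20 := fun e he => by
    rw [le_div_iff₀ hA0, mul_comm]
    exact (mul_le_mul_of_nonneg_right hA20 hs0.le).trans (hl e he)
  have hratio : ∀ e ∈ Z, ∀ e' ∈ Z, size g τ i0 e' ≤ 2 ^ W * size g τ i0 e := fun e he e' he' =>
    ((hD e he).lt_of_isPattern H ha (hZ e he) (hZ e' he') (hD e' he') (hsgn e he e' he')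
      (le_scale hNpos t) (hra.trans (hle e he)) (hsN.trans (hle e he))).le.trans
      (mul_le_mul_of_nonneg_right hA20 (size_nonneg H i0 e))
  rcases Set.eq_empty_or_nonempty Z with h0 | ⟨e0, he0⟩
  · rw [h0]
    exact Cov.empty.mono (Nat.zero_le _) subset_rfl
  refine cov_of_size_mem_Icc (i0 := i0) H ha (σ := size g τ i0 e0 / 2 ^ W) ?_
    (fun e he => (hZ e he).1) hmin (2 * W) (fun e he => ?_) fun e he => ?_
  · refine hs.trans ?_
    rw [le_div_iff₀ (by positivity), mul_comm]
    exact hl e0 he0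
  · rw [div_le_iff₀ (by positivity), mul_comm]
    exact hratio e he e0 he0
  · refine (hratio e0 he0 e he).trans_eq ?_
    rw [two_mul, pow_add]
    field_simp

/-- The number of relations needed for `N` unknowns. -/
def relationCount (N : ℕ) : ℕ :=
  (2 + logScale N + 2 ^ N * (N * 2 ^ N) * (2 * logScale N + 1)) * (400 * N ^ 2 + 1) ^ N

theorem cov_of_min (H : HtParam g τ) (hN : 3 ≤ Fintype.card ι) (ha : ∀ i, a i ≠ 0)
    (hmin : ∀ e, IsSol g a e → hr a ≤ hr fun i => a i * pw g e i) :
    Cov g (relationCount (Fintype.card ι)) {e | IsSol g a e} := by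
  classical
  obtain ⟨i0⟩ : Nonempty ι := Fintype.card_pos_iff.mp (by omega)
  have : Nonempty ι := ⟨i0⟩
  set N := Fintype.card ι with hNdef
  set s := max (hr a) (10 * (N : ℝ) ^ 2) with hs
  have hN1 : (1 : ℝ) ≤ N := by exact_mod_cast (show 1 ≤ N by omega)
  have hs1 : 10 * (N : ℝ) ^ 2 ≤ s := le_max_right _ _
  have hs2 : hr a ≤ s := le_max_left _ _
  have hs0 : 0 < s := lt_of_lt_of_le (by positivity) hs1
  have hsN : (N : ℝ) ≤ s := by nlinarith
  have hsc : ((scale N N : ℕ) : ℝ) ≤ 2 ^ logScale N := by exact_mod_cast scale_le_two_pow N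
  have hsc0 : (0 : ℝ) < (scale N N : ℕ) := by
    have := le_scale (N := N) (by omega) N
    exact_mod_cast (show 0 < scale N N by omega)
  have hsmall : Cov g ((400 * N ^ 2 + 1) ^ N) {e | IsSol g a e ∧ size g τ i0 e ≤ s} := by
    rcases le_total (hr a) (10 * (N : ℝ) ^ 2) with h | h
    · refine cov_of_size_le (i0 := i0) H hN fun e he => he.2.trans ?_
      rw [hs, max_eq_right h]
    · have hsr : s = hr a := max_eq_left h
      refine cov_of_size_le_two_mul (i0 := i0) H ha hs1 (fun e he => he.1.1)
        (fun e he => he.2.trans (by linarith)) fun e he => ?_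
      linarith [hmin e he.1]
  have hmid := cov_of_size_mem_Icc (i0 := i0) H ha hs1
    (Z := {e | IsSol g a e ∧ s ≤ size g τ i0 e ∧ size g τ i0 e ≤ 2 ^ logScale N * s})
    (fun e he => he.1.1) (fun e he => hmin e he.1) (logScale N) (fun e he => he.2.1)
    fun e he => he.2.2
  set Z := {e | IsSol g a e ∧ 2 ^ logScale N * s ≤ size g τ i0 e} with hZ
  have hpat : ∀ e ∈ Z, ∃ D t, t < N ∧ IsPattern g (size g τ i0 e) (scale N t) D e := by
    intro e he
    have h1 : s ≤ size g τ i0 e / (scale N N : ℕ) := by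
      rw [le_div_iff₀ hsc0, mul_comm]
      exact (mul_le_mul_of_nonneg_right hsc hs0.le).trans he.2
    obtain ⟨D, t, htN, hD⟩ := exists_pattern (i0 := i0) H ha he.1
      (lt_of_lt_of_le (by positivity) he.2) (hs2.trans h1) (hsN.trans h1)
    exact ⟨D, t, htN, hD⟩
  choose! D t htN hD using hpat
  have hlarge : Cov g (2 ^ N * (N * 2 ^ N) * ((2 * logScale N + 1) * (400 * N ^ 2 + 1) ^ N)) Z := by
    refine Cov.of_fiber (fun e => (D e, t e, Finset.univ.filter fun i => 0 ≤ lg g e i))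
      (Finset.univ ×ˢ Finset.range N ×ˢ Finset.univ) (by simp [hNdef]) (fun e he => by
        simpa using htN e he) ?_
    rintro ⟨D0, t0, S⟩ hb
    have ht0 : t0 < N := by simpa using hb
    refine cov_of_pattern (i0 := i0) (D := D0) (t := t0) H ha hs1 hs2 (fun e he => he.1.1)
      (fun e he => hmin e he.1.1) (fun e he => he.1.2) ht0 (fun e he => ?_) fun e he e' he' i => ?_
    · have h1 := he.2
      simp only [Prod.mk.injEq] at h1
      rw [← h1.1, ← h1.2.1]
      exact hD e he.1
    · have h1 := he.2
      have h2 := he'.2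
      simp only [Prod.mk.injEq] at h1 h2
      have h3 := Finset.ext_iff.mp (h1.2.2.trans h2.2.2.symm) i
      simpa using h3
  refine ((hsmall.union hmid).union hlarge).mono (le_of_eq ?_) fun e he => ?_
  · rw [relationCount]
    ring
  · rcases le_total (size g τ i0 e) s with h | h
    · exact Or.inl (Or.inl ⟨he, h⟩)
    · rcases le_total (size g τ i0 e) (2 ^ logScale N * s) with h' | h'
      · exact Or.inl (Or.inr ⟨he, h, h'⟩)
      · exact Or.inr ⟨he, h'⟩

theorem IsSol.sub (H : HtParam g τ) {e e0 : ι → ℤ} (he : IsSol g a e) :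
    IsSol g (fun i => a i * pw g e0 i) (e - e0) := by
  have h : ∀ i, a i * pw g e0 i * pw g (e - e0) i = a i * pw g e i := fun i => by
    rw [H.pw_sub]
    have := H.pw_ne e0 i
    field_simp
  simpa only [IsSol, h] using he

/-- The nondegenerate solutions satisfy one of few further linear relations. -/
theorem cov_isSol (H : HtParam g τ) (hN : 3 ≤ Fintype.card ι) (ha : ∀ i, a i ≠ 0) :
    Cov g (relationCount (Fintype.card ι)) {e | IsSol g a e} := by
  classical
  rcases Set.eq_empty_or_nonempty {e | IsSol g a e} with h0 | hne
  · rw [h0]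
    exact Cov.empty.mono (Nat.zero_le _) subset_rfl
  let f : (ι → ℤ) → ℕ := fun e =>
    Finset.univ.sup fun p : ι × ι => mulHeight (a p.1 * pw g e p.1 / (a p.2 * pw g e p.2))
  obtain ⟨e0, he0, hmin⟩ := (measure f).wf.has_min _ hne
  have hmin' : ∀ e, IsSol g (fun i => a i * pw g e0 i) e →
      hr (fun i => a i * pw g e0 i) ≤ hr fun i => a i * pw g e0 i * pw g e i := fun e he => by
    have h1 : IsSol g a (e0 + e) := by
      simpa only [IsSol, H.pw_add, ← mul_assoc] using he
    have h2 : f e0 ≤ f (e0 + e) := not_lt.mp (hmin _ h1)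
    obtain ⟨i0⟩ : Nonempty ι := Fintype.card_pos_iff.mp (by omega)
    have h3 : 0 < f e0 := (one_le_mulHeight _).trans
      (Finset.le_sup (f := fun p : ι × ι =>
        mulHeight (a p.1 * pw g e0 p.1 / (a p.2 * pw g e0 p.2))) (Finset.mem_univ (i0, i0)))
    have h4 : hr (fun i => a i * pw g e0 i * pw g e i) = Real.log (f (e0 + e)) := by
      simp only [hr, f, H.pw_add, mul_assoc]
    rw [h4]
    exact Real.log_le_log (by exact_mod_cast h3) (by exact_mod_cast h2)
  obtain ⟨R, hR1, hR2, hR3⟩ := cov_of_min H hN (fun i => mul_ne_zero (ha i) (H.pw_ne e0 i)) hmin'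
  refine ⟨R.image fun c i => c i / pw g e0 i, Finset.card_image_le.trans hR1, ?_, fun e he => ?_⟩
  · simp only [Finset.mem_image]
    rintro _ ⟨c, hc, rfl⟩
    obtain ⟨h1, i, hi⟩ := hR2 c hc
    refine ⟨fun h => h1 (funext fun j => ?_), i, by simp [hi]⟩
    simpa [H.pw_ne e0 j] using congrFun h j
  · obtain ⟨c, hc, h⟩ := hR3 (e - e0) (IsSol.sub H he)
    refine ⟨_, Finset.mem_image_of_mem _ hc, ?_⟩
    rw [← h]
    refine Finset.sum_congr rfl fun i _ => ?_
    rw [H.pw_sub]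
    ring

theorem relationCount_le {N : ℕ} (hN : 3 ≤ N) : relationCount N ≤ 2 ^ (10 * N ^ 2) := by
  have hN1 : N + 1 ≤ 2 ^ N := N.lt_two_pow_self
  have hsq : N ^ 2 ≤ 2 ^ (N + 1) := by
    induction N, hN using Nat.le_induction with
    | base => norm_num
    | succ k hk ih =>
      have := ih k.lt_two_pow_self
      rw [pow_succ 2 (k + 1)]
      nlinarith
  have h7 : 7 + N ≤ 2 ^ (N + 1) := by
    have := Nat.pow_le_pow_right (n := 2) (by norm_num) hN
    rw [pow_succ]
    omega
  have hbase : 400 * N ^ 2 + 1 ≤ 2 ^ (N + 10) := by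
    rw [show N + 10 = (N + 1) + 9 by ring, pow_add 2 (N + 1) 9]
    have : 1 ≤ N ^ 2 := Nat.one_le_pow _ _ (by omega)
    omega
  have hW : logScale N ≤ 2 ^ (6 * N + 1) := by
    rw [logScale]
    calc (7 + N) * 20 ^ N ≤ 2 ^ (N + 1) * (2 ^ 5) ^ N :=
          Nat.mul_le_mul h7 (Nat.pow_le_pow_left (by norm_num) _)
      _ = 2 ^ (6 * N + 1) := by rw [← pow_mul, ← pow_add]; congr 1; ring
  have h1 : 1 ≤ 2 ^ (6 * N) := Nat.one_le_two_pow
  have hW2 : 2 * logScale N + 1 ≤ 2 ^ (6 * N + 3) := by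
    rw [pow_add] at hW ⊢
    omega
  have hmain : 2 ^ N * (N * 2 ^ N) * (2 * logScale N + 1) ≤ 2 ^ (9 * N + 3) := by
    calc 2 ^ N * (N * 2 ^ N) * (2 * logScale N + 1)
        ≤ 2 ^ N * (2 ^ N * 2 ^ N) * 2 ^ (6 * N + 3) := by gcongr; omega
      _ = 2 ^ (9 * N + 3) := by rw [← pow_add, ← pow_add, ← pow_add]; congr 1; ring
  have htot : 2 + logScale N + 2 ^ N * (N * 2 ^ N) * (2 * logScale N + 1) ≤ 2 ^ (9 * N + 4) := by
    have h2 : 2 ^ (6 * N) ≤ 2 ^ (9 * N) := Nat.pow_le_pow_right (by norm_num) (by omega)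
    rw [pow_add] at hW hmain ⊢
    omega
  rw [relationCount]
  calc _ ≤ 2 ^ (9 * N + 4) * (2 ^ (N + 10)) ^ N :=
        Nat.mul_le_mul htot (Nat.pow_le_pow_left hbase _)
    _ = 2 ^ (9 * N + 4 + (N + 10) * N) := by rw [← pow_mul, ← pow_add]
    _ ≤ 2 ^ (10 * N ^ 2) := Nat.pow_le_pow_right (by norm_num) (by nlinarith)

end SUnit

namespace SUnit

variable {ι : Type*}

/-- `∑ i ∈ s, a i * X i = 0`, and no proper nonempty subsum vanishes. -/
def Nondeg (s : Finset ι) (a X : ι → ℚ) : Prop :=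
  ∑ i ∈ s, a i * X i = 0 ∧ ∀ I ⊆ s, I.Nonempty → I ≠ s → ∑ i ∈ I, a i * X i ≠ 0

/-- Proportionality of two vectors on `s`. -/
def Par (s : Finset ι) (X v : ι → ℚ) : Prop := ∀ i ∈ s, ∀ j ∈ s, X i * v j = X j * v i

/-- On `s`, every vector in `Z` is proportional to one of at most `K` vectors. -/
def Reps (Z : Set (ι → ℚ)) (s : Finset ι) (K : ℕ) : Prop :=
  ∃ V : Finset (ι → ℚ), V.card ≤ K ∧ (∀ v ∈ V, ∀ i ∈ s, v i ≠ 0) ∧ ∀ X ∈ Z, ∃ v ∈ V, Par s X v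

theorem Reps.of_empty {Z : Set (ι → ℚ)} {s : Finset ι} (K : ℕ) (h : ∀ X, X ∉ Z) : Reps Z s K :=
  ⟨∅, by simp, by simp, fun X hX => absurd hX (h X)⟩

theorem Reps.of_cover {Z : Set (ι → ℚ)} {s : Finset ι} {K : ℕ} {α : Type*} (F : Finset α)
    (Y : α → Set (ι → ℚ)) (h : ∀ x ∈ F, Reps (Y x) s K) (hZ : ∀ X ∈ Z, ∃ x ∈ F, X ∈ Y x) :
    Reps Z s (F.card * K) := by
  classical
  choose! V h1 h2 h3 using h
  refine ⟨F.biUnion V, Finset.card_biUnion_le_card_mul _ _ _ h1, fun v hv => ?_, fun X hX => ?_⟩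
  · obtain ⟨x, hx, hv⟩ := Finset.mem_biUnion.mp hv
    exact h2 x hx v hv
  · obtain ⟨x, hx, hX⟩ := hZ X hX
    obtain ⟨v, hv, hp⟩ := h3 x hx X hX
    exact ⟨v, Finset.mem_biUnion.mpr ⟨x, hx, hv⟩, hp⟩

theorem Reps.of_pair [DecidableEq ι] {i j : ι} (hij : i ≠ j) {a : ι → ℚ} (hi : a i ≠ 0)
    (hj : a j ≠ 0) : Reps {X | Nondeg {i, j} a X} {i, j} 1 := by
  refine ⟨{fun x => if x = i then a j else - a i}, by simp, ?_, fun X hX =>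
    ⟨_, Finset.mem_singleton_self _, ?_⟩⟩
  · simp only [Finset.mem_singleton, forall_eq]
    intro x _
    split_ifs <;> simpa
  · have h := hX.1
    rw [Finset.sum_pair hij] at h
    intro x hx y hy
    simp only [Finset.mem_insert, Finset.mem_singleton] at hx hy
    rcases hx with rfl | rfl <;> rcases hy with rfl | rfl <;> simp [hij.symm] <;> linarith

/-- A vanishing sum with a nonvanishing term contains a nondegenerate vanishing subsum. -/
theorem exists_nondeg_subset {s : Finset ι} {c X : ι → ℚ} (hX : ∀ i, X i ≠ 0)
    (hc : ∃ i ∈ s, c i ≠ 0) (hc0 : ∃ i ∈ s, c i = 0) (h : ∑ i ∈ s, c i * X i = 0) :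
    ∃ S ⊂ s, 2 ≤ S.card ∧ (∀ i ∈ S, c i ≠ 0) ∧ Nondeg S c X := by
  classical
  let F := {S ∈ s.powerset | S.Nonempty ∧ (∀ i ∈ S, c i ≠ 0) ∧ ∑ i ∈ S, c i * X i = 0}
  have hF : F.Nonempty := by
    refine ⟨{i ∈ s | c i ≠ 0}, ?_⟩
    simp only [F, Finset.mem_filter, Finset.mem_powerset, Finset.filter_subset, true_and]
    refine ⟨hc.imp fun i hi => by simpa using hi, fun i hi => hi.2, ?_⟩
    rw [Finset.sum_filter_of_ne, h]
    exact fun i _ hi => left_ne_zero_of_mul hi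
  obtain ⟨S, hS, hmin⟩ := Finset.exists_min_image F Finset.card hF
  simp only [F, Finset.mem_filter, Finset.mem_powerset] at hS hmin
  obtain ⟨hSs, hne, hcS, hsum⟩ := hS
  refine ⟨S, hSs.ssubset_of_ne ?_, ?_, hcS, hsum, fun I hI hIne hIS h0 => ?_⟩
  · rintro rfl
    obtain ⟨i, hi, h0⟩ := hc0
    exact hcS i hi h0
  · by_contra hlt
    have h1 : S.card = 1 := by have := hne.card_pos; omega
    obtain ⟨i, rfl⟩ := Finset.card_eq_one.mp h1
    rw [Finset.sum_singleton] at hsum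
    exact mul_ne_zero (hcS i (by simp)) (hX i) hsum
  · have := hmin I ⟨hI.trans hSs, hIne, fun i hi => hcS i (hI hi), h0⟩
    exact absurd (Finset.card_lt_card (hI.ssubset_of_ne hIS)) (by omega)

section Merge

variable [DecidableEq ι] {s S : Finset ι} {a v X : ι → ℚ} {i₀ : ι}

/-- The coefficients after replacing the block `S` by the single index `i₀`. -/
def merge (S : Finset ι) (a v : ι → ℚ) (i₀ : ι) : ι → ℚ :=
  Function.update a i₀ ((∑ i ∈ S, a i * v i) / v i₀)

theorem merge_mul (hv : v i₀ ≠ 0) (hi : i₀ ∈ S) (hpar : Par S X v) :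
    merge S a v i₀ i₀ * X i₀ = ∑ i ∈ S, a i * X i := by
  rw [merge, Function.update_self, div_mul_eq_mul_div, div_eq_iff hv, Finset.sum_mul,
    Finset.sum_mul]
  refine Finset.sum_congr rfl fun i h => ?_
  have := hpar i h i₀ hi
  linear_combination -a i * this

theorem merge_of_ne {i : ι} (h : i ≠ i₀) : merge S a v i₀ i = a i := Function.update_of_ne h _ _

theorem Nondeg.merge (h : Nondeg s a X) (hS : S ⊆ s) (hv : v i₀ ≠ 0) (hi : i₀ ∈ S)
    (hpar : Par S X v) : Nondeg (insert i₀ (s \ S)) (merge S a v i₀) X := by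
  have hm := merge_mul (a := a) hv hi hpar
  have hdiff : ∀ I ⊆ s \ S,
      ∑ i ∈ I, SUnit.merge S a v i₀ i * X i = ∑ i ∈ I, a i * X i := fun I hI =>
    Finset.sum_congr rfl fun i h => by
      rw [merge_of_ne]
      rintro rfl
      exact (Finset.mem_sdiff.mp (hI h)).2 hi
  have hins : ∀ I ⊆ s \ S, ∑ i ∈ insert i₀ I, SUnit.merge S a v i₀ i * X i
      = ∑ i ∈ S ∪ I, a i * X i := fun I hI => by
    have hdisj : Disjoint S I := Finset.disjoint_of_subset_right hI Finset.disjoint_sdiff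
    rw [Finset.sum_insert (Finset.disjoint_left.mp hdisj hi), hm, hdiff I hI,
      Finset.sum_union hdisj]
  refine ⟨?_, fun I hI hne hIs => ?_⟩
  · rw [hins _ subset_rfl, Finset.union_sdiff_of_subset hS, h.1]
  · by_cases hiI : i₀ ∈ I
    · have hJ : I.erase i₀ ⊆ s \ S := fun i hi' =>
        (Finset.mem_insert.mp (hI (Finset.mem_of_mem_erase hi'))).resolve_left
          (Finset.ne_of_mem_erase hi')
      rw [← Finset.insert_erase hiI, hins _ hJ]
      refine h.2 _ (Finset.union_subset hS (hJ.trans Finset.sdiff_subset))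
        ⟨i₀, Finset.mem_union_left _ hi⟩ fun heq => hIs ?_
      rw [← Finset.insert_erase hiI]
      congr 1
      refine hJ.antisymm fun i h' => ?_
      have h'' := Finset.mem_sdiff.mp h'
      exact (Finset.mem_union.mp (heq ▸ h''.1)).resolve_left h''.2
    · have hJ : I ⊆ s \ S := fun i hi' =>
        (Finset.mem_insert.mp (hI hi')).resolve_left fun h => hiI (h ▸ hi')
      rw [hdiff _ hJ]
      refine h.2 _ (hJ.trans Finset.sdiff_subset) hne ?_
      rintro rfl
      exact (Finset.mem_sdiff.mp (hJ (hS hi))).2 hi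

/-- Glue a vector on `S` to a vector on `insert i₀ (s \ S)`. -/
def glue (S : Finset ι) (v w : ι → ℚ) (i₀ : ι) (i : ι) : ℚ :=
  if i ∈ S then w i₀ * v i / v i₀ else w i

theorem glue_ne_zero {w : ι → ℚ} (hv : ∀ i ∈ S, v i ≠ 0) (hi : i₀ ∈ S)
    (hw : ∀ i ∈ insert i₀ (s \ S), w i ≠ 0) : ∀ i ∈ s, glue S v w i₀ i ≠ 0 := by
  intro i his
  rw [glue]
  split_ifs with h
  · exact div_ne_zero (mul_ne_zero (hw _ (by simp)) (hv i h)) (hv _ hi)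
  · exact hw i (by simp [h, his])

theorem Par.glue {w : ι → ℚ} (hX : ∀ i, X i ≠ 0) (hv : v i₀ ≠ 0) (hi : i₀ ∈ S)
    (h1 : Par S X v) (h2 : Par (insert i₀ (s \ S)) X w) : Par s X (glue S v w i₀) := by
  have key : ∀ i ∈ s, SUnit.glue S v w i₀ i * X i₀ = w i₀ * X i := fun i his => by
    rw [SUnit.glue]
    split_ifs with h
    · have := h1 i h i₀ hi
      field_simp
      linear_combination (-w i₀) * this
    · have := h2 i (by simp [h, his]) i₀ (by simp)
      linear_combination -this
  intro i hi j hj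
  have h1 := key i hi
  have h2 := key j hj
  apply mul_right_cancel₀ (hX i₀)
  linear_combination X i * h2 - X j * h1

end Merge

/-- If nondegenerate solutions always satisfy one of boundedly many shorter relations, then they
are boundedly many up to proportionality. -/
theorem reps_of_relations [Fintype ι] {P : Set (ι → ℚ)} (hP : ∀ X ∈ P, ∀ i, X i ≠ 0) {C : ℕ}
    (hC : ∀ (s : Finset ι) (a : ι → ℚ), 3 ≤ s.card → (∀ i ∈ s, a i ≠ 0) →
      ∃ R : Finset (ι → ℚ), R.card ≤ C ∧
        (∀ c ∈ R, (∃ i ∈ s, c i ≠ 0) ∧ ∃ i ∈ s, c i = 0) ∧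
        ∀ X ∈ P, Nondeg s a X → ∃ c ∈ R, ∑ i ∈ s, c i * X i = 0) :
    ∀ (N : ℕ) (s : Finset ι) (a : ι → ℚ), s.card = N → 2 ≤ N → (∀ i ∈ s, a i ≠ 0) →
      Reps {X ∈ P | Nondeg s a X} s ((C * 2 ^ Fintype.card ι) ^ (N - 2)) := by
  classical
  set G := C * 2 ^ Fintype.card ι with hG
  intro N
  induction N using Nat.strong_induction_on with
  | _ N ih =>
  intro s a hs hN ha
  rcases hN.eq_or_lt with rfl | hN
  · obtain ⟨i, j, hij, rfl⟩ := Finset.card_eq_two.mp hs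
    obtain ⟨V, h1, h2, h3⟩ := Reps.of_pair hij (ha i (by simp)) (ha j (by simp))
    exact ⟨V, by simpa using h1, h2, fun X hX => h3 X hX.2⟩
  obtain ⟨R, hRC, hR, hrel⟩ := hC s a (by omega) ha
  have hblock : ∀ p ∈ R ×ˢ (Finset.univ : Finset (Finset ι)),
      Reps {X ∈ P | Nondeg s a X ∧ p.2 ⊂ s ∧ 2 ≤ p.2.card ∧ (∀ i ∈ p.2, p.1 i ≠ 0) ∧
        Nondeg p.2 p.1 X} s (G ^ (N - 3)) := by
    rintro ⟨c, S⟩ -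
    by_cases hgood : S ⊂ s ∧ 2 ≤ S.card ∧ ∀ i ∈ S, c i ≠ 0
    swap
    · exact Reps.of_empty _ fun X hX => hgood ⟨hX.2.2.1, hX.2.2.2.1, hX.2.2.2.2.1⟩
    obtain ⟨hSs, hS2, hcS⟩ := hgood
    have hlt : S.card < N := hs ▸ Finset.card_lt_card hSs
    obtain ⟨V, hV1, hV2, hV3⟩ := ih _ hlt S c rfl hS2 hcS
    obtain ⟨i₀, hi₀⟩ : S.Nonempty := Finset.card_pos.mp (by omega)
    set s' := insert i₀ (s \ S) with hs'
    have hcard : s'.card = N - S.card + 1 := by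
      rw [hs', Finset.card_insert_of_notMem (by simp [hi₀]), Finset.card_sdiff_of_subset hSs.1, hs]
    have hone : ∀ v ∈ V, Reps {X ∈ P | Nondeg s a X ∧ Par S X v} s (G ^ (N - S.card - 1)) := by
      intro v hv
      by_cases hem : ∃ X, X ∈ P ∧ Nondeg s a X ∧ Par S X v
      swap
      · exact Reps.of_empty _ fun X hX => hem ⟨X, hX⟩
      obtain ⟨X₀, hX₀, hnd, hpar⟩ := hem
      have hvi := hV2 v hv i₀ hi₀
      have ha' : ∀ i ∈ s', merge S a v i₀ i ≠ 0 := by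
        intro i hi
        by_cases hii : i = i₀
        · subst hii
          refine left_ne_zero_of_mul (b := X₀ i) ?_
          rw [merge_mul hvi hi₀ hpar]
          exact hnd.2 S hSs.1 ⟨i, hi₀⟩ hSs.ne
        · rw [merge_of_ne hii]
          refine ha i ?_
          rw [hs', Finset.mem_insert, Finset.mem_sdiff] at hi
          exact (hi.resolve_left hii).1
      obtain ⟨W, hW1, hW2, hW3⟩ := ih (N - S.card + 1) (by omega) s' (merge S a v i₀) hcard
        (by omega) ha'
      refine ⟨W.image fun w => glue S v w i₀, Finset.card_image_le.trans (hW1.trans_eq ?_), ?_, ?_⟩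
      · congr 1
      · intro u hu
        obtain ⟨w, hw, rfl⟩ := Finset.mem_image.mp hu
        exact glue_ne_zero (hV2 v hv) hi₀ (hW2 w hw)
      · rintro X ⟨hXP, hXn, hXv⟩
        obtain ⟨w, hw, hwp⟩ := hW3 X ⟨hXP, hXn.merge hSs.1 hvi hi₀ hXv⟩
        exact ⟨_, Finset.mem_image_of_mem _ hw, Par.glue (hP X hXP) hvi hi₀ hXv hwp⟩
    obtain ⟨U, hU1, hU2, hU3⟩ := Reps.of_cover
      (Z := {X ∈ P | Nondeg s a X ∧ Nondeg S c X}) V _ hone fun X hX => by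
        obtain ⟨v, hv, hp⟩ := hV3 X ⟨hX.1, hX.2.2⟩
        exact ⟨v, hv, hX.1, hX.2.1, hp⟩
    refine ⟨U, hU1.trans ?_, hU2, fun X hX => hU3 X ⟨hX.1, hX.2.1, hX.2.2.2.2.2⟩⟩
    calc V.card * G ^ (N - S.card - 1) ≤ G ^ (S.card - 2) * G ^ (N - S.card - 1) :=
          Nat.mul_le_mul_right _ hV1
      _ = G ^ (N - 3) := by rw [← pow_add]; congr 1; omega
  obtain ⟨U, hU1, hU2, hU3⟩ := Reps.of_cover (Z := {X ∈ P | Nondeg s a X}) _ _ hblock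
    fun X hX => by
      obtain ⟨c, hc, hsum⟩ := hrel X hX.1 hX.2
      obtain ⟨S, h1, h2, h3, h4⟩ := exists_nondeg_subset (hP X hX.1) (hR c hc).1 (hR c hc).2 hsum
      exact ⟨(c, S), by simp [hc], hX.1, hX.2, h1, h2, h3, h4⟩
  refine ⟨U, hU1.trans ?_, hU2, hU3⟩
  rw [Finset.card_product, Finset.card_univ, Fintype.card_finset]
  calc R.card * 2 ^ Fintype.card ι * G ^ (N - 3) ≤ G * G ^ (N - 3) :=
        Nat.mul_le_mul_right _ (Nat.mul_le_mul_right _ hRC)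
    _ = G ^ (N - 2) := by rw [← pow_succ']; congr 1; omega

/-- The relations found on a type, extended by zero from a finite subset. -/
theorem exists_relations [Fintype ι] {k l : ℕ} (hk : 2 ≤ k) (hl : 2 ≤ l) {g : ι → ℕ}
    (hg : ∀ i, g i = k ∨ g i = l) (s : Finset ι) (a : ι → ℚ) (hs : 3 ≤ s.card)
    (ha : ∀ i ∈ s, a i ≠ 0) :
    ∃ R : Finset (ι → ℚ), R.card ≤ 2 ^ (10 * Fintype.card ι ^ 2) ∧
      (∀ c ∈ R, (∃ i ∈ s, c i ≠ 0) ∧ ∃ i ∈ s, c i = 0) ∧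
      ∀ X ∈ Set.range (pw g), Nondeg s a X → ∃ c ∈ R, ∑ i ∈ s, c i * X i = 0 := by
  classical
  obtain ⟨τ, H⟩ := exists_htParam hk hl (fun i : s => g i) fun i => hg i
  have hcard : Fintype.card s = s.card := Fintype.card_coe s
  obtain ⟨R, hR1, hR2, hR3⟩ := cov_isSol (a := fun i : s => a i) H (by rwa [hcard])
    fun i => ha i i.2
  let ext (c : s → ℚ) (i : ι) : ℚ := if h : i ∈ s then c ⟨i, h⟩ else 0
  have hext : ∀ c (i : s), ext c i = c i := fun c i => by simp [ext]
  refine ⟨R.image ext, Finset.card_image_le.trans (hR1.trans ?_), ?_, ?_⟩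
  · rw [hcard]
    exact (relationCount_le hs).trans (Nat.pow_le_pow_right (by norm_num)
      (Nat.mul_le_mul_left _ (Nat.pow_le_pow_left (Finset.card_le_univ s) 2)))
  · intro d hd
    obtain ⟨c, hc, rfl⟩ := Finset.mem_image.mp hd
    obtain ⟨h0, i, hi⟩ := hR2 c hc
    obtain ⟨j, hj⟩ := Function.ne_iff.mp h0
    exact ⟨⟨j, j.2, by rwa [hext]⟩, i, i.2, by rw [hext, hi]⟩
  · rintro _ ⟨e, rfl⟩ ⟨hsum, hsub⟩
    have hsol : IsSol (fun i : s => g i) (fun i : s => a i) fun i => e i := by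
      refine ⟨by rw [← hsum, ← Finset.sum_coe_sort s]; rfl, fun I hI hne => ?_⟩
      have := hsub (I.map (Function.Embedding.subtype _)) (fun x hx => by
        obtain ⟨y, _, rfl⟩ := Finset.mem_map.mp hx
        exact y.2) (hI.map) fun h => hne <| by
          ext x
          have hx : (x : ι) ∈ I.map (Function.Embedding.subtype _) := by rw [h]; exact x.2
          simpa using hx
      rw [Finset.sum_map] at this
      exact this
    obtain ⟨c, hc, h⟩ := hR3 _ hsol
    refine ⟨ext c, Finset.mem_image_of_mem _ hc, ?_⟩
    rw [← Finset.sum_coe_sort s, ← h]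
    exact Finset.sum_congr rfl fun i _ => by rw [hext]; rfl

end SUnit

namespace SUnit

theorem count_bound {N : ℕ} (hN : 2 ≤ N) :
    (2 ^ (10 * N ^ 2) * 2 ^ N) ^ (N - 2) ≤
      (8 * (N - 1)) ^ (10 * N ^ 5 - 4 * (N - 1) ^ 4) := by
  rw [← pow_add, ← pow_mul]
  refine (Nat.pow_le_pow_left (show 2 ≤ 8 * (N - 1) by omega) _).trans
    (Nat.pow_le_pow_right (by omega) ?_)
  have h1 : (10 * N ^ 2 + N) * (N - 2) ≤ 11 * N ^ 3 := by
    calc (10 * N ^ 2 + N) * (N - 2) ≤ (10 * N ^ 2 + N ^ 2) * N :=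
          Nat.mul_le_mul (Nat.add_le_add_left (Nat.le_self_pow two_ne_zero N) _) (Nat.sub_le _ _)
      _ = 11 * N ^ 3 := by ring
  have h2 : (N - 1) ^ 4 ≤ N ^ 4 := Nat.pow_le_pow_left (Nat.sub_le _ _) 4
  have h3 : N ^ 4 * 2 ≤ N ^ 5 := by rw [pow_succ N 4]; exact Nat.mul_le_mul_left _ hN
  have h4 : N ^ 3 * 2 ≤ N ^ 4 := by rw [pow_succ N 3]; exact Nat.mul_le_mul_left _ hN
  omega

/-- Proportional vectors of powers of multiplicatively independent bases agree. -/
theorem eq_of_par {ι : Type*} [Fintype ι] {k l : ℕ} (hk : 2 ≤ k) (hl : 2 ≤ l)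
    (hkl : MultIndep k l) {g : ι → ℕ} {i j : ι} (hi : g i = k) (hj : g j = l) {e f : ι → ℤ}
    {v : ι → ℚ} (hv : ∀ i, v i ≠ 0) (h1 : Par Finset.univ (pw g e) v)
    (h2 : Par Finset.univ (pw g f) v) : pw g e = pw g f := by
  have hpar : ∀ x y, pw g e x * pw g f y = pw g e y * pw g f x := fun x y => by
    have h1 := h1 x (Finset.mem_univ _) y (Finset.mem_univ _)
    have h2 := h2 x (Finset.mem_univ _) y (Finset.mem_univ _)
    apply mul_right_cancel₀ (mul_ne_zero (hv x) (hv y))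
    linear_combination pw g f y * v x * h1 - pw g e y * v x * h2
  have hk0 : (k : ℚ) ≠ 0 := by positivity
  have hl0 : (l : ℚ) ≠ 0 := by positivity
  have hij := hpar i j
  simp only [pw, hi, hj] at hij
  have hef : e i = f i := by
    have := (hkl (e i - f i) (e j - f j) (by
      rw [zpow_sub₀ hk0, zpow_sub₀ hl0, div_eq_div_iff (zpow_ne_zero _ hk0) (zpow_ne_zero _ hl0),
        hij])).1
    omega
  have hpi : pw g e i = pw g f i := by rw [pw, pw, hef]
  have hne : pw g f i ≠ 0 := by rw [pw, hi]; exact zpow_ne_zero _ hk0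
  funext x
  have := hpar i x
  rw [hpi, mul_comm] at this
  exact (mul_right_cancel₀ hne this).symm

end SUnit

/-- If `k` and `ℓ` are multiplicatively independent, `n, m ≥ 1`, and
`a₁, …, aₙ, b₁, …, bₘ` are nonzero rationals, then there are at most
`(8(n+m-1))^{10(n+m)^5 - 4(n+m-1)^4}` tuples `(X₁, …, Xₙ, Y₁, …, Yₘ)` with
each `Xᵢ` an integer power of `k`, each `Yⱼ` an integer power of `ℓ`,
`a₁X₁ + ⋯ + aₙXₙ + b₁Y₁ + ⋯ + bₘYₘ = 0`, and no proper nonempty subsum of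
the left-hand side vanishing. -/
theorem sunit_count_nondegenerate
    (k l : ℕ) (hk : 2 ≤ k) (hl : 2 ≤ l) (hkl : MultIndep k l)
    (n m : ℕ) (hn : 1 ≤ n) (hm : 1 ≤ m)
    (a : Fin n → ℚ) (b : Fin m → ℚ) (ha : ∀ i, a i ≠ 0) (hb : ∀ j, b j ≠ 0)
    (T : Set ((Fin n → ℚ) × (Fin m → ℚ)))
    (hT : T = { p | (∀ i, ∃ e : ℤ, p.1 i = (k : ℚ) ^ e) ∧
                    (∀ j, ∃ e : ℤ, p.2 j = (l : ℚ) ^ e) ∧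
                    (∑ i, a i * p.1 i) + (∑ j, b j * p.2 j) = 0 ∧
                    ∀ (I : Finset (Fin n)) (J : Finset (Fin m)),
                      (I.Nonempty ∨ J.Nonempty) →
                      ¬(I = Finset.univ ∧ J = Finset.univ) →
                      (∑ i ∈ I, a i * p.1 i) + (∑ j ∈ J, b j * p.2 j) ≠ 0 }) :
    T.Finite ∧ T.ncard ≤ (8 * (n + m - 1)) ^ (10 * (n + m) ^ 5 - 4 * (n + m - 1) ^ 4) := by
  classical
  let g : Fin n ⊕ Fin m → ℕ := Sum.elim (fun _ => k) fun _ => l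
  have hg : ∀ i, g i = k ∨ g i = l := by rintro (i | i) <;> simp [g]
  have hg0 : ∀ i, (g i : ℚ) ≠ 0 := fun i => by rcases hg i with h | h <;> rw [h] <;> positivity
  have hcard : Fintype.card (Fin n ⊕ Fin m) = n + m := by simp
  obtain ⟨V, hV1, hV2, hV3⟩ := SUnit.reps_of_relations (P := Set.range (SUnit.pw g))
    (by rintro _ ⟨e, rfl⟩ i; exact zpow_ne_zero _ (hg0 i))
    (SUnit.exists_relations hk hl hg) (n + m) Finset.univ (Sum.elim a b)
    (by rw [Finset.card_univ, hcard]) (by omega) (by rintro (i | i) - <;> simp [ha, hb])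
  rw [hcard] at hV1
  have hmem : ∀ p ∈ T, (Sum.elim p.1 p.2 : Fin n ⊕ Fin m → ℚ) ∈ Set.range (SUnit.pw g) ∧
      SUnit.Nondeg Finset.univ (Sum.elim a b) (Sum.elim p.1 p.2) := by
    intro p hp
    rw [hT] at hp
    obtain ⟨h1, h2, h3, h4⟩ := hp
    choose e he using h1
    choose f hf using h2
    refine ⟨⟨Sum.elim e f, ?_⟩, by simpa using h3, fun I _ hI hne => ?_⟩
    · funext i
      rcases i with i | i <;> simp [SUnit.pw, g, he, hf]
    · rw [← Finset.toLeft_disjSum_toRight (u := I), Finset.sum_disjSum]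
      refine h4 I.toLeft I.toRight ?_ ?_
      · by_contra! h
        rw [← Finset.toLeft_disjSum_toRight (u := I), h.1, h.2] at hI
        simp at hI
      · rintro ⟨hl, hr⟩
        rw [← Finset.toLeft_disjSum_toRight (u := I), hl, hr] at hne
        simp at hne
  choose! v hv hpar using fun p hp => hV3 _ (hmem p hp)
  have hinj : Set.InjOn v T := by
    intro p hp q hq hpq
    obtain ⟨⟨e, he⟩, -⟩ := hmem p hp
    obtain ⟨⟨f, hf⟩, -⟩ := hmem q hq
    have h1 := hpar p hp
    have h2 := hpar q hq
    rw [← he] at h1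
    rw [← hf, ← hpq] at h2
    have := SUnit.eq_of_par hk hl hkl (i := Sum.inl ⟨0, hn⟩) (j := Sum.inr ⟨0, hm⟩) rfl rfl
      (fun i => hV2 _ (hv p hp) i (Finset.mem_univ i)) h1 h2
    rw [he, hf] at this
    exact Prod.ext (funext fun i => congrFun this (Sum.inl i))
      (funext fun i => congrFun this (Sum.inr i))
  refine ⟨Set.Finite.of_injOn (fun p hp => hv p hp) hinj V.finite_toSet, ?_⟩
  calc T.ncard ≤ (V : Set (Fin n ⊕ Fin m → ℚ)).ncard :=
        Set.ncard_le_ncard_of_injOn v (fun p hp => hv p hp) hinj V.finite_toSet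
    _ = V.card := Set.ncard_coe_finset V
    _ ≤ _ := hV1.trans (SUnit.count_bound (by omega))
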